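/- Let n ≥ 2, m = 2.46, ε₀ = √((m−1)/(m+1)) = √(73/173), and θ ∈ (2 arccos ε₀, π). Let M > 0 and set T₁ = min{1/(256M), 1/(12M²), 1/2}. If u : C_θ × [0,1) → ℝ is continuous, twice continuously differentiable in x and once continuously differentiable in t on C_θ × (0,1), and satisfies |∂_t u + Δu| ≤ M(|u| + |∇u|) on C_θ × (0,1), |u(x,t)| ≤ M e^{M|x|²} on C_θ × (0,1), and u(x,0) = 0 for all x ∈ C_θ, then u(x,t) = 0 for all (x,t) ∈ C_θ × (0,T₁). -/

import Mathlib

open Set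

/-- The open cone `C_θ = {x : x₁ > |x| cos(θ/2)}` in `ℝⁿ`. -/
def cone {n : ℕ} (hn : 0 < n) (θ : ℝ) : Set (EuclideanSpace ℝ (Fin n)) :=
  {x | ‖x‖ * Real.cos (θ / 2) < x ⟨0, hn⟩}

/-- The Laplacian (in the `x` variables) of `g : ℝⁿ → ℝ` at `x`. -/
noncomputable def lap {n : ℕ} (g : EuclideanSpace ℝ (Fin n) → ℝ)
    (x : EuclideanSpace ℝ (Fin n)) : ℝ :=
  ∑ i : Fin n, iteratedFDeriv ℝ 2 g x
    ![EuclideanSpace.single i 1, EuclideanSpace.single i 1]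

section Mine
set_option linter.all false
open MeasureTheory Filter Topology
open scoped ContDiff

set_option linter.unusedSimpArgs false
/-- ambient space -/
abbrev EE (n : ℕ) := EuclideanSpace ℝ (Fin n)
/-- space-time -/
abbrev ZZ (n : ℕ) := EE n × ℝ
/-- basis vector -/
noncomputable def bb {n : ℕ} (i : Fin n) : EE n := EuclideanSpace.single i 1
/-- slice derivative -/
noncomputable def gx {n : ℕ} (i : Fin n) (f : ZZ n → ℝ) (z : ZZ n) : ℝ :=
  fderiv ℝ (fun y => f (y, z.2)) z.1 (bb i)
/-- time derivative -/
noncomputable def gt {n : ℕ} (f : ZZ n → ℝ) (z : ZZ n) : ℝ :=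
  fderiv ℝ (fun s => f (z.1, s)) z.2 1

theorem gx_eq {n : ℕ} {i : Fin n} {f : ZZ n → ℝ} {z : ZZ n} (h : DifferentiableAt ℝ f z) :
    gx i f z = fderiv ℝ f z (bb i, 0) := by
  have h1 : HasFDerivAt (fun y : EE n => (y, z.2)) (ContinuousLinearMap.inl ℝ (EE n) ℝ) z.1 :=
    hasFDerivAt_prodMk_left z.1 z.2
  have := (HasFDerivAt.comp z.1 (f := fun y : EE n => (y, z.2)) (g := f)
    (by exact h.hasFDerivAt) h1)
  unfold gx
  rw [show (fun y => f (y, z.2)) = f ∘ (fun y : EE n => (y, z.2)) from rfl, this.fderiv]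
  simp

theorem gt_eq {n : ℕ} {f : ZZ n → ℝ} {z : ZZ n} (h : DifferentiableAt ℝ f z) :
    gt f z = fderiv ℝ f z (0, 1) := by
  have h1 : HasFDerivAt (fun s : ℝ => (z.1, s)) (ContinuousLinearMap.inr ℝ (EE n) ℝ) z.2 :=
    hasFDerivAt_prodMk_right z.1 z.2
  have := (HasFDerivAt.comp z.2 (f := fun s : ℝ => (z.1, s)) (g := f)
    (by exact h.hasFDerivAt) h1)
  unfold gt
  rw [show (fun s => f (z.1, s)) = f ∘ (fun s : ℝ => (z.1, s)) from rfl, this.fderiv]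
  simp

theorem int_fderiv_zero {V : Type*} [NormedAddCommGroup V] [NormedSpace ℝ V] [MeasurableSpace V]
    [BorelSpace V] [FiniteDimensional ℝ V] {μ : Measure V} [μ.IsAddHaarMeasure]
    {g : V → ℝ} (hg : ContDiff ℝ 1 g) (hc : HasCompactSupport g) (v : V) :
    ∫ x, fderiv ℝ g x v ∂μ = 0 := by
  have hc' : HasCompactSupport (fun x => fderiv ℝ g x v) := by
    apply hc.mono'
    intro x hx
    by_contra h
    exact hx (by simp [image_eq_zero_of_notMem_tsupport
      (fun h' => h (tsupport_fderiv_subset ℝ h'))])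
  have h1 : Integrable (fun x => fderiv ℝ g x v) μ :=
    ((hg.continuous_fderiv (by simp)).clm_apply continuous_const).integrable_of_hasCompactSupport hc'
  have h2 : Integrable g μ := hg.continuous.integrable_of_hasCompactSupport hc
  have := integral_mul_fderiv_eq_neg_fderiv_mul_of_integrable (μ := μ) (f := fun _ : V => (1 : ℝ))
    (g := g) (v := v) (by simp) (by simpa using h1) (by simpa using h2)
    (fun x _ => differentiableAt_const _) (fun x _ => (hg.differentiable (by simp)) x)
  simpa using this

/-- smooth functions -/
def SS (n : ℕ) : Subalgebra ℝ (ZZ n → ℝ) where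
  carrier := {f | ContDiff ℝ ∞ f}
  mul_mem' := fun {a b} (ha : ContDiff ℝ ∞ a) (hb : ContDiff ℝ ∞ b) => ContDiff.mul ha hb
  add_mem' := fun {a b} (ha : ContDiff ℝ ∞ a) (hb : ContDiff ℝ ∞ b) => ContDiff.add ha hb
  algebraMap_mem' := fun r => (contDiff_const : ContDiff ℝ ∞ (fun _ : ZZ n => r))

theorem scd {n : ℕ} (f : SS n) : ContDiff ℝ ∞ f.1 := f.2

/-- directional derivation -/
noncomputable def DD {n : ℕ} (v : ZZ n) : Derivation ℝ (SS n) (SS n) where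
  toFun f := ⟨fun z => fderiv ℝ f.1 z v, ((scd f).fderiv_right (m := ∞) (by simp)).clm_apply contDiff_const⟩
  map_add' f g := by
    ext z
    have h1 : DifferentiableAt ℝ f.1 z := ((scd f).differentiable (by simp)) z
    have h2 : DifferentiableAt ℝ g.1 z := ((scd g).differentiable (by simp)) z
    simp [fderiv_add h1 h2]
  map_smul' c f := by
    ext z
    have h1 : DifferentiableAt ℝ f.1 z := ((scd f).differentiable (by simp)) z
    simp [fderiv_const_smul h1]
  map_one_eq_zero' := by
    ext z
    simp [Pi.one_def]
  leibniz' f g := by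
    ext z
    have h1 : DifferentiableAt ℝ f.1 z := ((scd f).differentiable (by simp)) z
    have h2 : DifferentiableAt ℝ g.1 z := ((scd g).differentiable (by simp)) z
    simp [fderiv_mul h1 h2]

theorem DD_comm {n : ℕ} (v w : ZZ n) (f : SS n) : DD v (DD w f) = DD w (DD v f) := by
  ext z
  have h2 : DifferentiableAt ℝ (fderiv ℝ f.1) z :=
    (((scd f).fderiv_right (m := ∞) (by simp)).differentiable (by simp)) z
  have hs : IsSymmSndFDerivAt ℝ f.1 z := (scd f).contDiffAt.isSymmSndFDerivAt (by simpa using (show (2 : WithTop ℕ∞) ≤ ∞ from WithTop.coe_le_coe.2 le_top))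
  show fderiv ℝ (fun y => fderiv ℝ f.1 y w) z v = fderiv ℝ (fun y => fderiv ℝ f.1 y v) z w
  rw [fderiv_clm_apply h2 (differentiableAt_const _), fderiv_clm_apply h2 (differentiableAt_const _)]
  simpa using hs.eq v w

/-- space derivation -/
noncomputable def XX {n : ℕ} (i : Fin n) : Derivation ℝ (SS n) (SS n) := DD (bb i, 0)
/-- time derivation -/
noncomputable def TT {n : ℕ} : Derivation ℝ (SS n) (SS n) := DD (0, 1)
/-- Laplacian -/
noncomputable def LL {n : ℕ} (f : SS n) : SS n := ∑ i, XX i (XX i f)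
/-- potential of the symmetric part -/
noncomputable def VV {n : ℕ} (φ : SS n) : SS n := ∑ i, XX i φ ^ 2 - TT φ
/-- zeroth order coefficient -/
noncomputable def pot {n : ℕ} (φ F : SS n) : SS n :=
  4 * (∑ j, ∑ i, XX j (XX i φ) * XX i φ * XX j φ) - 4 * (∑ i, XX i φ * XX i (TT φ)) + TT (TT φ)
    - LL (LL φ) - 2 * F * VV φ - LL F - F ^ 2

theorem carl_id {n : ℕ} (w φ F : SS n) :
    2 * (LL w + VV φ * w) * (TT w - 2 * (∑ i, XX i φ * XX i w) - LL φ * w)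
      - 2 * F * w * (LL w + VV φ * w) - F ^ 2 * w ^ 2 =
    4 * (∑ j, ∑ i, XX j (XX i φ) * XX i w * XX j w) + 2 * F * (∑ i, XX i w ^ 2) + pot φ F * w ^ 2
      + (∑ j, XX j (2 * (XX j w * TT w) + (∑ i, -4 * (XX j w * XX i φ * XX i w)) +
          (∑ i, 2 * (XX j φ * XX i w ^ 2)) - 2 * (XX j w * LL φ * w) + w ^ 2 * XX j (LL φ)
          - 2 * (VV φ * XX j φ * w ^ 2) - 2 * (F * w * XX j w) + XX j F * w ^ 2)
        + TT (VV φ * w ^ 2 - ∑ j, XX j w ^ 2)) := by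
  have c0 : ∀ (D : Derivation ℝ (SS n) (SS n)), D 2 = 0 := fun D => by
    have := D.map_natCast 2; simpa using this
  have c4 : ∀ (D : Derivation ℝ (SS n) (SS n)), D 4 = 0 := fun D => by
    have := D.map_natCast 4; simpa using this
  have ct : ∀ i (f : SS n), TT (XX i f) = XX i (TT f) := fun i f => DD_comm _ _ _
  have cx : ∀ i j (f : SS n), XX i (XX j f) = XX j (XX i f) := fun i j f => DD_comm _ _ _
  have p1 : 2 * LL w * TT w = (∑ j, XX j (2 * (XX j w * TT w))) - TT (∑ j, XX j w ^ 2) := by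
    simp only [LL, map_sum, Finset.mul_sum, Finset.sum_mul, ← Finset.sum_sub_distrib]
    refine Finset.sum_congr rfl fun j _ => ?_
    simp only [Derivation.leibniz, Derivation.leibniz_pow, smul_eq_mul, c0, ct, nsmul_eq_mul]
    push_cast; ring
  have p2 : -4 * LL w * (∑ i, XX i φ * XX i w) = 4 * (∑ j, ∑ i, XX j (XX i φ) * XX i w * XX j w)
      - 2 * LL φ * (∑ i, XX i w ^ 2) + (∑ j, XX j (∑ i, -4 * (XX j w * XX i φ * XX i w)))
      + (∑ j, XX j (∑ i, 2 * (XX j φ * XX i w ^ 2))) := by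
    have e1 : (∑ j, XX j (∑ i, 2 * (XX j φ * XX i w ^ 2))) =
        ∑ j, ∑ i, XX i (2 * (XX i φ * XX j w ^ 2)) := by
      simp only [map_sum]; rw [Finset.sum_comm]
    have e2 : LL φ * (∑ i, XX i w ^ 2) = ∑ j, ∑ i, XX i (XX i φ) * XX j w ^ 2 := by
      rw [LL, Finset.sum_mul_sum, Finset.sum_comm]
    rw [mul_assoc 2, e1, e2, LL, mul_assoc, Finset.sum_mul_sum]
    simp only [map_sum, Finset.mul_sum, ← Finset.sum_sub_distrib, ← Finset.sum_add_distrib]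
    refine Finset.sum_congr rfl fun j _ => Finset.sum_congr rfl fun i _ => ?_
    simp only [Derivation.leibniz, Derivation.leibniz_pow, smul_eq_mul, c0, c4, nsmul_eq_mul,
      map_neg, cx j i w]
    push_cast; ring
  have p3 : -2 * LL w * LL φ * w = (∑ j, XX j (- 2 * (XX j w * LL φ * w) + w ^ 2 * XX j (LL φ)))
      + 2 * LL φ * (∑ i, XX i w ^ 2) - LL (LL φ) * w ^ 2 := by
    generalize LL φ = a
    simp only [LL, map_sum, Finset.mul_sum, Finset.sum_mul, ← Finset.sum_sub_distrib,
      ← Finset.sum_add_distrib]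
    refine Finset.sum_congr rfl fun j _ => ?_
    simp only [Derivation.leibniz, Derivation.leibniz_pow, smul_eq_mul, c0, nsmul_eq_mul, map_add,
      map_neg]
    push_cast; ring
  have p4 : -4 * VV φ * w * (∑ i, XX i φ * XX i w) = (∑ j, XX j (- 2 * (VV φ * XX j φ * w ^ 2)))
      + 2 * (∑ i, XX i (VV φ) * XX i φ) * w ^ 2 + 2 * VV φ * LL φ * w ^ 2 := by
    generalize VV φ = a
    simp only [LL, map_sum, Finset.mul_sum, Finset.sum_mul, ← Finset.sum_add_distrib]
    refine Finset.sum_congr rfl fun j _ => ?_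
    simp only [Derivation.leibniz, Derivation.leibniz_pow, smul_eq_mul, c0, nsmul_eq_mul, map_add,
      map_neg]
    push_cast; ring
  have p5 : -2 * F * w * LL w = (∑ j, XX j (- 2 * (F * w * XX j w) + XX j F * w ^ 2))
      + 2 * F * (∑ i, XX i w ^ 2) - LL F * w ^ 2 := by
    simp only [LL, map_sum, Finset.mul_sum, Finset.sum_mul, ← Finset.sum_sub_distrib,
      ← Finset.sum_add_distrib]
    refine Finset.sum_congr rfl fun j _ => ?_
    simp only [Derivation.leibniz, Derivation.leibniz_pow, smul_eq_mul, c0, nsmul_eq_mul, map_add,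
      map_neg]
    push_cast; ring
  have p6 : 2 * (∑ i, XX i (VV φ) * XX i φ) = 4 * (∑ j, ∑ i, XX j (XX i φ) * XX i φ * XX j φ)
      - 2 * (∑ i, XX i φ * XX i (TT φ)) := by
    simp only [VV, map_sub, map_sum, Finset.mul_sum, Finset.sum_mul, ← Finset.sum_sub_distrib]
    refine Finset.sum_congr rfl fun j _ => ?_
    simp only [sub_mul, mul_sub, Finset.sum_mul, Finset.mul_sum]
    congr 1
    · refine Finset.sum_congr rfl fun i _ => ?_
      simp only [Derivation.leibniz_pow, smul_eq_mul, nsmul_eq_mul]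
      push_cast; ring
    · ring
  have p7 : TT (VV φ) = 2 * (∑ i, XX i φ * XX i (TT φ)) - TT (TT φ) := by
    simp only [VV, map_sub, map_sum, Finset.mul_sum]
    congr 1
    refine Finset.sum_congr rfl fun i _ => ?_
    simp only [Derivation.leibniz_pow, smul_eq_mul, nsmul_eq_mul, ct]
    push_cast; ring
  have p8 : TT (VV φ * w ^ 2) = TT (VV φ) * w ^ 2 + 2 * VV φ * w * TT w := by
    simp only [Derivation.leibniz, Derivation.leibniz_pow, smul_eq_mul, nsmul_eq_mul]
    push_cast; ring
  rw [map_sub TT]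
  have e : ∀ j, XX j (2 * (XX j w * TT w) + (∑ i, -4 * (XX j w * XX i φ * XX i w)) +
          (∑ i, 2 * (XX j φ * XX i w ^ 2)) - 2 * (XX j w * LL φ * w) + w ^ 2 * XX j (LL φ)
          - 2 * (VV φ * XX j φ * w ^ 2) - 2 * (F * w * XX j w) + XX j F * w ^ 2) =
      XX j (2 * (XX j w * TT w)) + XX j (∑ i, -4 * (XX j w * XX i φ * XX i w)) +
      XX j (∑ i, 2 * (XX j φ * XX i w ^ 2)) +
      XX j (- 2 * (XX j w * LL φ * w) + w ^ 2 * XX j (LL φ)) +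
      XX j (- 2 * (VV φ * XX j φ * w ^ 2)) + XX j (- 2 * (F * w * XX j w) + XX j F * w ^ 2) := by
    intro j
    simp only [← map_add]
    congr 1; ring
  simp only [e, Finset.sum_add_distrib]
  rw [pot]
  linear_combination p1 + p2 + p3 + p4 + p5 - p8 + w ^ 2 * p6 - w ^ 2 * p7

instance haarZ {n : ℕ} : (volume : Measure (ZZ n)).IsAddHaarMeasure :=
  Measure.prod.instIsAddHaarMeasure (volume : Measure (EE n)) (volume : Measure ℝ)

/-- evaluation -/
def ev {n : ℕ} (z : ZZ n) : SS n →ₐ[ℝ] ℝ := (Pi.evalAlgHom ℝ (fun _ : ZZ n => ℝ) z).comp (SS n).val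

theorem ev_def {n : ℕ} (z : ZZ n) (f : SS n) : ev z f = f.1 z := rfl

/-- exponential of a smooth function -/
noncomputable def eS {n : ℕ} (φ : SS n) : SS n := ⟨fun z => Real.exp (φ.1 z), (scd φ).exp⟩

theorem DD_eS {n : ℕ} (v : ZZ n) (φ : SS n) : DD v (eS φ) = DD v φ * eS φ := by
  ext z
  have h1 : DifferentiableAt ℝ φ.1 z := ((scd φ).differentiable (by simp)) z
  show fderiv ℝ (fun y => Real.exp (φ.1 y)) z v = fderiv ℝ φ.1 z v * Real.exp (φ.1 z)
  rw [fderiv_exp h1]; simp [mul_comm]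

theorem conj_id {n : ℕ} (V φ : SS n) : LL (eS φ * V) + VV φ * (eS φ * V) +
    (TT (eS φ * V) - 2 * (∑ i, XX i φ * XX i (eS φ * V)) - LL φ * (eS φ * V)) =
    eS φ * (LL V + TT V) := by
  have ex : ∀ i, XX i (eS φ) = XX i φ * eS φ := fun i => DD_eS _ _
  have et : TT (eS φ) = TT φ * eS φ := DD_eS _ _
  have h1 : LL (eS φ * V) = eS φ * LL V + 2 * eS φ * (∑ i, XX i φ * XX i V) + eS φ * V * LL φ
      + eS φ * V * (∑ i, XX i φ ^ 2) := by
    simp only [LL, Finset.mul_sum, ← Finset.sum_add_distrib]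
    refine Finset.sum_congr rfl fun i _ => ?_
    simp only [Derivation.leibniz, smul_eq_mul, map_add, ex]
    ring
  have h2 : (∑ i, XX i φ * XX i (eS φ * V)) = eS φ * (∑ i, XX i φ * XX i V)
      + eS φ * V * (∑ i, XX i φ ^ 2) := by
    simp only [Finset.mul_sum, ← Finset.sum_add_distrib]
    refine Finset.sum_congr rfl fun i _ => ?_
    simp only [Derivation.leibniz, smul_eq_mul, ex]
    ring
  rw [h1, h2, VV, Derivation.leibniz, et]
  simp only [smul_eq_mul]
  ring

theorem DD_off {n : ℕ} {K : Set (ZZ n)} (hK : IsClosed K) {f : SS n} (h : ∀ z ∉ K, f.1 z = 0) (v : ZZ n) :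
    ∀ z ∉ K, (DD v f).1 z = 0 := by
  intro z hz
  have : f.1 =ᶠ[𝓝 z] fun _ => 0 := by
    filter_upwards [hK.isOpen_compl.mem_nhds hz] with y hy using h y hy
  show fderiv ℝ f.1 z v = 0
  rw [this.fderiv_eq]; simp

theorem DD_int {n : ℕ} {K : Set (ZZ n)} (hK : IsCompact K) {f : SS n} (h : ∀ z ∉ K, f.1 z = 0) (v : ZZ n) :
    Integrable (DD v f).1 ∧ ∫ z, (DD v f).1 z = 0 := by
  have hc : HasCompactSupport f.1 := HasCompactSupport.intro hK h
  refine ⟨(scd (DD v f)).continuous.integrable_of_hasCompactSupport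
    (HasCompactSupport.intro hK (DD_off hK.isClosed h v)), ?_⟩
  exact int_fderiv_zero ((scd f).of_le (mod_cast le_top)) hc v

theorem carl1 {n : ℕ} (V φ F : SS n) (hc : HasCompactSupport V.1) {A : ℝ} (hA : 0 ≤ A)
    (hq : ∀ z ∈ tsupport V.1, ∀ ξ : Fin n → ℝ, A * ∑ i, ξ i ^ 2 ≤
      4 * (∑ j, ∑ i, (XX j (XX i φ)).1 z * ξ i * ξ j) + 2 * F.1 z * ∑ i, ξ i ^ 2)
    (hp : ∀ z ∈ tsupport V.1, A * (1 + ∑ i, (XX i φ).1 z ^ 2) ≤ (pot φ F).1 z) :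
    A * ∫ z, Real.exp (φ.1 z) ^ 2 * (V.1 z ^ 2 + 1 / 2 * ∑ i, (XX i V).1 z ^ 2) ≤
      ∫ z, Real.exp (φ.1 z) ^ 2 * ((LL V).1 z + (TT V).1 z) ^ 2 := by
  set K := tsupport V.1
  have hK : IsCompact K := hc
  have hV : ∀ z ∉ K, V.1 z = 0 := fun z hz => image_eq_zero_of_notMem_tsupport hz
  set w := eS φ * V with hw
  have hw0 : ∀ z ∉ K, w.1 z = 0 := fun z hz => by
    show _ * V.1 z = 0
    rw [hV z hz, mul_zero]
  have hX : ∀ (f : SS n), (∀ z ∉ K, f.1 z = 0) → ∀ i, ∀ z ∉ K, (XX i f).1 z = 0 :=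
    fun f h i => DD_off hK.isClosed h _
  have hT : ∀ (f : SS n), (∀ z ∉ K, f.1 z = 0) → ∀ z ∉ K, (TT f).1 z = 0 :=
    fun f h => DD_off hK.isClosed h _
  have hL : ∀ (f : SS n), (∀ z ∉ K, f.1 z = 0) → ∀ z ∉ K, (LL f).1 z = 0 := fun f h z hz => by
    rw [← ev_def, LL, map_sum]
    exact Finset.sum_eq_zero fun i _ => hX _ (hX _ h i) i z hz
  have cid := conj_id V φ
  rw [← hw] at cid
  set G : Fin n → SS n := fun j => (2 * (XX j w * TT w) + (∑ i, -4 * (XX j w * XX i φ * XX i w)) +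
          (∑ i, 2 * (XX j φ * XX i w ^ 2)) - 2 * (XX j w * LL φ * w) + w ^ 2 * XX j (LL φ)
          - 2 * (VV φ * XX j φ * w ^ 2) - 2 * (F * w * XX j w) + XX j F * w ^ 2) with hG
  set G0 : SS n := VV φ * w ^ 2 - ∑ j, XX j w ^ 2 with hG0
  have hGK : ∀ j, ∀ z ∉ K, (G j).1 z = 0 := by
    intro j z hz
    have h1 : ∀ i, ev z (XX i w) = 0 := fun i => hX _ hw0 i z hz
    have h2 : ev z w = 0 := hw0 z hz
    rw [← ev_def, hG]
    simp [h1, h2]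
  have hG0K : ∀ z ∉ K, G0.1 z = 0 := by
    intro z hz
    have h1 : ∀ i, ev z (XX i w) = 0 := fun i => hX _ hw0 i z hz
    have h2 : ev z w = 0 := hw0 z hz
    rw [← ev_def, hG0]
    simp [h1, h2]
  have id : 2 * (LL w + VV φ * w) * (TT w - 2 * (∑ i, XX i φ * XX i w) - LL φ * w)
      - 2 * F * w * (LL w + VV φ * w) - F ^ 2 * w ^ 2 =
      4 * (∑ j, ∑ i, XX j (XX i φ) * XX i w * XX j w) + 2 * F * (∑ i, XX i w ^ 2) + pot φ F * w ^ 2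
      + (∑ j, XX j (G j) + TT G0) := carl_id w φ F
  clear_value G G0
  have i0 : ∫ z, ((∑ j, (XX j (G j)).1 z) + (TT G0).1 z) = 0 := by
    have a1 : ∀ j, Integrable (XX j (G j)).1 := fun j => (DD_int hK (hGK j) _).1
    have a2 : Integrable (TT G0).1 := (DD_int hK hG0K _).1
    rw [integral_add (integrable_finsetSum _ fun j _ => a1 j) a2,
      integral_finsetSum _ fun j _ => a1 j]
    rw [show ∫ z, (TT G0).1 z = 0 from (DD_int hK hG0K _).2, add_zero]
    exact Finset.sum_eq_zero fun j _ => (DD_int hK (hGK j) _).2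
  have ii : Integrable (fun z => (∑ j, (XX j (G j)).1 z) + (TT G0).1 z) :=
    (integrable_finsetSum _ fun j _ => (DD_int hK (hGK j) _).1).add (DD_int hK hG0K _).1
  have ecd : ∀ f : SS n, Continuous f.1 := fun f => (scd f).continuous
  have i1 : Integrable (fun z => Real.exp (φ.1 z) ^ 2 * (V.1 z ^ 2 + 1 / 2 * ∑ i, (XX i V).1 z ^ 2)) := by
    apply Continuous.integrable_of_hasCompactSupport
    · have := ecd φ; have := ecd V; have := fun i => ecd (XX i V)
      fun_prop
    · refine HasCompactSupport.intro hK fun z hz => ?_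
      simp [hV z hz, fun i => hX _ hV i z hz]
  have i2 : Integrable (fun z => Real.exp (φ.1 z) ^ 2 * ((LL V).1 z + (TT V).1 z) ^ 2) := by
    apply Continuous.integrable_of_hasCompactSupport
    · have := ecd φ; have := ecd (LL V); have := ecd (TT V)
      fun_prop
    · refine HasCompactSupport.intro hK fun z hz => ?_
      simp [hL _ hV z hz, hT _ hV z hz]
  rw [← integral_const_mul, ← add_zero (∫ z, A * _), ← i0, ← integral_add (i1.const_mul _) ii]
  refine integral_mono ((i1.const_mul _).add ii) i2 fun z => ?_
  have idz := congrArg (ev z) id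
  have cidz := congrArg (ev z) cid
  simp only [map_add, map_mul, map_sub, map_sum, map_pow, map_ofNat] at idz cidz
  have e1 : ev z (eS φ) = Real.exp (φ.1 z) := rfl
  simp only [← ev_def]
  show A * (Real.exp (ev z φ) ^ 2 * _) + _ ≤ Real.exp (ev z φ) ^ 2 * _
  rw [show Real.exp (ev z φ) = ev z (eS φ) from rfl, ← mul_pow, ← cidz]
  by_cases hz : z ∈ K
  · have q := hq z hz (fun i => ev z (XX i w))
    have p := mul_le_mul_of_nonneg_right (hp z hz) (sq_nonneg (ev z w))
    simp only [← ev_def] at q p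
    have key : A * (ev z (eS φ) ^ 2 * (ev z V ^ 2 + 1 / 2 * ∑ i, ev z (XX i V) ^ 2)) ≤
        A * ∑ i, ev z (XX i w) ^ 2 + A * (1 + ∑ i, ev z (XX i φ) ^ 2) * ev z w ^ 2 := by
      rw [mul_assoc A (1 + _), ← mul_add]
      apply mul_le_mul_of_nonneg_left _ hA
      have : ev z w = ev z (eS φ) * ev z V := by rw [hw, map_mul]
      have h3 : ev z (eS φ) ^ 2 * ∑ i, ev z (XX i V) ^ 2 ≤
          2 * ∑ i, ev z (XX i w) ^ 2 + 2 * (∑ i, ev z (XX i φ) ^ 2) * ev z w ^ 2 := by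
        simp only [Finset.mul_sum, Finset.sum_mul, ← Finset.sum_add_distrib]
        refine Finset.sum_le_sum fun i _ => ?_
        have : ev z (XX i w) = ev z (eS φ) * ev z (XX i V) + ev z w * ev z (XX i φ) := by
          rw [hw, Derivation.leibniz, show XX i (eS φ) = XX i φ * eS φ from DD_eS _ _]
          simp only [map_add, map_mul, smul_eq_mul]; ring
        rw [this]
        nlinarith [sq_nonneg (ev z (eS φ) * ev z (XX i V) + 2 * (ev z w * ev z (XX i φ)))]
      rw [this] at h3 ⊢
      nlinarith
    nlinarith [sq_nonneg (ev z (LL w) + ev z (VV φ) * ev z w + ev z F * ev z w),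
      sq_nonneg (ev z (TT w) - 2 * (∑ i, ev z (XX i φ) * ev z (XX i w)) - ev z (LL φ) * ev z w)]
  · have h1 : ∀ i, ev z (XX i w) = 0 := fun i => hX _ hw0 i z hz
    have h2 : ev z w = 0 := hw0 z hz
    have h3 : ∀ j, ev z (XX j (G j)) = 0 := fun j => hX _ (hGK j) j z hz
    have h4 : ev z (TT G0) = 0 := hT _ hG0K z hz
    have h5 : ev z V = 0 := hV z hz
    have h6 : ∀ i, ev z (XX i V) = 0 := fun i => hX _ hV i z hz
    simp only [h3, h4, h5, h6]
    simp only [ne_eq, OfNat.ofNat_ne_zero, not_false_eq_true, zero_pow, Finset.sum_const_zero,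
      mul_zero, add_zero]
    positivity

/-- solutions vanishing for nonpositive times -/
structure Sol {n : ℕ} (Ω : Set (EE n)) (T M : ℝ) (u : ZZ n → ℝ) : Prop where
  op : IsOpen Ω
  M0 : 0 ≤ M
  zero : ∀ x t, t ≤ 0 → u (x, t) = 0
  cont : ContinuousOn u (Ω ×ˢ Iio T)
  cx : ∀ t ∈ Ioo 0 T, ContDiffOn ℝ 2 (fun x => u (x, t)) Ω
  eq : ∀ x ∈ Ω, ∀ t ∈ Ioo 0 T, ∃ d, HasDerivAt (fun s => u (x, s)) d t ∧
    |d + ∑ i, gx i (gx i u) (x, t)| ≤ M * (|u (x, t)| + √(∑ i, gx i u (x, t) ^ 2))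

/-- second directional derivative -/
noncomputable def d2 {n : ℕ} (v : EE n) (f : EE n → ℝ) (x : EE n) : ℝ :=
  fderiv ℝ (fun y => fderiv ℝ f y v) x v

theorem gx_gx {n : ℕ} (i : Fin n) (u : ZZ n → ℝ) (x : EE n) (t : ℝ) :
    gx i (gx i u) (x, t) = d2 (bb i) (fun y => u (y, t)) x := rfl

theorem d2_line {n : ℕ} {f : EE n → ℝ} {x : EE n} (hf : ContDiffAt ℝ 2 f x) (v : EE n) :
    deriv (fun s : ℝ => f (x + s • v)) =ᶠ[𝓝 0] (fun s : ℝ => fderiv ℝ f (x + s • v) v) ∧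
    deriv (deriv (fun s : ℝ => f (x + s • v))) 0 = d2 v f x := by
  have hl : ∀ s : ℝ, HasDerivAt (fun s : ℝ => x + s • v) v s := fun s => by
    simpa using ((hasDerivAt_id s).smul_const v).const_add x
  have hc : ContinuousAt (fun s : ℝ => x + s • v) 0 := (hl 0).continuousAt
  have h1 : deriv (fun s : ℝ => f (x + s • v)) =ᶠ[𝓝 0] (fun s : ℝ => fderiv ℝ f (x + s • v) v) := by
    have e1 : ∀ᶠ y in 𝓝 (x + (0 : ℝ) • v), ContDiffAt ℝ 2 f y := by
      simpa using hf.eventually (by simp)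
    filter_upwards [hc.eventually e1] with s hs
    exact (((hs.differentiableAt (by simp)).hasFDerivAt).comp_hasDerivAt s (hl s)).deriv
  refine ⟨h1, ?_⟩
  rw [h1.deriv_eq]
  have h2 : DifferentiableAt ℝ (fun y => fderiv ℝ f y v) (x + (0 : ℝ) • v) := by
    have : DifferentiableAt ℝ (fderiv ℝ f) x :=
      (hf.fderiv_right (m := 1) (by norm_num)).differentiableAt (by simp)
    simpa using this.clm_apply (differentiableAt_const v)
  have := (h2.hasFDerivAt.comp_hasDerivAt (0 : ℝ) (hl 0)).deriv
  simpa [d2, Function.comp_def] using this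

theorem d2_max {n : ℕ} {f : EE n → ℝ} {x : EE n} (hf : ContDiffAt ℝ 2 f x) (hm : IsLocalMax f x)
    (v : EE n) : d2 v f x ≤ 0 := by
  by_contra! h
  obtain ⟨h1, h2⟩ := d2_line hf v
  have hc : ContinuousAt (fun s : ℝ => x + s • v) 0 := by fun_prop
  rw [← h2] at h
  have hd : deriv (fun s : ℝ => f (x + s • v)) 0 = 0 := by
    rw [h1.self_of_nhds]; simp [hm.fderiv_eq_zero]
  have hfc : ContinuousAt f (x + (0 : ℝ) • v) := by simpa using hf.continuousAt
  have hmin := isLocalMin_of_deriv_deriv_pos h hd (ContinuousAt.comp (f := fun s : ℝ => x + s • v)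
    hfc hc)
  have hmax : ∀ᶠ s in 𝓝 (0 : ℝ), f (x + s • v) ≤ f (x + (0 : ℝ) • v) := by
    have : ∀ᶠ y in 𝓝 (x + (0 : ℝ) • v), f y ≤ f (x + (0 : ℝ) • v) := by simp only [zero_smul, add_zero]; exact hm
    exact hc.eventually this
  have he : (fun s : ℝ => f (x + s • v)) =ᶠ[𝓝 0] fun _ => f (x + (0 : ℝ) • v) := by
    filter_upwards [hmin, hmax] with s a b using le_antisymm b a
  have := he.deriv.deriv_eq
  rw [this] at h
  simp at h

theorem fd_quad {n : ℕ} (c : ℝ) (x y v : EE n) :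
    HasFDerivAt (fun y : EE n => c * ‖y - x‖ ^ 2) ((2 * c) • innerSL ℝ (y - x)) y := by
  have := ((hasFDerivAt_id y).sub_const x).norm_sq.const_mul c
  refine this.congr_fderiv ?_
  ext w; simp; ring

theorem cd_quad {n : ℕ} (c : ℝ) (x : EE n) : ContDiff ℝ ∞ (fun y : EE n => c * ‖y - x‖ ^ 2) :=
  contDiff_const.mul ((contDiff_id.sub contDiff_const).norm_sq ℝ)

theorem d2_quad {n : ℕ} (c : ℝ) (x y : EE n) (i : Fin n) :
    d2 (bb i) (fun y : EE n => c * ‖y - x‖ ^ 2) y = 2 * c := by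
  have : (fun y' => fderiv ℝ (fun y : EE n => c * ‖y - x‖ ^ 2) y' (bb i)) =
      fun y' => 2 * c * inner ℝ (y' - x) (bb i) := by
    ext y'; rw [(fd_quad c x y' (bb i)).fderiv]; simp [inner_sub_left]
  rw [d2, this]
  have h : HasFDerivAt (fun y' : EE n => 2 * c * inner ℝ (y' - x) (bb i))
      ((2 * c) • (innerSL ℝ (bb i))) y := by
    have h1 : HasFDerivAt (fun y' : EE n => innerSL ℝ (bb i) (y' - x)) (innerSL ℝ (bb i)) y :=
      (innerSL ℝ (bb i)).hasFDerivAt.comp y ((hasFDerivAt_id y).sub_const x)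
    have := h1.const_mul (2 * c)
    simpa [real_inner_comm] using this
  rw [h.fderiv]; simp [bb]

theorem d2_sub {n : ℕ} {f g : EE n → ℝ} {x : EE n} (hf : ContDiffAt ℝ 2 f x)
    (hg : ContDiffAt ℝ 2 g x) (v : EE n) : d2 v (fun y => f y - g y) x = d2 v f x - d2 v g x := by
  have D : ∀ {f : EE n → ℝ}, ContDiffAt ℝ 2 f x → DifferentiableAt ℝ (fun y => fderiv ℝ f y v) x :=
    fun hf => ((hf.fderiv_right (m := 1) (by norm_num)).differentiableAt (by simp)).clm_apply
      (differentiableAt_const v)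
  have h : (fun y => fderiv ℝ (fun y => f y - g y) y v) =ᶠ[𝓝 x]
      fun y => fderiv ℝ f y v - fderiv ℝ g y v := by
    filter_upwards [hf.eventually (by simp), hg.eventually (by simp)] with y h1 h2
    rw [fderiv_fun_sub (h1.differentiableAt (by simp)) (h2.differentiableAt (by simp))]; simp
  rw [d2, h.fderiv_eq, fderiv_fun_sub (D hf) (D hg)]; simp [d2]

theorem Sol.neg {n : ℕ} {Ω : Set (EE n)} {T M : ℝ} {u : ZZ n → ℝ} (h : Sol Ω T M u) :
    Sol Ω T M (fun z => - u z) := by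
  have e : ∀ i (f : ZZ n → ℝ), gx i (fun z => - f z) = fun z => - gx i f z := by
    intro i f; ext z; simp [gx, fderiv_fun_neg]
  refine ⟨h.op, h.M0, fun x t ht => by simp [h.zero x t ht], h.cont.neg,
    fun t ht => (h.cx t ht).neg, fun x hx t ht => ?_⟩
  obtain ⟨d, hd, hd2⟩ := h.eq x hx t ht
  refine ⟨-d, hd.neg, ?_⟩
  simp only [e, Finset.sum_neg_distrib, neg_sq, abs_neg]
  rwa [← neg_add, abs_neg]

theorem sqrt_sum_le {n : ℕ} {a : Fin n → ℝ} {B : ℝ} (hB : 0 ≤ B) (h : ∀ i, |a i| ≤ B) :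
    √(∑ i, a i ^ 2) ≤ n * B := by
  apply Real.sqrt_le_iff.2
  refine ⟨by positivity, ?_⟩
  calc ∑ i, a i ^ 2 ≤ ∑ i : Fin n, B ^ 2 := Finset.sum_le_sum fun i _ => by
        rw [← sq_abs]; exact pow_le_pow_left₀ (abs_nonneg _) (h i) 2
    _ = n * B ^ 2 := by simp
    _ ≤ (n * B) ^ 2 := by
      rw [mul_pow]
      apply mul_le_mul_of_nonneg_right _ (sq_nonneg _)
      exact_mod_cast Nat.le_self_pow (by simp) n

theorem frozen1 {n : ℕ} {Ω : Set (EE n)} {T M : ℝ} {u : ZZ n → ℝ} (h : Sol Ω T M u)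
    {K : Set (EE n)} (hK : IsCompact K) (hKΩ : K ⊆ Ω) {t₁ : ℝ} (ht : t₁ ∈ Ioo 0 T) :
    ∃ Λ > 0, ∀ x ∈ K, ∀ t ∈ Icc (t₁ / 2) t₁, u (x, t) - u (x, t₁) ≤ Λ * (t₁ - t) := by
  obtain ⟨ρ, hρ, hρΩ⟩ := hK.exists_cthickening_subset_open h.op hKΩ
  set K' := Metric.cthickening ρ K
  have hK' : IsCompact K' := hK.cthickening
  have ht0 := ht.1
  have hsub : K' ×ˢ Icc (t₁ / 2) t₁ ⊆ Ω ×ˢ Iio T :=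
    prod_mono hρΩ (fun t h => lt_of_le_of_lt h.2 ht.2)
  obtain ⟨N, hN⟩ := (hK'.prod (isCompact_Icc (a := t₁ / 2) (b := t₁))).exists_bound_of_continuousOn
    (h.cont.mono hsub)
  have hcx := h.cx t₁ ht
  have hat : ∀ t ∈ Ioo 0 T, ∀ y ∈ Ω, ContDiffAt ℝ 2 (fun x => u (x, t)) y :=
    fun t ht y hy => (h.cx t ht).contDiffAt (h.op.mem_nhds hy)
  have hfd : ContinuousOn (fderiv ℝ (fun x => u (x, t₁))) K' := fun y hy =>
    ((hat t₁ ht y (hρΩ hy)).fderiv_right (m := 1) (by norm_num)).continuousAt.continuousWithinAt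
  have hfd2 : ∀ i : Fin n, ContinuousOn (d2 (bb i) (fun x => u (x, t₁))) K' := fun i y hy => by
    have h1 := ((hat t₁ ht y (hρΩ hy)).fderiv_right (m := 1) (by norm_num)).clm_apply
      (contDiffAt_const (c := (bb i : EE n)))
    have h2 := ((h1.fderiv_right (m := 0) (by norm_num)).clm_apply
      (contDiffAt_const (c := (bb i : EE n)))).continuousAt
    exact h2.continuousWithinAt
  obtain ⟨N1, hN1⟩ := hK'.exists_bound_of_continuousOn hfd
  obtain ⟨N2, hN2⟩ := hK'.exists_bound_of_continuousOn
    (continuousOn_finsetSum Finset.univ fun i _ => hfd2 i)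
  set N' := max N 1
  set N1' := max N1 0
  set N2' := max N2 0
  have hN'1 : 1 ≤ N' := le_max_right _ _
  have hN1'0 : 0 ≤ N1' := le_max_right _ _
  have hN2'0 : 0 ≤ N2' := le_max_right _ _
  set c := 2 * N' / ρ ^ 2 with hc
  have hc0 : 0 < c := by positivity
  have hM := h.M0
  set B := N1' + 2 * c * ρ
  have hB : 0 ≤ B := by positivity
  refine ⟨2 * n * c + N2' + M * (N' + n * B) + 1, by positivity, ?_⟩
  set Λ := 2 * n * c + N2' + M * (N' + n * B) + 1 with hΛ
  intro x hx t htt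
  set g : ZZ n → ℝ := fun z => u z - u (z.1, t₁) - c * ‖z.1 - x‖ ^ 2 - Λ * (t₁ - z.2) with hg
  have hball : Metric.closedBall x ρ ⊆ K' := Metric.closedBall_subset_cthickening hx ρ
  have hcpt : IsCompact (Metric.closedBall x ρ ×ˢ Icc (t₁ / 2) t₁) :=
    (isCompact_closedBall x ρ).prod isCompact_Icc
  have hgc : ContinuousOn g (Metric.closedBall x ρ ×ˢ Icc (t₁ / 2) t₁) := by
    have a1 : ContinuousOn u (Metric.closedBall x ρ ×ˢ Icc (t₁ / 2) t₁) :=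
      h.cont.mono ((prod_mono hball subset_rfl).trans hsub)
    have a2 : ContinuousOn (fun z : ZZ n => u (z.1, t₁)) (Metric.closedBall x ρ ×ˢ Icc (t₁ / 2) t₁) :=
      a1.comp (by fun_prop) (fun z hz => ⟨hz.1, ⟨by linarith, le_rfl⟩⟩)
    exact ((a1.sub a2).sub (by fun_prop)).sub (by fun_prop)
  obtain ⟨⟨y, s⟩, ⟨hy, hs⟩, hmax⟩ := hcpt.exists_isMaxOn
    ⟨(x, t), ⟨Metric.mem_closedBall_self hρ.le, htt⟩⟩ hgc
  simp only at hy hs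
  have hmax' : ∀ y' ∈ Metric.closedBall x ρ, ∀ s' ∈ Icc (t₁ / 2) t₁, g (y', s') ≤ g (y, s) :=
    fun y' hy' s' hs' => hmax (a := (y', s')) ⟨hy', hs'⟩
  suffices hle : g (y, s) ≤ 0 by
    have := (hmax' x (Metric.mem_closedBall_self hρ.le) t htt).trans hle
    simp only [hg, sub_self, norm_zero] at this
    linarith
  by_contra! hpos
  have hyd : ‖y - x‖ ≤ ρ := by simpa [dist_eq_norm] using hy
  have huN : ∀ y' ∈ Metric.closedBall x ρ, ∀ s' ∈ Icc (t₁ / 2) t₁, |u (y', s')| ≤ N' :=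
    fun y' hy' s' hs' => (hN (y', s') ⟨hball hy', hs'⟩).trans (le_max_left _ _)
  have ht1m : t₁ ∈ Icc (t₁ / 2) t₁ := ⟨by linarith, le_rfl⟩
  have hst : s < t₁ := by
    rcases hs.2.lt_or_eq with h1 | h1
    · exact h1
    · simp only [hg, h1, sub_self] at hpos
      nlinarith [sq_nonneg ‖y - x‖]
  have hΛ0 : 0 < Λ := by positivity
  have hyρ : ‖y - x‖ < ρ := by
    rcases hyd.lt_or_eq with h1 | h1
    · exact h1
    · simp only [hg, h1] at hpos
      have : c * ρ ^ 2 = 2 * N' := by rw [hc]; field_simp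
      have b1 := abs_le.1 (huN y hy s hs)
      have b2 := abs_le.1 (huN y hy t₁ ht1m)
      nlinarith [mul_pos hΛ0 (sub_pos.2 hst)]
  have hs0 : s ∈ Ioo 0 T := ⟨by linarith [hs.1], by linarith [ht.2]⟩
  have hyΩ : y ∈ Ω := hρΩ (hball hy)
  obtain ⟨d, hd, hdle⟩ := h.eq y hyΩ s hs0
  have c1 := hat s hs0 y hyΩ
  have c2 := hat t₁ ht y hyΩ
  have c3 : ContDiffAt ℝ 2 (fun y' : EE n => c * ‖y' - x‖ ^ 2) y :=
    ((cd_quad c x).of_le (WithTop.coe_le_coe.2 le_top)).contDiffAt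
  -- spatial local max
  have hlm : IsLocalMax (fun y' => u (y', s) - u (y', t₁) - c * ‖y' - x‖ ^ 2) y := by
    have : Metric.ball x ρ ∈ 𝓝 y := Metric.isOpen_ball.mem_nhds (by simpa [dist_eq_norm] using hyρ)
    filter_upwards [this] with y' hy'
    have := hmax' y' (Metric.ball_subset_closedBall hy') s hs
    simp only [hg] at this
    linarith
  have hl : ∀ i : Fin n, d2 (bb i) (fun y' => u (y', s)) y ≤
      d2 (bb i) (fun y' => u (y', t₁)) y + 2 * c := fun i => by
    have := d2_max ((c1.sub c2).sub c3) hlm (bb i)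
    rw [d2_sub (c1.sub c2) c3, d2_sub c1 c2, d2_quad] at this
    linarith
  have hgr : ∀ i : Fin n, |gx i u (y, s)| ≤ B := fun i => by
    have h0 := hlm.fderiv_eq_zero
    rw [fderiv_fun_sub ((c1.sub c2).differentiableAt (by simp)) (c3.differentiableAt (by simp)),
      fderiv_fun_sub (c1.differentiableAt (by simp)) (c2.differentiableAt (by simp)),
      (fd_quad c x y (bb i)).fderiv, sub_sub, sub_eq_zero] at h0
    have hbb : ‖(bb i : EE n)‖ = 1 := by simp [bb]
    show |fderiv ℝ (fun y' => u (y', s)) y (bb i)| ≤ _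
    rw [h0]
    have e1 : |fderiv ℝ (fun y' => u (y', t₁)) y (bb i)| ≤ N1' := by
      have := ContinuousLinearMap.le_opNorm (fderiv ℝ (fun y' => u (y', t₁)) y) (bb i)
      rw [hbb, mul_one] at this
      exact this.trans ((hN1 y (hball hy)).trans (le_max_left _ _))
    have e2 : |((2 * c) • innerSL ℝ (y - x)) (bb i)| ≤ 2 * c * ρ := by
      simp only [smul_apply, innerSL_apply_apply, smul_eq_mul, abs_mul]
      rw [abs_of_pos hc0, abs_two]
      apply mul_le_mul_of_nonneg_left _ (by positivity)
      have := abs_real_inner_le_norm (y - x) (bb i)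
      rw [hbb, mul_one] at this
      linarith
    exact (abs_add_le _ _).trans (add_le_add e1 e2)
  -- time derivative
  have htd : d + Λ ≤ 0 := by
    have h1 : HasDerivAt (fun s' => g (y, s')) (d + Λ) s := by
      have h2 : HasDerivAt (fun s' : ℝ => Λ * (t₁ - s')) (-Λ) s := by
        simpa using ((hasDerivAt_id s).const_sub t₁).const_mul Λ
      have := ((hd.sub_const (u (y, t₁))).sub_const (c * ‖y - x‖ ^ 2)).sub h2
      rwa [sub_neg_eq_add] at this
    by_contra! hp
    have h2 := (hasDerivWithinAt_iff_tendsto_slope' (by simp)).1 (h1.hasDerivWithinAt (s := Ioi s))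
    have h3 := (h2.eventually (lt_mem_nhds hp)).and (Ioo_mem_nhdsGT hst)
    obtain ⟨a, ha1, ha2⟩ := h3.exists
    have h4 := hmax' y hy a ⟨hs.1.trans ha2.1.le, ha2.2.le⟩
    rw [slope_def_field] at ha1
    have : (g (y, a) - g (y, s)) / (a - s) ≤ 0 :=
      div_nonpos_of_nonpos_of_nonneg (by linarith) (by linarith [ha2.1])
    linarith
  have hlap : ∑ i, gx i (gx i u) (y, s) ≤ N2' + 2 * n * c := by
    have e1 : ∑ i, gx i (gx i u) (y, s) ≤ ∑ i : Fin n, (d2 (bb i) (fun y' => u (y', t₁)) y + 2 * c) :=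
      Finset.sum_le_sum fun i _ => hl i
    rw [Finset.sum_add_distrib] at e1
    have e2 := (le_abs_self _).trans ((hN2 y (hball hy)).trans (le_max_left N2 0))
    simp only [Finset.sum_const, Finset.card_univ, Fintype.card_fin, nsmul_eq_mul] at e1
    linarith
  have hr : M * (|u (y, s)| + √(∑ i, gx i u (y, s) ^ 2)) ≤ M * (N' + n * B) :=
    mul_le_mul_of_nonneg_left (add_le_add (huN y hy s hs) (sqrt_sum_le hB hgr)) hM
  have := (abs_le.1 hdle).1
  linarith

theorem frozen {n : ℕ} {Ω : Set (EE n)} {T M : ℝ} {u : ZZ n → ℝ} (h : Sol Ω T M u)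
    {K : Set (EE n)} (hK : IsCompact K) (hKΩ : K ⊆ Ω) {t₁ : ℝ} (ht : t₁ ∈ Ioo 0 T) :
    ∃ Λ > 0, ∀ x ∈ K, ∀ t ∈ Icc (t₁ / 2) t₁, |u (x, t) - u (x, t₁)| ≤ Λ * (t₁ - t) := by
  obtain ⟨a, ha, h1⟩ := frozen1 h hK hKΩ ht
  obtain ⟨b, hb, h2⟩ := frozen1 h.neg hK hKΩ ht
  refine ⟨a + b, by positivity, fun x hx t htt => abs_le.2 ?_⟩
  have a1 := h1 x hx t htt
  have a2 := h2 x hx t htt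
  have : 0 ≤ t₁ - t := by linarith [htt.2]
  constructor <;> nlinarith

theorem glue {V : Type*} [NormedAddCommGroup V] [NormedSpace ℝ V] {Ω : Set V} (hΩ : IsOpen Ω)
    {P f : V → ℝ} {k : ℕ∞} (hP : ContDiff ℝ k P) (hs : tsupport P ⊆ Ω) (hf : ContDiffOn ℝ k f Ω) :
    ContDiff ℝ k (fun x => P x * f x) := by
  rw [contDiff_iff_contDiffAt]
  intro x
  by_cases hx : x ∈ tsupport P
  · exact hP.contDiffAt.mul (hf.contDiffAt (hΩ.mem_nhds (hs hx)))
  · have : (fun x => P x * f x) =ᶠ[𝓝 x] fun _ => 0 := by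
      filter_upwards [(isClosed_tsupport P).isOpen_compl.mem_nhds hx] with y hy
      simp [image_eq_zero_of_notMem_tsupport hy]
    exact (contDiffAt_const (c := (0 : ℝ))).congr_of_eventuallyEq this

theorem glueC {V : Type*} [TopologicalSpace V] {Ω : Set V} (hΩ : IsOpen Ω)
    {P f : V → ℝ} (hP : Continuous P) (hs : tsupport P ⊆ Ω) (hf : ContinuousOn f Ω) :
    Continuous (fun x => P x * f x) := by
  rw [continuous_iff_continuousAt]
  intro x
  by_cases hx : x ∈ tsupport P
  · exact hP.continuousAt.mul (hf.continuousAt (hΩ.mem_nhds (hs hx)))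
  · have : (fun x => P x * f x) =ᶠ[𝓝 x] fun _ => 0 := by
      filter_upwards [(isClosed_tsupport P).isOpen_compl.mem_nhds hx] with y hy
      simp [image_eq_zero_of_notMem_tsupport hy]
    exact (continuousAt_const (y := (0 : ℝ))).congr this.symm

theorem glueI {V : Type*} [TopologicalSpace V] [MeasurableSpace V] [OpensMeasurableSpace V]
    [SecondCountableTopology V] {μ : Measure V} [IsFiniteMeasureOnCompacts μ]
    {Ω : Set V} (hΩ : IsOpen Ω)
    {P f : V → ℝ} (hP : Continuous P) (hc : HasCompactSupport P) (hs : tsupport P ⊆ Ω)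
    (hf : ContinuousOn f Ω) : Integrable (fun x => P x * f x) μ :=
  (glueC hΩ hP hs hf).integrable_of_hasCompactSupport (hc.mul_right)

theorem ibp {n : ℕ} {Ω : Set (EE n)} (hΩ : IsOpen Ω)
    {P f : EE n → ℝ} (hP : ContDiff ℝ ∞ P) (hc : HasCompactSupport P) (hs : tsupport P ⊆ Ω)
    (hf : ContDiffOn ℝ 1 f Ω) (v : EE n) :
    Integrable (fun x => P x * fderiv ℝ f x v) ∧ Integrable (fun x => fderiv ℝ P x v * f x) ∧
    ∫ x, P x * fderiv ℝ f x v = - ∫ x, fderiv ℝ P x v * f x := by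
  have hc' : HasCompactSupport (fun x => fderiv ℝ P x v) := by
    apply hc.mono'
    intro x hx
    by_contra h
    exact hx (by simp [image_eq_zero_of_notMem_tsupport
      (fun h' => h (tsupport_fderiv_subset ℝ h'))])
  have hs' : tsupport (fun x => fderiv ℝ P x v) ⊆ Ω := by
    refine (closure_minimal ?_ (isClosed_tsupport P)).trans hs
    intro x hx
    by_contra h
    exact hx (by simp [image_eq_zero_of_notMem_tsupport
      (fun h' => h (tsupport_fderiv_subset ℝ h'))])
  have hPd : ∀ x, DifferentiableAt ℝ P x := hP.differentiable (by simp)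
  have hcP' : Continuous (fun x => fderiv ℝ P x v) :=
    (hP.continuous_fderiv (by simp)).clm_apply continuous_const
  have hcf : ContinuousOn (fun x => fderiv ℝ f x v) Ω :=
    ((hf.continuousOn_fderiv_of_isOpen hΩ (by simp))).clm_apply continuousOn_const
  have i1 : Integrable (fun x => P x * fderiv ℝ f x v) := glueI hΩ hP.continuous hc hs hcf
  have i2 : Integrable (fun x => fderiv ℝ P x v * f x) := glueI hΩ hcP' hc' hs' hf.continuousOn
  refine ⟨i1, i2, ?_⟩
  have hg : ContDiff ℝ 1 (fun x => P x * f x) :=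
    glue (k := 1) hΩ (hP.of_le (by exact_mod_cast le_top)) hs hf
  have h0 := int_fderiv_zero (μ := volume) hg hc.mul_right v
  have : ∀ x, fderiv ℝ (fun x => P x * f x) x v = P x * fderiv ℝ f x v + fderiv ℝ P x v * f x := by
    intro x
    by_cases hx : x ∈ tsupport P
    · have := (hf.differentiableOn (by simp)).differentiableAt (hΩ.mem_nhds (hs hx))
      rw [fderiv_fun_mul (hPd x) this]; simp [mul_comm]
    · have e : (fun x => P x * f x) =ᶠ[𝓝 x] fun _ => 0 := by
        filter_upwards [(isClosed_tsupport P).isOpen_compl.mem_nhds hx] with y hy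
        simp [image_eq_zero_of_notMem_tsupport hy]
      rw [e.fderiv_eq]
      have e2 : fderiv ℝ P x = 0 := image_eq_zero_of_notMem_tsupport
        (fun h' => hx (tsupport_fderiv_subset ℝ h'))
      simp [e2, image_eq_zero_of_notMem_tsupport hx]
  simp only [this] at h0
  rw [integral_add i1 i2] at h0
  linarith

theorem LD {n : ℕ} {f : ZZ n → ℝ} {f' : EE n → ℝ} {K : Set (EE n)} (hK : IsCompact K)
    {t₁ Λ δ : ℝ} (hδ : 0 < δ)
    (h0 : ∀ t, ∀ y ∉ K, f (y, t) = 0)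
    (hi : ∀ t ∈ Icc (t₁ - δ) t₁, Integrable (fun y => f (y, t)))
    (hl : ∀ y ∈ K, ∀ t ∈ Icc (t₁ - δ) t₁, |f (y, t) - f (y, t₁)| ≤ Λ * (t₁ - t))
    (hd : ∀ y, HasDerivWithinAt (fun t => f (y, t)) (f' y) (Iic t₁) t₁) :
    Integrable f' ∧ HasDerivWithinAt (fun t => ∫ y, f (y, t)) (∫ y, f' y) (Iic t₁) t₁ := by
  have ht : ∀ y, Tendsto (fun t => slope (fun t => f (y, t)) t₁ t) (𝓝[<] t₁) (𝓝 (f' y)) := fun y =>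
    (hasDerivWithinAt_iff_tendsto_slope' (by simp)).1 ((hd y).mono Iio_subset_Iic_self)
  have hev : ∀ᶠ t in 𝓝[<] t₁, t ∈ Ico (t₁ - δ) t₁ := Ico_mem_nhdsLT (by linarith)
  have hbd : ∀ᶠ t in 𝓝[<] t₁, ∀ᵐ y, ‖slope (fun t => f (y, t)) t₁ t‖ ≤ K.indicator (fun _ => Λ) y := by
    filter_upwards [hev] with t htt
    refine ae_of_all _ fun y => ?_
    by_cases hy : y ∈ K
    · rw [indicator_of_mem hy, slope_def_field, Real.norm_eq_abs, abs_div,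
        div_le_iff₀ (abs_pos.2 (by linarith [htt.2])), abs_sub_comm t t₁,
        abs_of_pos (show 0 < t₁ - t by linarith [htt.2])]
      exact hl y hy t ⟨htt.1, htt.2.le⟩
    · rw [indicator_of_notMem hy, slope_def_field, h0 _ y hy, h0 _ y hy]; simp
  have hbi : Integrable (K.indicator (fun _ : EE n => Λ)) :=
    (integrable_indicator_iff hK.measurableSet).2 (integrableOn_const hK.measure_lt_top.ne)
  have hme : ∀ᶠ t in 𝓝[<] t₁, AEStronglyMeasurable (fun y => slope (fun t => f (y, t)) t₁ t) := by
    filter_upwards [hev] with t htt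
    simp only [slope_def_field]
    exact (((hi t ⟨htt.1, htt.2.le⟩).sub (hi t₁ ⟨by linarith, le_rfl⟩)).div_const _).1
  have hmeas : AEStronglyMeasurable f' := by
    obtain ⟨s, hs⟩ := exists_seq_tendsto (𝓝[<] t₁)
    obtain ⟨N, hN⟩ := eventually_atTop.1 (hs.eventually hme)
    refine aestronglyMeasurable_of_tendsto_ae (u := atTop)
      (f := fun k y => slope (fun t => f (y, t)) t₁ (s (k + N))) (fun k => hN _ (by simp)) ?_
    exact ae_of_all _ fun y => ((ht y).comp hs).comp (tendsto_add_atTop_nat N)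
  have hle : ∀ y, ‖f' y‖ ≤ K.indicator (fun _ => Λ) y := by
    intro y
    refine le_of_tendsto (ht y).norm ?_
    filter_upwards [hev] with t htt
    by_cases hy : y ∈ K
    · rw [indicator_of_mem hy, slope_def_field, Real.norm_eq_abs, abs_div,
        div_le_iff₀ (abs_pos.2 (by linarith [htt.2])), abs_sub_comm t t₁,
        abs_of_pos (show 0 < t₁ - t by linarith [htt.2])]
      exact hl y hy t ⟨htt.1, htt.2.le⟩
    · rw [indicator_of_notMem hy, slope_def_field, h0 _ y hy, h0 _ y hy]; simp
  refine ⟨hbi.mono' hmeas (ae_of_all _ hle), ?_⟩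
  have main := tendsto_integral_filter_of_dominated_convergence _ hme hbd hbi (ae_of_all _ ht)
  rw [← hasDerivWithinAt_Iio_iff_Iic, hasDerivWithinAt_iff_tendsto_slope' (by simp)]
  refine main.congr' ?_
  filter_upwards [hev] with t htt
  simp only [slope_def_field]
  rw [integral_div, integral_sub (hi t ⟨htt.1, htt.2.le⟩) (hi t₁ ⟨by linarith, le_rfl⟩)]

theorem left_ineq {B B' H : ℝ → ℝ} {a b : ℝ} (hab : a ≤ b) (hc : ContinuousOn B (Icc a b))
    (hd : ∀ t ∈ Ioo a b, HasDerivWithinAt B (B' t) (Iic t) t) (hH : IntegrableOn H (Icc a b))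
    (hle : ∀ t ∈ Ioo a b, B' t ≤ H t) : B b - B a ≤ ∫ t in a..b, H t := by
  have := intervalIntegral.sub_le_integral_of_hasDeriv_right_of_le (a := -b) (b := -a)
    (g := fun t => - B (-t)) (g' := fun t => B' (-t)) (φ := fun t => H (-t)) (by linarith)
    ((hc.comp continuous_neg.continuousOn (fun t ht => by
      simp only [mem_Icc] at ht ⊢; constructor <;> linarith)).neg) ?_ ?_ ?_
  · simp only [neg_neg] at this
    rw [intervalIntegral.integral_comp_neg] at this
    simp only [neg_neg] at this
    linarith
  · intro t ht
    have h1 := hd (-t) ⟨by linarith [ht.2], by linarith [ht.1]⟩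
    have h2 : HasDerivWithinAt (fun t : ℝ => -t) (-1) (Ioi t) t := (hasDerivAt_neg t).hasDerivWithinAt
    have h3 := (h1.scomp t h2 (fun s hs => by simp only [mem_Ioi, mem_Iic] at hs ⊢; linarith)).neg
    have h4 : HasDerivWithinAt (fun t => - B (-t)) (-((-1 : ℝ) • B' (-t))) (Ioi t) t := h3
    simpa using h4
  · have := hH.comp_neg
    simpa using this
  · intro t ht
    exact hle (-t) ⟨by linarith [ht.2], by linarith [ht.1]⟩

theorem Sol.cx' {n : ℕ} {Ω : Set (EE n)} {T M : ℝ} {u : ZZ n → ℝ} (h : Sol Ω T M u) {t : ℝ}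
    (ht : t < T) : ContDiffOn ℝ 2 (fun x => u (x, t)) Ω := by
  by_cases h0 : 0 < t
  · exact h.cx t ⟨h0, ht⟩
  · have : (fun x => u (x, t)) = fun _ => 0 := funext fun x => h.zero x t (not_lt.1 h0)
    rw [this]; exact contDiffOn_const

theorem Sol.lip {n : ℕ} {Ω : Set (EE n)} {T M : ℝ} {u : ZZ n → ℝ} (h : Sol Ω T M u) {t₁ : ℝ}
    (ht : t₁ < T) {K : Set (EE n)} (hK : IsCompact K) (hKΩ : K ⊆ Ω) :
    ∃ Λ > 0, ∃ δ > 0, ∀ x ∈ K, ∀ t ∈ Icc (t₁ - δ) t₁, |u (x, t) - u (x, t₁)| ≤ Λ * (t₁ - t) := by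
  by_cases h0 : 0 < t₁
  · obtain ⟨Λ, hΛ, h1⟩ := frozen h hK hKΩ ⟨h0, ht⟩
    exact ⟨Λ, hΛ, t₁ / 2, by linarith, fun x hx t htt => h1 x hx t ⟨by linarith [htt.1], htt.2⟩⟩
  · refine ⟨1, one_pos, 1, one_pos, fun x hx t htt => ?_⟩
    rw [h.zero x t (htt.2.trans (not_lt.1 h0)), h.zero x t₁ (not_lt.1 h0)]
    simp [htt.2]

theorem Sol.der {n : ℕ} {Ω : Set (EE n)} {T M : ℝ} {u : ZZ n → ℝ} (h : Sol Ω T M u) {t : ℝ}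
    (ht : t < T) {x : EE n} (hx : x ∈ Ω) : ∃ d, HasDerivWithinAt (fun s => u (x, s)) d (Iic t) t ∧
    |d + ∑ i, gx i (gx i u) (x, t)| ≤ M * (|u (x, t)| + √(∑ i, gx i u (x, t) ^ 2)) := by
  by_cases h0 : 0 < t
  · obtain ⟨d, h1, h2⟩ := h.eq x hx t ⟨h0, ht⟩
    exact ⟨d, h1.hasDerivWithinAt, h2⟩
  · refine ⟨0, ?_, ?_⟩
    · refine (hasDerivWithinAt_const t _ (0 : ℝ)).congr (fun s hs => ?_) ?_
      · exact h.zero x s (le_trans hs (not_lt.1 h0))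
      · exact h.zero x t (not_lt.1 h0)
    · have e : (fun x => u (x, t)) = fun _ => 0 := funext fun x => h.zero x t (not_lt.1 h0)
      have e1 : ∀ i x, gx i u (x, t) = 0 := fun i x => by simp [gx, e]
      have e2 : ∀ i, gx i (gx i u) (x, t) = 0 := fun i => by
        have : (fun y => gx i u (y, t)) = fun _ => 0 := funext fun y => e1 i y
        unfold gx at this ⊢; simp [this]
      simp [e1, e2, h.zero x t (not_lt.1 h0)]

theorem Sol.contb {n : ℕ} {Ω : Set (EE n)} {T M : ℝ} {u : ZZ n → ℝ} (h : Sol Ω T M u) {b : ℝ}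
    (hb : b < T) : ContinuousOn (fun z : ZZ n => u (z.1, min z.2 b)) (Ω ×ˢ univ) :=
  h.cont.comp (f := fun z : ZZ n => (z.1, min z.2 b)) (by fun_prop)
    (fun z hz => ⟨hz.1, (min_le_right _ _).trans_lt hb⟩)

theorem ts_fst {n : ℕ} {P : EE n → ℝ} {Ω : Set (EE n)} (hs : tsupport P ⊆ Ω) :
    tsupport (fun z : ZZ n => P z.1) ⊆ Ω ×ˢ univ := by
  intro z hz
  refine ⟨hs ?_, mem_univ _⟩
  have := tsupport_comp_subset_preimage P (f := fun z : ZZ n => z.1) continuous_fst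
  exact this hz

theorem Sol.contP {n : ℕ} {Ω : Set (EE n)} {T M : ℝ} {u : ZZ n → ℝ} (h : Sol Ω T M u) {b : ℝ}
    (hb : b < T) {P : EE n → ℝ} (hP : Continuous P) (hs : tsupport P ⊆ Ω) :
    Continuous (fun z : ZZ n => P z.1 * u (z.1, min z.2 b)) :=
  glueC (h.op.prod isOpen_univ) (hP.comp continuous_fst) (ts_fst hs) (h.contb hb)

theorem Sol.measP {n : ℕ} {Ω : Set (EE n)} {T M : ℝ} {u : ZZ n → ℝ} (h : Sol Ω T M u) {b : ℝ}
    (hb : b < T) {P : EE n → ℝ} (hP : ContDiff ℝ ∞ P) (hs : tsupport P ⊆ Ω) (i : Fin n) :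
    Measurable (fun z : ZZ n => P z.1 * gx i u (z.1, min z.2 b)) := by
  have h1 := h.contP hb hP.continuous hs
  have h2 : Measurable (fun p : ℝ × EE n => fderiv ℝ (fun y => P y * u (y, min p.1 b)) p.2 (bb i)) :=
    measurable_fderiv_apply_const_with_param ℝ (f := fun (t : ℝ) (y : EE n) => P y * u (y, min t b))
      (h1.comp continuous_swap) (bb i)
  have hs' : tsupport (fun x => fderiv ℝ P x (bb i)) ⊆ Ω := by
    refine (closure_minimal ?_ (isClosed_tsupport P)).trans hs
    intro x hx
    by_contra h
    exact hx (by simp [image_eq_zero_of_notMem_tsupport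
      (fun h' => h (tsupport_fderiv_subset ℝ h'))])
  have hcP' : Continuous (fun x => fderiv ℝ P x (bb i)) :=
    (hP.continuous_fderiv (by simp)).clm_apply continuous_const
  have h3 := h.contP hb hcP' hs'
  have h4 := (h2.comp measurable_swap).sub h3.measurable
  convert h4 using 1
  ext ⟨x, t⟩
  simp only [Pi.sub_apply, Function.comp, Prod.swap]
  by_cases hx : x ∈ tsupport P
  · have := ((h.cx' (t := min t b) ((min_le_right _ _).trans_lt hb)).differentiableOn (by simp)).differentiableAt
      (h.op.mem_nhds (hs hx))
    rw [fderiv_fun_mul (hP.differentiable (by simp) x) this]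
    simp [gx, mul_comm]
  · have e : (fun y => P y * u (y, min t b)) =ᶠ[𝓝 x] fun _ => 0 := by
      filter_upwards [(isClosed_tsupport P).isOpen_compl.mem_nhds hx] with y hy
      simp [image_eq_zero_of_notMem_tsupport hy]
    rw [e.fderiv_eq]
    have e2 : fderiv ℝ P x = 0 := image_eq_zero_of_notMem_tsupport
      (fun h' => hx (tsupport_fderiv_subset ℝ h'))
    simp [e2, image_eq_zero_of_notMem_tsupport hx]

theorem Sol.gxcd {n : ℕ} {Ω : Set (EE n)} {T M : ℝ} {u : ZZ n → ℝ} (h : Sol Ω T M u) {t : ℝ}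
    (ht : t < T) (i : Fin n) : ContDiffOn ℝ 1 (fun x => gx i u (x, t)) Ω :=
  ((h.cx' ht).fderiv_of_isOpen h.op (m := 1) (by norm_num)).clm_apply contDiffOn_const

theorem Sol.gx2c {n : ℕ} {Ω : Set (EE n)} {T M : ℝ} {u : ZZ n → ℝ} (h : Sol Ω T M u) {t : ℝ}
    (ht : t < T) (i : Fin n) : ContinuousOn (fun x => gx i (gx i u) (x, t)) Ω :=
  ((h.gxcd ht i).continuousOn_fderiv_of_isOpen h.op (by simp)).clm_apply continuousOn_const

theorem cacc_pt {n : ℕ} {M P u d : ℝ} (g l p : Fin n → ℝ) (hM : 0 ≤ M)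
    (h : |d + ∑ i, l i| ≤ M * (|u| + √(∑ i, g i ^ 2))) :
    P ^ 2 * ∑ i, g i ^ 2 - (2 * M + 2 * M ^ 2 + 8) * (P ^ 2 + ∑ i, p i ^ 2) * u ^ 2 ≤
    2 * (P ^ 2 * u * d) +
      2 * ∑ i, (P ^ 2 * (g i * g i + u * l i) + 2 * P * p i * (u * g i)) := by
  set q := √(∑ i, g i ^ 2)
  have hS : 0 ≤ ∑ i, g i ^ 2 := Finset.sum_nonneg fun i _ => sq_nonneg _
  have hq : q ^ 2 = ∑ i, g i ^ 2 := Real.sq_sqrt hS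
  have hp : 0 ≤ ∑ i, p i ^ 2 := Finset.sum_nonneg fun i _ => sq_nonneg _
  have e : ∑ i, (P ^ 2 * (g i * g i + u * l i) + 2 * P * p i * (u * g i)) =
      P ^ 2 * ∑ i, g i ^ 2 + P ^ 2 * u * ∑ i, l i + ∑ i, 2 * P * p i * (u * g i) := by
    simp only [Finset.sum_add_distrib, Finset.mul_sum, mul_add]
    congr 2 <;> exact Finset.sum_congr rfl fun i _ => by ring
  have e2 : -(1 / 4) * (P ^ 2 * ∑ i, g i ^ 2) - 4 * (u ^ 2 * ∑ i, p i ^ 2) ≤ ∑ i, 2 * P * p i * (u * g i) := by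
    simp only [Finset.mul_sum, ← Finset.sum_sub_distrib]
    exact Finset.sum_le_sum fun i _ => by nlinarith [sq_nonneg (P * g i + 4 * (u * p i))]
  have e3 : -(P ^ 2 * (M * (u ^ 2 + |u| * q))) ≤ P ^ 2 * (u * (d + ∑ i, l i)) := by
    rw [← mul_neg]
    apply mul_le_mul_of_nonneg_left _ (sq_nonneg _)
    have : |u * (d + ∑ i, l i)| ≤ |u| * (M * (|u| + q)) := by
      rw [abs_mul]; exact mul_le_mul_of_nonneg_left h (abs_nonneg _)
    have := (abs_le.1 this).1
    nlinarith [sq_abs u]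
  have e4 : P ^ 2 * (M * (|u| * q)) ≤ P ^ 2 * (1 / 4 * q ^ 2 + M ^ 2 * u ^ 2) := by
    apply mul_le_mul_of_nonneg_left _ (sq_nonneg _)
    nlinarith [sq_nonneg (1 / 2 * q - M * |u|), sq_abs u]
  rw [e]
  have e5 : 0 ≤ M * (u ^ 2 * ∑ i, p i ^ 2) := by positivity
  have e6 : 0 ≤ M ^ 2 * (u ^ 2 * ∑ i, p i ^ 2) := by positivity
  have e7 : 0 ≤ P ^ 2 * u ^ 2 := by positivity
  rw [hq] at e4
  nlinarith

theorem trunc {μ : Measure ℝ} {D : ℝ → ℝ} [IsFiniteMeasure μ] {S : ℝ} (hD : AEStronglyMeasurable D μ) (h0 : ∀ t, 0 ≤ D t)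
    (h : ∀ k : ℕ, ∫ t, min (D t) k ∂μ ≤ S) : Integrable D μ ∧ ∫ t, D t ∂μ ≤ S := by
  have hi : ∀ k : ℕ, Integrable (fun t => min (D t) k) μ := fun k =>
    Integrable.of_bound (C := k) (hD.inf aestronglyMeasurable_const)
      (ae_of_all _ fun t => by
        rw [Real.norm_eq_abs, abs_of_nonneg (le_min (h0 t) (Nat.cast_nonneg k))]
        exact min_le_right _ _)
  have ht : ∀ t, Tendsto (fun k : ℕ => ENNReal.ofReal (min (D t) k)) atTop (𝓝 (ENNReal.ofReal (D t))) := by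
    intro t
    apply tendsto_const_nhds.congr'
    obtain ⟨N, hN⟩ := exists_nat_ge (D t)
    filter_upwards [eventually_ge_atTop N] with k hk
    rw [min_eq_left (hN.trans (by exact_mod_cast hk))]
  have hl : ∫⁻ t, ENNReal.ofReal (D t) ∂μ ≤ ENNReal.ofReal S := by
    calc ∫⁻ t, ENNReal.ofReal (D t) ∂μ = ∫⁻ t, liminf (fun k : ℕ => ENNReal.ofReal (min (D t) k)) atTop ∂μ :=
          lintegral_congr fun t => (ht t).liminf_eq.symm
      _ ≤ liminf (fun k : ℕ => ∫⁻ t, ENNReal.ofReal (min (D t) k) ∂μ) atTop :=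
          lintegral_liminf_le' fun k => (hi k).1.aemeasurable.ennreal_ofReal
      _ ≤ ENNReal.ofReal S := by
          refine liminf_le_of_le (by isBoundedDefault) fun b hb => ?_
          obtain ⟨k, hk⟩ := hb.exists
          refine hk.trans ?_
          rw [← ofReal_integral_eq_lintegral_ofReal (hi k)
            (ae_of_all _ fun t => le_min (h0 t) (Nat.cast_nonneg k))]
          exact ENNReal.ofReal_le_ofReal (h k)
  have hI : Integrable D μ := ⟨hD, by
    rw [hasFiniteIntegral_iff_ofReal (ae_of_all _ h0)]; exact hl.trans_lt ENNReal.ofReal_lt_top⟩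
  refine ⟨hI, ?_⟩
  have hS : 0 ≤ S := le_trans (integral_nonneg fun t => le_min (h0 t) (Nat.cast_nonneg 0)) (h 0)
  rw [← ofReal_integral_eq_lintegral_ofReal hI (ae_of_all _ h0)] at hl
  exact (ENNReal.ofReal_le_ofReal_iff hS).1 hl

theorem ts_fd {n : ℕ} {P : EE n → ℝ} (v : EE n) : tsupport (fun x => fderiv ℝ P x v) ⊆ tsupport P := by
  refine closure_minimal ?_ (isClosed_tsupport P)
  intro x hx
  by_contra h
  exact hx (by simp [image_eq_zero_of_notMem_tsupport
    (fun h' => h (tsupport_fderiv_subset ℝ h'))])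

theorem ts_sq {n : ℕ} {P : EE n → ℝ} : tsupport (fun x => P x ^ 2) ⊆ tsupport P := by
  refine closure_mono ?_
  intro x hx h
  exact hx (by simp [h])

/-- energy density weight -/
noncomputable def Wt {n : ℕ} (P : EE n → ℝ) (y : EE n) : ℝ := P y ^ 2 + ∑ i, (fderiv ℝ P y (bb i)) ^ 2

theorem Wt_cont {n : ℕ} {P : EE n → ℝ} (hP : ContDiff ℝ ∞ P) : Continuous (Wt P) := by
  have : ∀ i : Fin n, Continuous (fun x => fderiv ℝ P x (bb i)) := fun i =>
    (hP.continuous_fderiv (by simp)).clm_apply continuous_const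
  have := hP.continuous
  unfold Wt
  fun_prop

theorem Wt_ts {n : ℕ} {P : EE n → ℝ} : tsupport (Wt P) ⊆ tsupport P := by
  refine closure_minimal ?_ (isClosed_tsupport P)
  intro x hx
  by_contra h
  refine hx ?_
  have e2 : fderiv ℝ P x = 0 := image_eq_zero_of_notMem_tsupport
        (fun h' => h (tsupport_fderiv_subset ℝ h'))
  simp [Wt, e2, image_eq_zero_of_notMem_tsupport h]

theorem cacc_der {n : ℕ} {Ω : Set (EE n)} {T M : ℝ} {u : ZZ n → ℝ} (h : Sol Ω T M u) {t : ℝ}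
    (ht : t < T) {P : EE n → ℝ} (hP : ContDiff ℝ ∞ P) (hc : HasCompactSupport P)
    (hs : tsupport P ⊆ Ω) : ∃ B', HasDerivWithinAt (fun t => ∫ y, P y ^ 2 * u (y, t) ^ 2) B' (Iic t) t ∧
    Integrable (fun y => P y ^ 2 * ∑ i, gx i u (y, t) ^ 2) ∧
    (∫ y, P y ^ 2 * ∑ i, gx i u (y, t) ^ 2) -
      (2 * M + 2 * M ^ 2 + 8) * (∫ y, Wt P y * u (y, t) ^ 2) ≤ B' := by
  choose! d hd hd2 using fun (x : EE n) (hx : x ∈ Ω) => h.der ht hx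
  have hP2 : ContDiff ℝ ∞ (fun y => P y ^ 2) := hP.pow 2
  have hc2 : HasCompactSupport (fun y => P y ^ 2) := hc.mono' (subset_tsupport _ |>.trans ts_sq)
  have hs2 : tsupport (fun y => P y ^ 2) ⊆ Ω := ts_sq.trans hs
  have hut : ContinuousOn (fun y => u (y, t)) Ω := (h.cx' ht).continuousOn
  obtain ⟨Λ, hΛ, δ, hδ, hlip⟩ := h.lip ht hc hs
  have hcpt : IsCompact (tsupport P ×ˢ Icc (t - δ) t) := hc.isCompact.prod isCompact_Icc
  obtain ⟨N, hN⟩ := hcpt.exists_bound_of_continuousOn (f := fun z : ZZ n => u z)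
    (h.cont.mono (prod_mono hs fun s hs => lt_of_le_of_lt hs.2 ht))
  obtain ⟨N2, hN2⟩ := hc.isCompact.exists_bound_of_continuousOn (hP2.continuous.continuousOn)
  obtain ⟨i1, h1⟩ := LD (f := fun z : ZZ n => P z.1 ^ 2 * u z ^ 2)
    (f' := fun y => 2 * (P y ^ 2 * u (y, t) * d y)) (K := tsupport P) (t₁ := t)
    (Λ := N2 * (2 * N * Λ)) hc hδ
    (fun s y hy => by simp [image_eq_zero_of_notMem_tsupport hy])
    (fun s hs' => glueI h.op hP2.continuous hc2 hs2
      ((h.cx' (lt_of_le_of_lt hs'.2 ht)).continuousOn.pow 2))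
    (fun y hy s hs' => by
      have a1 := hN (y, s) ⟨hy, hs'⟩
      have a2 := hN (y, t) ⟨hy, ⟨by linarith, le_rfl⟩⟩
      have a3 := hlip y hy s hs'
      have a4 := hN2 y hy
      rw [Real.norm_eq_abs] at a1 a2 a4
      have : P y ^ 2 * u (y, s) ^ 2 - P y ^ 2 * u (y, t) ^ 2 =
        P y ^ 2 * ((u (y, s) + u (y, t)) * (u (y, s) - u (y, t))) := by ring
      show |P y ^ 2 * u (y, s) ^ 2 - P y ^ 2 * u (y, t) ^ 2| ≤ _
      rw [this, abs_mul, abs_mul, mul_assoc N2]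
      have a5 : |u (y, s) + u (y, t)| ≤ 2 * N := (abs_add_le _ _).trans (by linarith)
      have hN0 := (abs_nonneg _).trans a1
      have hN20 := (abs_nonneg _).trans a4
      have hst : 0 ≤ t - s := by linarith [hs'.2]
      calc _ ≤ N2 * (2 * N * (Λ * (t - s))) := by gcongr
        _ = _ := by ring)
    (fun y => by
      by_cases hy : y ∈ Ω
      · have := ((hd y hy).pow 2).const_mul (P y ^ 2)
        simp only [Nat.cast_ofNat, Nat.add_one_sub_one, pow_one] at this
        refine this.congr_deriv ?_
        ring
      · have : P y = 0 := image_eq_zero_of_notMem_tsupport fun h' => hy (hs h')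
        simp only [this]
        simpa using hasDerivWithinAt_const t _ (0 : ℝ))
  have hgx := fun i => h.gxcd ht i
  have hgc : ContinuousOn (fun y => ∑ i, gx i u (y, t) ^ 2) Ω :=
    continuousOn_finsetSum _ fun i _ => (hgx i).continuousOn.pow 2
  have iD : Integrable (fun y => P y ^ 2 * ∑ i, gx i u (y, t) ^ 2) :=
    glueI h.op hP2.continuous hc2 hs2 hgc
  refine ⟨_, h1, iD, ?_⟩
  have iW : Integrable (fun y => Wt P y * u (y, t) ^ 2) :=
    glueI h.op (Wt_cont hP) (hc.mono' (subset_tsupport _ |>.trans Wt_ts)) (Wt_ts.trans hs) (hut.pow 2)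
  have Z : ∀ i : Fin n, Integrable (fun y => P y ^ 2 * (gx i u (y, t) * gx i u (y, t) + u (y, t) * gx i (gx i u) (y, t))
      + 2 * P y * fderiv ℝ P y (bb i) * (u (y, t) * gx i u (y, t))) ∧
      ∫ y, (P y ^ 2 * (gx i u (y, t) * gx i u (y, t) + u (y, t) * gx i (gx i u) (y, t))
      + 2 * P y * fderiv ℝ P y (bb i) * (u (y, t) * gx i u (y, t))) = 0 := by
    intro i
    have hf : ContDiffOn ℝ 1 (fun y => u (y, t) * gx i u (y, t)) Ω :=
      ((h.cx' ht).of_le (by norm_num)).mul (hgx i)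
    obtain ⟨j1, j2, j3⟩ := ibp h.op hP2 hc2 hs2 hf (bb i)
    have e1 : ∀ y, P y ^ 2 * fderiv ℝ (fun y => u (y, t) * gx i u (y, t)) y (bb i) =
        P y ^ 2 * (gx i u (y, t) * gx i u (y, t) + u (y, t) * gx i (gx i u) (y, t)) := by
      intro y
      by_cases hy : y ∈ Ω
      · rw [fderiv_fun_mul (((h.cx' ht).differentiableOn (by simp)).differentiableAt (h.op.mem_nhds hy))
          (((hgx i).differentiableOn (by simp)).differentiableAt (h.op.mem_nhds hy))]
        simp only [add_apply, smul_apply, smul_eq_mul]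
        simp only [gx]
        ring
      · have : P y = 0 := image_eq_zero_of_notMem_tsupport fun h' => hy (hs h')
        simp [this]
    have e2 : ∀ y, fderiv ℝ (fun y => P y ^ 2) y (bb i) = 2 * P y * fderiv ℝ P y (bb i) := by
      intro y
      rw [((hP.differentiable (by simp) y).hasFDerivAt.pow 2).fderiv]
      simp [mul_assoc]
    simp only [e1, e2] at j1 j2 j3
    refine ⟨j1.add j2, ?_⟩
    rw [integral_add j1 j2, j3]; simp
  have hsum : ∫ y, ∑ i, (P y ^ 2 * (gx i u (y, t) * gx i u (y, t) + u (y, t) * gx i (gx i u) (y, t))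
      + 2 * P y * fderiv ℝ P y (bb i) * (u (y, t) * gx i u (y, t))) = 0 := by
    rw [integral_finsetSum _ fun i _ => (Z i).1]
    exact Finset.sum_eq_zero fun i _ => (Z i).2
  have iS := integrable_finsetSum Finset.univ fun i _ => (Z i).1
  rw [← integral_const_mul, ← integral_sub iD (iW.const_mul _)]
  have : ∫ y, 2 * (P y ^ 2 * u (y, t) * d y) = ∫ y, (2 * (P y ^ 2 * u (y, t) * d y) + 2 * ∑ i,
      (P y ^ 2 * (gx i u (y, t) * gx i u (y, t) + u (y, t) * gx i (gx i u) (y, t))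
      + 2 * P y * fderiv ℝ P y (bb i) * (u (y, t) * gx i u (y, t)))) := by
    rw [integral_add i1 (iS.const_mul 2), integral_const_mul 2 (fun y => ∑ i, _), hsum]; simp
  rw [this]
  refine integral_mono (iD.sub (iW.const_mul _)) (i1.add (iS.const_mul 2)) fun y => ?_
  by_cases hy : y ∈ Ω
  · have := cacc_pt (P := P y) (u := u (y, t)) (d := d y) (fun i => gx i u (y, t))
      (fun i => gx i (gx i u) (y, t)) (fun i => fderiv ℝ P y (bb i)) h.M0 (hd2 y hy)
    simpa [Wt, mul_assoc] using this
  · have hy' : y ∉ tsupport P := fun h' => hy (hs h')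
    have e2 : fderiv ℝ P y = 0 := image_eq_zero_of_notMem_tsupport
        (fun h' => hy' (tsupport_fderiv_subset ℝ h'))
    simp [Wt, image_eq_zero_of_notMem_tsupport hy', e2]

theorem cont_int {n : ℕ} {Ω : Set (EE n)} {T M : ℝ} {u : ZZ n → ℝ} (h : Sol Ω T M u) {b : ℝ}
    (hb : b < T) {P : EE n → ℝ} (hP : Continuous P) (hc : HasCompactSupport P)
    (hs : tsupport P ⊆ Ω) : Continuous (fun t => ∫ y, P y * u (y, min t b) ^ 2) := by
  have h1 : Continuous (fun z : ZZ n => P z.1 * u (z.1, min z.2 b) ^ 2) :=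
    glueC (h.op.prod isOpen_univ) (hP.comp continuous_fst) (ts_fst hs) ((h.contb hb).pow 2)
  rw [← continuousOn_univ]
  refine continuousOn_integral_of_compact_support (k := tsupport P) hc ?_ ?_
  · exact (h1.comp continuous_swap).continuousOn
  · intro p x _ hx
    simp [image_eq_zero_of_notMem_tsupport hx]

theorem cacc {n : ℕ} {Ω : Set (EE n)} {T M : ℝ} {u : ZZ n → ℝ} (h : Sol Ω T M u) {a b : ℝ}
    (ha : a ≤ 0) (hab : a ≤ b)
    (hb : b < T) {P : EE n → ℝ} (hP : ContDiff ℝ ∞ P) (hc : HasCompactSupport P)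
    (hs : tsupport P ⊆ Ω) :
    IntegrableOn (fun z : ZZ n => P z.1 ^ 2 * ∑ i, gx i u z ^ 2) (univ ×ˢ Icc a b) ∧
    ∫ z in univ ×ˢ Icc a b, P z.1 ^ 2 * ∑ i, gx i u z ^ 2 ≤ (∫ y, P y ^ 2 * u (y, b) ^ 2) +
      (2 * M + 2 * M ^ 2 + 8) * ∫ t in a..b, ∫ y, Wt P y * u (y, t) ^ 2 := by
  set f : ZZ n → ℝ := fun z => P z.1 ^ 2 * ∑ i, gx i u (z.1, min z.2 b) ^ 2 with hf
  have hfm : Measurable f := by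
    have : f = fun z => ∑ i, (P z.1 * gx i u (z.1, min z.2 b)) ^ 2 := by
      ext z; simp [hf, Finset.mul_sum, mul_pow]
    rw [this]
    exact Finset.measurable_sum _ fun i _ => (h.measP hb hP hs i).pow_const 2
  set D : ℝ → ℝ := fun t => ∫ y, f (y, t)
  have hDm : StronglyMeasurable D := hfm.stronglyMeasurable.integral_prod_left'
  have hD0 : ∀ t, 0 ≤ D t := fun t => integral_nonneg fun y => by
    simp only [hf, Pi.zero_apply]
    have : 0 ≤ ∑ i, gx i u (y, min t b) ^ 2 := Finset.sum_nonneg fun i _ => sq_nonneg _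
    positivity
  have hP2c : Continuous (fun y => P y ^ 2) := hP.continuous.pow 2
  have hBc := cont_int h hb hP2c (hc.mono' (subset_tsupport _ |>.trans ts_sq)) (ts_sq.trans hs)
  have hGc := cont_int h hb (Wt_cont hP) (hc.mono' (subset_tsupport _ |>.trans Wt_ts)) (Wt_ts.trans hs)
  set C := 2 * M + 2 * M ^ 2 + 8
  set S := (∫ y, P y ^ 2 * u (y, b) ^ 2) + C * ∫ t in a..b, ∫ y, Wt P y * u (y, min t b) ^ 2 with hS
  have key : ∀ k : ℕ, ∫ t in Icc a b, min (D t) k ≤ S := by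
    intro k
    choose! B' h1 h2 h3 using fun (t : ℝ) (ht : t < T) => cacc_der h ht hP hc hs
    have iM : IntegrableOn (fun t => min (D t) k) (Icc a b) := by
      refine Measure.integrableOn_of_bounded (M := k) (by simp) (hDm.aestronglyMeasurable.inf aestronglyMeasurable_const) (ae_of_all _ fun t => ?_)
      rw [Real.norm_eq_abs, abs_of_nonneg (le_min (hD0 t) (Nat.cast_nonneg k))]
      exact min_le_right _ _
    have iG : IntegrableOn (fun t => C * ∫ y, Wt P y * u (y, min t b) ^ 2) (Icc a b) :=
      (hGc.const_mul C).integrableOn_Icc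
    have := left_ineq (B := fun t => - ∫ y, P y ^ 2 * u (y, t) ^ 2) (B' := fun t => - B' t)
      (H := fun t => (C * ∫ y, Wt P y * u (y, min t b) ^ 2) - min (D t) k) hab
      (ContinuousOn.neg (hBc.continuousOn.congr fun t ht => by simp [min_eq_left ht.2]))
      (fun t ht => (h1 t (ht.2.trans hb)).neg) (iG.sub iM)
      (fun t ht => by
        have e1 := h3 t (ht.2.trans hb)
        have e2 : D t = ∫ y, P y ^ 2 * ∑ i, gx i u (y, t) ^ 2 := by
          simp only [D, hf, min_eq_left ht.2.le]
        have e3 := min_le_left (D t) k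
        simp only [min_eq_left ht.2.le]
        linarith)
    have e0 : ∫ y, P y ^ 2 * u (y, a) ^ 2 = 0 := by simp [h.zero _ a ha]
    rw [intervalIntegral.integral_sub, intervalIntegral.integral_const_mul,
      intervalIntegral.integral_of_le hab (f := fun t => min (D t) k), ← integral_Icc_eq_integral_Ioc] at this
    · simp only [e0] at this
      linarith
    · exact (intervalIntegrable_iff_integrableOn_Icc_of_le hab).2 iG
    · exact (intervalIntegrable_iff_integrableOn_Icc_of_le hab).2 iM
  obtain ⟨t1, t2⟩ := trunc (μ := volume.restrict (Icc a b)) hDm.aestronglyMeasurable hD0 key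
  have hvol : (volume : Measure (ZZ n)).restrict (univ ×ˢ Icc a b) =
      (volume : Measure (EE n)).prod (volume.restrict (Icc a b)) := by
    rw [Measure.volume_eq_prod, ← Measure.prod_restrict, Measure.restrict_univ]
  have hsl : ∀ t, Integrable (fun y => f (y, t)) := fun t =>
    (cacc_der h (t := min t b) ((min_le_right _ _).trans_lt hb) hP hc hs).choose_spec.2.1
  have hfi : Integrable f ((volume : Measure (ZZ n)).restrict (univ ×ˢ Icc a b)) := by
    rw [hvol, integrable_prod_iff' hfm.aestronglyMeasurable]
    refine ⟨ae_of_all _ hsl, ?_⟩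
    convert t1 using 2 with t
    refine integral_congr_ae (ae_of_all _ fun y => ?_)
    have : 0 ≤ ∑ i, gx i u (y, min t b) ^ 2 := Finset.sum_nonneg fun i _ => sq_nonneg _
    simp only [hf, Real.norm_eq_abs]
    exact abs_of_nonneg (by positivity)
  have hms : MeasurableSet ((univ : Set (EE n)) ×ˢ Icc a b) := MeasurableSet.univ.prod measurableSet_Icc
  have hcongr : ∀ z ∈ (univ : Set (EE n)) ×ˢ Icc a b, f z = P z.1 ^ 2 * ∑ i, gx i u z ^ 2 := fun z hz => by
    simp only [hf, min_eq_left hz.2.2]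
  refine ⟨IntegrableOn.congr_fun hfi hcongr hms, ?_⟩
  rw [← setIntegral_congr_fun hms hcongr, hvol, integral_prod_symm _ (by rwa [← hvol])]
  refine t2.trans (le_of_eq ?_)
  rw [hS]
  congr 2
  refine intervalIntegral.integral_congr fun t ht => ?_
  rw [uIcc_of_le hab] at ht
  simp only [min_eq_left ht.2]

theorem bump_cpt {V : Type*} [NormedAddCommGroup V] [NormedSpace ℝ V] [FiniteDimensional ℝ V]
    {K O : Set V} (hK : IsCompact K) (hO : IsOpen O) (hKO : K ⊆ O) :
    ∃ P : V → ℝ, ContDiff ℝ ∞ P ∧ HasCompactSupport P ∧ tsupport P ⊆ O ∧ (∀ᶠ x in 𝓝ˢ K, P x = 1) ∧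
      ∀ x, P x ∈ Icc (0 : ℝ) 1 := by
  have : ProperSpace V := FiniteDimensional.proper ℝ V
  obtain ⟨L, hL, h1, h2⟩ := exists_compact_between hK hO hKO
  obtain ⟨f, f1, f2, f3⟩ := exists_contMDiffMap_one_nhds_of_subset_interior (n := (⊤ : ℕ∞))
    (modelWithCornersSelf ℝ V) hK.isClosed h1
  have hts : tsupport f ⊆ L := by
    refine closure_minimal (fun x hx => ?_) hL.isClosed
    by_contra h
    exact hx (f2 x h)
  exact ⟨f, f.contMDiff.contDiff, HasCompactSupport.of_support_subset_isCompact hL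
    ((subset_tsupport _).trans hts), hts.trans h2, f1, f3⟩

/-- energy density -/
noncomputable def QQ {n : ℕ} (u : ZZ n → ℝ) (z : ZZ n) : ℝ := u z ^ 2 + ∑ i, gx i u z ^ 2

theorem QQ_nonneg {n : ℕ} (u : ZZ n → ℝ) (z : ZZ n) : 0 ≤ QQ u z :=
  add_nonneg (sq_nonneg _) (Finset.sum_nonneg fun i _ => sq_nonneg _)

theorem cpt_bounds {n : ℕ} {Ω : Set (EE n)} {T : ℝ} {K : Set (ZZ n)} (hK : IsCompact K)
    (hs : K ⊆ Ω ×ˢ Iio T) : ∃ a b, a ≤ 0 ∧ a < b ∧ b < T ∧ ∀ z ∈ K, a < z.2 ∧ z.2 < b := by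
  rcases K.eq_empty_or_nonempty with rfl | hne
  · exact ⟨min 0 (T - 2), T - 1, min_le_left _ _, by linarith [min_le_right 0 (T - 2)], by linarith,
      by simp⟩
  · obtain ⟨zM, hM, hM2⟩ := hK.exists_isMaxOn hne continuous_snd.continuousOn
    obtain ⟨zm, hm, hm2⟩ := hK.exists_isMinOn hne continuous_snd.continuousOn
    have h1 : zM.2 < T := (hs hM).2
    have h2 : zm.2 ≤ zM.2 := hm2 hM
    refine ⟨min 0 (zm.2 - 1), (zM.2 + T) / 2, min_le_left _ _, ?_, by linarith, fun z hz => ⟨?_, ?_⟩⟩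
    · linarith [min_le_right 0 (zm.2 - 1)]
    · have : zm.2 ≤ z.2 := hm2 hz
      linarith [min_le_right 0 (zm.2 - 1)]
    · have : z.2 ≤ zM.2 := hM2 hz
      linarith

theorem QQ_int {n : ℕ} {Ω : Set (EE n)} {T M : ℝ} {u : ZZ n → ℝ} (h : Sol Ω T M u)
    {K : Set (ZZ n)} (hK : IsCompact K) (hs : K ⊆ Ω ×ˢ Iio T) :
    IntegrableOn (QQ u) K ∧ (∀ i, IntegrableOn (gx i u) K) ∧ IntegrableOn u K ∧
    IntegrableOn (fun z => √(∑ i, gx i u z ^ 2)) K := by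
  obtain ⟨a, b, ha, hab, hb, hz⟩ := cpt_bounds hK hs
  obtain ⟨P, p1, p2, p3, p4, p5⟩ := bump_cpt (hK.image continuous_fst) h.op
    (by rintro _ ⟨z, hz, rfl⟩; exact (hs hz).1)
  have hP1 : ∀ z ∈ K, P z.1 = 1 := fun z hz => p4.self_of_nhdsSet _ (mem_image_of_mem _ hz)
  obtain ⟨c1, -⟩ := cacc h ha hab.le hb p1 p2 p3
  have hKs : K ⊆ univ ×ˢ Icc a b := fun z hz' => ⟨mem_univ _, (hz z hz').1.le, (hz z hz').2.le⟩
  have i1 : IntegrableOn (fun z => ∑ i, gx i u z ^ 2) K :=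
    (c1.mono_set hKs).congr_fun (fun z hz => by simp [hP1 z hz]) hK.measurableSet
  have hu : ContinuousOn u K := h.cont.mono hs
  have hm : ∀ i, AEStronglyMeasurable (gx i u) (volume.restrict K) := fun i => by
    refine (h.measP hb p1 p3 i).aestronglyMeasurable.restrict.congr ?_
    filter_upwards [ae_restrict_mem hK.measurableSet] with z hz'
    simp [hP1 z hz', min_eq_left (hz z hz').2.le]
  have : IsFiniteMeasure (volume.restrict K) := ⟨by simpa using hK.measure_lt_top⟩
  have i2 : IntegrableOn (fun z => 1 + ∑ i, gx i u z ^ 2) K := (integrable_const (1 : ℝ)).add i1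
  have hm2 : AEStronglyMeasurable (fun z => ∑ i, gx i u z ^ 2) (volume.restrict K) := i1.1
  have h0 : ∀ z, 0 ≤ ∑ i, gx i u z ^ 2 := fun z => Finset.sum_nonneg fun i _ => sq_nonneg _
  refine ⟨(hu.pow 2).integrableOn_compact hK |>.add i1, fun i => i2.mono' (hm i) ?_,
    hu.integrableOn_compact hK, i2.mono' (hm2.aemeasurable.sqrt.aestronglyMeasurable) ?_⟩
  · refine ae_of_all _ fun z => ?_
    have : gx i u z ^ 2 ≤ ∑ i, gx i u z ^ 2 :=
      Finset.single_le_sum (f := fun i => gx i u z ^ 2) (fun i _ => sq_nonneg _) (Finset.mem_univ i)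
    rw [Real.norm_eq_abs]
    nlinarith [sq_abs (gx i u z), sq_nonneg (|gx i u z| - 1)]
  · refine ae_of_all _ fun z => ?_
    rw [Real.norm_eq_abs, abs_of_nonneg (Real.sqrt_nonneg _)]
    nlinarith [Real.sq_sqrt (h0 z), sq_nonneg (√(∑ i, gx i u z ^ 2) - 1)]

theorem int_test {n : ℕ} {f P : ZZ n → ℝ} {K : Set (ZZ n)} (hK : IsCompact K)
    (hf : IntegrableOn f K) (hP : Continuous P) (h0 : ∀ z ∉ K, P z = 0) :
    Integrable (fun z => P z * f z) := by
  have h1 : IntegrableOn (fun z => P z * f z) K := hf.continuousOn_mul hP.continuousOn hK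
  exact h1.integrable_of_forall_notMem_eq_zero fun z hz => by simp [h0 z hz]

section slices
variable {n : ℕ} (P : SS n) (t : ℝ)

theorem sl_cd : ContDiff ℝ ∞ (fun y : EE n => P.1 (y, t)) :=
  (scd P).comp (contDiff_id.prodMk contDiff_const)

theorem sl_ts : tsupport (fun y : EE n => P.1 (y, t)) ⊆ {y | (y, t) ∈ tsupport P.1} :=
  tsupport_comp_subset_preimage P.1 (f := fun y : EE n => (y, t)) (by fun_prop)

theorem sl_cs (hc : HasCompactSupport P.1) : HasCompactSupport (fun y : EE n => P.1 (y, t)) := by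
  refine HasCompactSupport.of_support_subset_isCompact (hc.isCompact.image continuous_fst) ?_
  intro y hy
  exact ⟨(y, t), subset_tsupport _ hy, rfl⟩

theorem sl_fd (i : Fin n) (y : EE n) :
    fderiv ℝ (fun y : EE n => P.1 (y, t)) y (bb i) = (XX i P).1 (y, t) :=
  gx_eq (z := (y, t)) ((scd P).differentiable (by simp) _)

theorem DD_ts (v : ZZ n) : tsupport (DD v P).1 ⊆ tsupport P.1 := by
  refine closure_minimal ?_ (isClosed_tsupport _)
  intro x hx
  by_contra h
  exact hx (by
    show fderiv ℝ P.1 x v = 0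
    simp [image_eq_zero_of_notMem_tsupport (fun h' => h (tsupport_fderiv_subset ℝ h'))])

theorem DD_cs (v : ZZ n) (hc : HasCompactSupport P.1) : HasCompactSupport (DD v P).1 :=
  hc.mono' ((subset_tsupport _).trans (DD_ts P v))
end slices

theorem weak1 {n : ℕ} {Ω : Set (EE n)} {T M : ℝ} {u : ZZ n → ℝ} (h : Sol Ω T M u) (P : SS n)
    (hc : HasCompactSupport P.1) (hs : tsupport P.1 ⊆ Ω ×ˢ Iio T) (i : Fin n) :
    ∫ z, P.1 z * gx i u z = - ∫ z, (XX i P).1 z * u z := by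
  obtain ⟨q1, q2, q3, q4⟩ := QQ_int h hc hs
  have i1 : Integrable (fun z => P.1 z * gx i u z) := int_test hc (q2 i) (scd P).continuous
    fun z hz => image_eq_zero_of_notMem_tsupport hz
  have i2 : Integrable (fun z => (XX i P).1 z * u z) := int_test hc q3 (scd _).continuous
    fun z hz => image_eq_zero_of_notMem_tsupport fun h' => hz (DD_ts P _ h')
  rw [Measure.volume_eq_prod] at i1 i2 ⊢
  rw [integral_prod_symm _ i1, integral_prod_symm _ i2, ← integral_neg]
  refine integral_congr_ae (ae_of_all _ fun t => ?_)
  by_cases ht : t < T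
  · have := (ibp h.op (sl_cd P t) (sl_cs P t hc) (fun y hy => (hs (sl_ts P t hy)).1)
      ((h.cx' ht).of_le (by norm_num)) (bb i)).2.2
    simp only [sl_fd] at this
    exact this
  · have e1 : ∀ y, P.1 (y, t) = 0 := fun y => image_eq_zero_of_notMem_tsupport fun h' => ht (hs h').2
    have e2 : ∀ y, (XX i P).1 (y, t) = 0 :=
      fun y => image_eq_zero_of_notMem_tsupport fun h' => ht (hs (DD_ts P _ h')).2
    simp [e1, e2]

theorem LL_val {n : ℕ} (P : SS n) (z : ZZ n) : (LL P).1 z = ∑ i, (XX i (XX i P)).1 z := by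
  rw [← ev_def, LL, map_sum]; rfl

theorem weak2a {n : ℕ} {Ω : Set (EE n)} {T M : ℝ} {u : ZZ n → ℝ} (h : Sol Ω T M u) (P : SS n)
    (hc : HasCompactSupport P.1) (hs : tsupport P.1 ⊆ Ω ×ˢ Iio T) (hP0 : ∀ z, 0 ≤ P.1 z) :
    ∫ z, ((LL P).1 z - (TT P).1 z) * u z ≤ ∫ z, P.1 z * (M * (|u z| + √(∑ i, gx i u z ^ 2))) := by
  obtain ⟨q1, q2, q3, q4⟩ := QQ_int h hc hs
  have o1 : ∀ z ∉ tsupport P.1, P.1 z = 0 := fun z hz => image_eq_zero_of_notMem_tsupport hz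
  have o2 : ∀ v, ∀ z ∉ tsupport P.1, (DD v P).1 z = 0 :=
    fun v z hz => image_eq_zero_of_notMem_tsupport fun h' => hz (DD_ts P _ h')
  have o3 : ∀ v w, ∀ z ∉ tsupport P.1, (DD v (DD w P)).1 z = 0 :=
    fun v w z hz => image_eq_zero_of_notMem_tsupport fun h' => hz (DD_ts P _ (DD_ts _ _ h'))
  have o4 : ∀ z ∉ tsupport P.1, (LL P).1 z = 0 := fun z hz => by
    rw [LL_val]; exact Finset.sum_eq_zero fun i _ => o3 _ _ z hz
  have i1 : Integrable (fun z => P.1 z * (M * (|u z| + √(∑ i, gx i u z ^ 2)))) :=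
    int_test hc ((q3.abs.add q4).const_mul M) (scd P).continuous o1
  have i2 : Integrable (fun z => ((LL P).1 z - (TT P).1 z) * u z) :=
    int_test hc q3 ((scd _).continuous.sub (scd _).continuous)
      fun z hz => by rw [o4 z hz]; simp [TT, o2 _ z hz]
  have i3 := i1.sub i2
  obtain ⟨a, b, ha, hab, hb, hz⟩ := cpt_bounds hc hs
  set F : ZZ n → ℝ := fun z => P.1 z * (M * (|u z| + √(∑ i, gx i u z ^ 2))) -
    ((LL P).1 z - (TT P).1 z) * u z with hF
  change Integrable F at i3
  have hFo : ∀ z ∉ tsupport P.1, F z = 0 := fun z hz => by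
    simp [hF, o1 z hz, o4 z hz, TT, o2 _ z hz]
  rw [← sub_nonneg, ← integral_sub i1 i2]
  have i3' := i3
  rw [Measure.volume_eq_prod] at i3
  rw [Measure.volume_eq_prod, integral_prod_symm _ i3]
  have hH := i3.integral_prod_right
  change Integrable (fun t => ∫ y, F (y, t)) at hH
  change 0 ≤ ∫ t, ∫ y, F (y, t)
  have hsup : Function.support (fun t => ∫ y, F (y, t)) ⊆ Ioc a b := by
    intro t ht
    by_contra hn
    refine ht ?_
    have : ∀ y, F (y, t) = 0 := fun y => hFo _ fun h' => hn ⟨(hz _ h').1, (hz _ h').2.le⟩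
    simp [this]
  rw [← intervalIntegral.integral_eq_integral_of_support_subset hsup]
  have hcont : Continuous (fun z => P.1 z * u z) :=
    glueC (h.op.prod isOpen_Iio) (scd P).continuous hs h.cont
  have hBc : Continuous (fun t => ∫ y, P.1 (y, t) * u (y, t)) := by
    rw [← continuousOn_univ]
    refine continuousOn_integral_of_compact_support (k := Prod.fst '' tsupport P.1)
      (hc.isCompact.image continuous_fst) ?_ ?_
    · exact (hcont.comp continuous_swap).continuousOn
    · intro p x _ hx
      rw [o1 (x, p) fun h' => hx ⟨_, h', rfl⟩, zero_mul]
  obtain ⟨L, hL⟩ := ((scd P).of_le (m := 1) (by exact_mod_cast le_top)).lipschitzWith_of_hasCompactSupport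
    hc (by simp)
  have hder : ∀ t < T, ∃ B', HasDerivWithinAt (fun t => ∫ y, P.1 (y, t) * u (y, t)) B' (Iic t) t ∧
      B' ≤ ∫ y, F (y, t) := by
    intro t ht
    set K := Prod.fst '' tsupport P.1
    have hK : IsCompact K := hc.isCompact.image continuous_fst
    have hKΩ : K ⊆ Ω := by rintro _ ⟨z, hz, rfl⟩; exact (hs hz).1
    have hK0 : ∀ t, ∀ y ∉ K, (y, t) ∉ tsupport P.1 := fun t y hy h' => hy ⟨_, h', rfl⟩
    choose! d hd hd2 using fun (x : EE n) (hx : x ∈ Ω) => h.der ht hx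
    have hut : ContinuousOn (fun y => u (y, t)) Ω := (h.cx' ht).continuousOn
    obtain ⟨Λ, hΛ, δ, hδ, hlip⟩ := h.lip ht hK hKΩ
    obtain ⟨N, hN⟩ := hK.exists_bound_of_continuousOn (hut.mono hKΩ)
    obtain ⟨N2, hN2⟩ := hc.exists_bound_of_continuous (scd P).continuous
    have hsl : ∀ t, tsupport (fun y : EE n => P.1 (y, t)) ⊆ Ω := fun t y hy => (hs (sl_ts P t hy)).1
    obtain ⟨j1, h1⟩ := LD (f := fun z : ZZ n => P.1 z * u z)
      (f' := fun y => (TT P).1 (y, t) * u (y, t) + P.1 (y, t) * d y) (K := K) (t₁ := t)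
      (Λ := N2 * Λ + L * N) hK hδ
      (fun s y hy => by simp [o1 _ (hK0 s y hy)])
      (fun s hs' => glueI h.op (sl_cd P s).continuous (sl_cs P s hc) (hsl s)
        ((h.cx' (lt_of_le_of_lt hs'.2 ht)).continuousOn))
      (fun y hy s hs' => by
        have a2 := hN y hy
        have a3 := hlip y hy s hs'
        have a4 := hN2 (y, s)
        have a5 := hL.dist_le_mul (y, s) (y, t)
        rw [Real.norm_eq_abs] at a2 a4
        have hst : 0 ≤ t - s := by linarith [hs'.2]
        have e : dist ((y, s) : ZZ n) (y, t) = t - s := by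
          rw [Prod.dist_eq]; simp [Real.dist_eq, abs_sub_comm s t, abs_of_nonneg hst, hst]
        rw [e, Real.dist_eq] at a5
        have : P.1 (y, s) * u (y, s) - P.1 (y, t) * u (y, t) =
          P.1 (y, s) * (u (y, s) - u (y, t)) + (P.1 (y, s) - P.1 (y, t)) * u (y, t) := by ring
        rw [this]
        refine (abs_add_le _ _).trans ?_
        rw [abs_mul, abs_mul]
        have hN0 := (abs_nonneg _).trans a2
        have hN20 := (abs_nonneg _).trans a4
        calc _ ≤ N2 * (Λ * (t - s)) + L * (t - s) * N := by gcongr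
          _ = _ := by ring)
      (fun y => by
        have hPt : HasDerivWithinAt (fun s => P.1 (y, s)) ((TT P).1 (y, t)) (Iic t) t := by
          have e1 : HasDerivAt (fun s : ℝ => (y, s)) ((0, 1) : ZZ n) t :=
            (hasDerivAt_const t y).prodMk (hasDerivAt_id t)
          exact (((scd P).differentiable (by simp) (y, t)).hasFDerivAt.comp_hasDerivAt t e1).hasDerivWithinAt
        by_cases hy : y ∈ Ω
        · exact hPt.mul (hd y hy)
        · have hy' : y ∉ K := fun h' => hy (hKΩ h')
          have e1 : ∀ s, P.1 (y, s) = 0 := fun s => o1 _ (hK0 s y hy')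
          have e2 : (TT P).1 (y, t) = 0 := o2 _ _ (hK0 t y hy')
          simp only [e1, e2]
          simpa using hasDerivWithinAt_const t _ (0 : ℝ))
    refine ⟨_, h1, ?_⟩
    have Z : ∀ i : Fin n, Integrable (fun y => P.1 (y, t) * gx i (gx i u) (y, t) -
        (XX i (XX i P)).1 (y, t) * u (y, t)) ∧ ∫ y, (P.1 (y, t) * gx i (gx i u) (y, t) -
        (XX i (XX i P)).1 (y, t) * u (y, t)) = 0 := by
      intro i
      obtain ⟨k1, k2, k3⟩ := ibp h.op (sl_cd P t) (sl_cs P t hc) (hsl t) (h.gxcd ht i) (bb i)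
      obtain ⟨l1, l2, l3⟩ := ibp h.op (sl_cd (XX i P) t) (sl_cs (XX i P) t (DD_cs P _ hc))
        (fun y hy => (hs (DD_ts P _ (sl_ts _ t hy))).1) ((h.cx' ht).of_le (by norm_num)) (bb i)
      simp only [sl_fd] at k2 k3 l2 l3
      refine ⟨k1.sub l2, ?_⟩
      have e : ∫ y, P.1 (y, t) * gx i (gx i u) (y, t) = - ∫ y, (XX i P).1 (y, t) * gx i u (y, t) := k3
      have e' : ∫ y, (XX i P).1 (y, t) * gx i u (y, t) = - ∫ y, (XX i (XX i P)).1 (y, t) * u (y, t) := l3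
      rw [integral_sub (by exact k1) l2, e, e']; simp
    have iS := integrable_finsetSum Finset.univ fun i _ => (Z i).1
    have hsum : ∫ y, ∑ i, (P.1 (y, t) * gx i (gx i u) (y, t) -
        (XX i (XX i P)).1 (y, t) * u (y, t)) = 0 := by
      rw [integral_finsetSum _ fun i _ => (Z i).1]
      exact Finset.sum_eq_zero fun i _ => (Z i).2
    have hgc : ContinuousOn (fun y => M * (|u (y, t)| + √(∑ i, gx i u (y, t) ^ 2))) Ω :=
      (hut.abs.add (continuousOn_finsetSum _ fun i _ => (h.gxcd ht i).continuousOn.pow 2).sqrt).const_mul M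
    have k1 : Integrable (fun y => P.1 (y, t) * (M * (|u (y, t)| + √(∑ i, gx i u (y, t) ^ 2)))) :=
      glueI h.op (sl_cd P t).continuous (sl_cs P t hc) (hsl t) hgc
    have k2 : Integrable (fun y => ((LL P - TT P).1 (y, t)) * u (y, t)) := by
      have hts : tsupport (LL P - TT P).1 ⊆ tsupport P.1 := by
        refine closure_minimal (fun z hz => ?_) (isClosed_tsupport _)
        by_contra h'
        refine hz ?_
        show (LL P).1 z - (TT P).1 z = 0
        rw [o4 z h']; simp [TT, o2 _ z h']
      exact glueI h.op (sl_cd _ t).continuous (sl_cs _ t (hc.mono' ((subset_tsupport _).trans hts)))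
        (fun y hy => (hs (hts (sl_ts _ t hy))).1) hut
    have iF : Integrable (fun y => F (y, t)) := k1.sub k2
    have e : ∫ y, ((TT P).1 (y, t) * u (y, t) + P.1 (y, t) * d y) =
        ∫ y, (((TT P).1 (y, t) * u (y, t) + P.1 (y, t) * d y) + ∑ i, (P.1 (y, t) * gx i (gx i u) (y, t) -
        (XX i (XX i P)).1 (y, t) * u (y, t))) := by
      rw [integral_add j1 iS, hsum, add_zero]
    rw [e]
    refine integral_mono (j1.add iS) iF fun y => ?_
    simp only [hF, LL_val]
    rw [Finset.sum_sub_distrib, ← Finset.mul_sum, ← Finset.sum_mul]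
    by_cases hy : y ∈ Ω
    · have := mul_le_mul_of_nonneg_left ((le_abs_self _).trans (hd2 y hy)) (hP0 (y, t))
      linarith
    · have hy' : y ∉ K := fun h' => hy (hKΩ h')
      have e1 : P.1 (y, t) = 0 := o1 _ (hK0 t y hy')
      rw [e1]
      linarith
  choose! B' hB1 hB2 using hder
  have := left_ineq (a := a) (b := b) (H := fun t => ∫ y, F (y, t)) hab.le hBc.continuousOn
    (fun t ht => hB1 t (ht.2.trans hb)) hH.integrableOn (fun t ht => hB2 t (ht.2.trans hb))
  have ea : ∀ y, P.1 (y, a) = 0 := fun y => o1 _ fun h' => (hz _ h').1.false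
  have eb : ∀ y, P.1 (y, b) = 0 := fun y => o1 _ fun h' => (hz _ h').2.false
  simpa [ea, eb] using this

theorem weak2 {n : ℕ} {Ω : Set (EE n)} {T M : ℝ} {u : ZZ n → ℝ} (h : Sol Ω T M u) (P : SS n)
    (hc : HasCompactSupport P.1) (hs : tsupport P.1 ⊆ Ω ×ˢ Iio T) (hP0 : ∀ z, 0 ≤ P.1 z) :
    |∫ z, ((LL P).1 z - (TT P).1 z) * u z| ≤ ∫ z, P.1 z * (M * (|u z| + √(∑ i, gx i u z ^ 2))) := by
  refine abs_le'.2 ⟨weak2a h P hc hs hP0, ?_⟩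
  have e : ∀ i (f : ZZ n → ℝ), gx i (fun z => - f z) = fun z => - gx i f z := by
    intro i f; ext z; simp [gx, fderiv_fun_neg]
  have := weak2a h.neg P hc hs hP0
  simpa [e, integral_neg] using this

theorem fatou_real {α : Type*} [MeasurableSpace α] {μ : Measure α} {f : ℕ → α → ℝ} {g : α → ℝ} {R : ℝ}
    (hf : ∀ k, Integrable (f k) μ) (h0 : ∀ k x, 0 ≤ f k x) (hg : Integrable g μ)
    (ht : ∀ᵐ x ∂μ, Tendsto (fun k => f k x) atTop (𝓝 (g x)))
    (hR : ∀ᶠ k in atTop, ∫ x, f k x ∂μ ≤ R) : ∫ x, g x ∂μ ≤ R := by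
  have g0 : 0 ≤ᵐ[μ] g := by
    filter_upwards [ht] with x hx using ge_of_tendsto' hx fun k => h0 k x
  have hl : ∫⁻ t, ENNReal.ofReal (g t) ∂μ ≤ ENNReal.ofReal R := by
    calc ∫⁻ t, ENNReal.ofReal (g t) ∂μ = ∫⁻ t, liminf (fun k : ℕ => ENNReal.ofReal (f k t)) atTop ∂μ :=
          lintegral_congr_ae (by
            filter_upwards [ht] with x hx using (ENNReal.tendsto_ofReal hx).liminf_eq.symm)
      _ ≤ liminf (fun k : ℕ => ∫⁻ t, ENNReal.ofReal (f k t) ∂μ) atTop :=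
          lintegral_liminf_le' fun k => (hf k).1.aemeasurable.ennreal_ofReal
      _ ≤ ENNReal.ofReal R := by
          refine liminf_le_of_le (by isBoundedDefault) fun b hb => ?_
          obtain ⟨k, hk, hk2⟩ := (hb.and hR).exists
          refine hk.trans ?_
          rw [← ofReal_integral_eq_lintegral_ofReal (hf k) (ae_of_all _ (h0 k))]
          exact ENNReal.ofReal_le_ofReal hk2
  have hS : 0 ≤ R := by
    obtain ⟨k, hk⟩ := hR.exists
    exact (integral_nonneg (h0 k)).trans hk
  rw [← ofReal_integral_eq_lintegral_ofReal hg g0] at hl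
  exact (ENNReal.ofReal_le_ofReal_iff hS).1 hl

section mol
variable {n : ℕ}

/-- mollification -/
noncomputable def mol (ρ : SS n) (hρ : HasCompactSupport ρ.1) (v : ZZ n → ℝ) (hv : Integrable v) : SS n :=
  ⟨convolution v ρ.1 (ContinuousLinearMap.lsmul ℝ ℝ) volume,
    hρ.contDiff_convolution_right _ hv.locallyIntegrable (scd ρ)⟩

theorem mol_val (ρ : SS n) (hρ : HasCompactSupport ρ.1) (v : ZZ n → ℝ) (hv : Integrable v) (z : ZZ n) :
    (mol ρ hρ v hv).1 z = ∫ t, v t * ρ.1 (z - t) := rfl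

theorem DD_mol (ρ : SS n) (hρ : HasCompactSupport ρ.1) (v : ZZ n → ℝ) (hv : Integrable v) (w : ZZ n) :
    DD w (mol ρ hρ v hv) = mol (DD w ρ) (DD_cs ρ w hρ) v hv := by
  ext z
  have h1 := hρ.hasFDerivAt_convolution_right (ContinuousLinearMap.lsmul ℝ ℝ) hv.locallyIntegrable
    ((scd ρ).of_le (m := 1) (by exact_mod_cast le_top)) z
  show fderiv ℝ (convolution v ρ.1 (ContinuousLinearMap.lsmul ℝ ℝ) volume) z w = _
  rw [h1.fderiv, convolution_def, ContinuousLinearMap.integral_apply]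
  · rfl
  · have := (hρ.fderiv ℝ).convolutionExists_right ((ContinuousLinearMap.lsmul ℝ ℝ).precompR (ZZ n))
      hv.locallyIntegrable ((scd ρ).continuous_fderiv (by simp)) z
    exact this

/-- reflected translate -/
noncomputable def rt (ρ : SS n) (z : ZZ n) : SS n :=
  ⟨fun t => ρ.1 (z - t), (scd ρ).comp (contDiff_const.sub contDiff_id)⟩

theorem DD_rt (ρ : SS n) (z w : ZZ n) : DD w (rt ρ z) = - rt (DD w ρ) z := by
  ext t
  have h1 : HasFDerivAt (fun t : ZZ n => z - t) (-(ContinuousLinearMap.id ℝ (ZZ n))) t :=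
    (hasFDerivAt_id t).const_sub z
  have h2 := ((scd ρ).differentiable (by simp) (z - t)).hasFDerivAt.comp t h1
  show fderiv ℝ (ρ.1 ∘ (fun t : ZZ n => z - t)) t w = - fderiv ℝ ρ.1 (z - t) w
  rw [h2.fderiv]; simp

theorem rt_cs (ρ : SS n) (z : ZZ n) (hρ : HasCompactSupport ρ.1) : HasCompactSupport (rt ρ z).1 :=
  hρ.comp_homeomorph (Homeomorph.subLeft z)

theorem mol_int (ρ : SS n) (hρ : HasCompactSupport ρ.1) (v : ZZ n → ℝ) (hv : Integrable v) (z : ZZ n) :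
    Integrable (fun t => v t * ρ.1 (z - t)) :=
  hρ.convolutionExists_right (ContinuousLinearMap.lsmul ℝ ℝ) hv.locallyIntegrable (scd ρ).continuous z

theorem jens {μ : Measure (ZZ n)} {ρ a : ZZ n → ℝ} (h0 : ∀ z, 0 ≤ ρ z) (i0 : Integrable ρ μ) (h1 : ∫ z, ρ z ∂μ = 1)
    (i1 : Integrable (fun z => a z * ρ z) μ) (i2 : Integrable (fun z => a z ^ 2 * ρ z) μ) :
    (∫ z, a z * ρ z ∂μ) ^ 2 ≤ ∫ z, a z ^ 2 * ρ z ∂μ := by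
  set m := ∫ z, a z * ρ z ∂μ with hm
  have : 0 ≤ ∫ z, (a z - m) ^ 2 * ρ z ∂μ := integral_nonneg fun z => mul_nonneg (sq_nonneg _) (h0 z)
  have e : ∀ z, (a z - m) ^ 2 * ρ z = a z ^ 2 * ρ z - 2 * m * (a z * ρ z) + m ^ 2 * ρ z := fun z => by ring
  simp only [e] at this
  have i3 : Integrable (fun z => a z ^ 2 * ρ z - 2 * m * (a z * ρ z)) μ := i2.sub (i1.const_mul _)
  rw [integral_add i3 (i0.const_mul _), integral_sub i2 (i1.const_mul _),
    integral_const_mul, integral_const_mul, h1, ← hm] at this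
  nlinarith

theorem mol_pair (ρ : SS n) (hρ : HasCompactSupport ρ.1) (q : ZZ n → ℝ) (hq : Integrable q)
    (q0 : ∀ z, 0 ≤ q z) (h0 : ∀ z, 0 ≤ ρ.1 z) (h1 : ∫ z, ρ.1 z = 1) {h : ZZ n → ℝ} (hc : Continuous h)
    (hcs : HasCompactSupport h) {η : ℝ} (hη : ∀ z t, ρ.1 (z - t) ≠ 0 → h z ≤ h t + η)
    (hi : Integrable (fun t => q t * h t)) :
    ∫ z, h z * (mol ρ hρ q hq).1 z ≤ ∫ t, q t * (h t + η) := by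
  obtain ⟨N, hN⟩ := hρ.exists_bound_of_continuous (scd ρ).continuous
  have hhi : Integrable h := hc.integrable_of_hasCompactSupport hcs
  have I : Integrable (fun p : ZZ n × ZZ n => ρ.1 (p.1 - p.2) * (h p.1 * q p.2)) (volume.prod volume) :=
    (hhi.mul_prod hq).bdd_mul (c := N)
      ((scd ρ).continuous.comp (continuous_fst.sub continuous_snd)).aestronglyMeasurable
      (ae_of_all _ fun p => hN _)
  have e1 : ∫ z, h z * (mol ρ hρ q hq).1 z = ∫ z, ∫ t, ρ.1 (z - t) * (h z * q t) := by
    refine integral_congr_ae (ae_of_all _ fun z => ?_)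
    simp only [mol_val]
    rw [← integral_const_mul]
    exact integral_congr_ae (ae_of_all _ fun t => by ring)
  rw [e1, integral_integral_swap (by exact I)]
  have i0 : Integrable ρ.1 := (scd ρ).continuous.integrable_of_hasCompactSupport hρ
  refine integral_mono I.integral_prod_right ?_ fun t => ?_
  · have := hi.add (hq.mul_const η)
    refine this.congr (ae_of_all _ fun t => ?_)
    simp only [Pi.add_apply]; ring
  · have e2 : q t * (h t + η) = ∫ z, ρ.1 (z - t) * ((h t + η) * q t) := by
      rw [integral_mul_const, integral_sub_right_eq_self ρ.1 t, h1]; ring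
    rw [e2]
    obtain ⟨L, hL⟩ := hcs.exists_bound_of_continuous hc
    refine integral_mono ?_ ((i0.comp_sub_right t).mul_const _) fun z => ?_
    · have := ((i0.comp_sub_right t).mul_const (q t)).bdd_mul (c := L) hc.aestronglyMeasurable (ae_of_all _ hL)
      refine this.congr (ae_of_all _ fun z => ?_)
      show h z * (ρ.1 (z - t) * q t) = _
      ring
    · show ρ.1 (z - t) * (h z * q t) ≤ ρ.1 (z - t) * ((h t + η) * q t)
      by_cases hz : ρ.1 (z - t) = 0
      · simp [hz]
      · exact mul_le_mul_of_nonneg_left (mul_le_mul_of_nonneg_right (hη z t hz) (q0 t)) (h0 _)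
end mol

theorem jens' {n : ℕ} (ρ : SS n) (hρ : HasCompactSupport ρ.1) (h0 : ∀ z, 0 ≤ ρ.1 z) (h1 : ∫ z, ρ.1 z = 1)
    {a : ZZ n → ℝ} (i1 : Integrable a) (i2 : Integrable (fun z => a z ^ 2)) (z : ZZ n) :
    (∫ t, a t * ρ.1 (z - t)) ^ 2 ≤ ∫ t, a t ^ 2 * ρ.1 (z - t) :=
  jens (fun t => h0 _) (((scd ρ).continuous.integrable_of_hasCompactSupport hρ).comp_sub_left z)
    (by rw [integral_sub_left_eq_self ρ.1 volume z, h1]) (mol_int ρ hρ a i1 z) (mol_int ρ hρ _ i2 z)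

theorem mol_bounds {n : ℕ} {Ω : Set (EE n)} {T M : ℝ} {u : ZZ n → ℝ} (h : Sol Ω T M u)
    {K : Set (ZZ n)} (hK : IsCompact K) (hs : K ⊆ Ω ×ˢ Iio T) (hv : Integrable (K.indicator u))
    (hq : Integrable (K.indicator (QQ u)))
    (ρ : SS n) (hρ : HasCompactSupport ρ.1) (h0 : ∀ z, 0 ≤ ρ.1 z) (h1 : ∫ z, ρ.1 z = 1)
    {z : ZZ n} (hz : tsupport (rt ρ z).1 ⊆ K) :
    (mol ρ hρ _ hv).1 z ^ 2 + ∑ i, (XX i (mol ρ hρ _ hv)).1 z ^ 2 ≤ (mol ρ hρ _ hq).1 z ∧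
    ((LL (mol ρ hρ _ hv)).1 z + (TT (mol ρ hρ _ hv)).1 z) ^ 2 ≤ 2 * M ^ 2 * (mol ρ hρ _ hq).1 z ∧
    ∀ i hg, (XX i (mol ρ hρ _ hv)).1 z = (mol ρ hρ (K.indicator (gx i u)) hg).1 z := by
  classical
  obtain ⟨q1, q2, q3, q4⟩ := QQ_int h hK hs
  have hm := hK.measurableSet
  set P := rt ρ z with hP
  have hPc : HasCompactSupport P.1 := rt_cs ρ z hρ
  have hPs := hz.trans hs
  have g1 : ∀ i, Integrable (K.indicator (gx i u)) := fun i => (q2 i).integrable_indicator hm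
  have sqi : ∀ (f : ZZ n → ℝ) (c : ℝ), Integrable (K.indicator f) → (∀ z, f z ^ 2 ≤ c * QQ u z) →
      Integrable (fun z => K.indicator f z ^ 2) := fun f c hf hle => by
    refine (hq.const_mul c).mono' (hf.1.pow 2) (ae_of_all _ fun t => ?_)
    by_cases ht : t ∈ K
    · simp only [indicator_of_mem ht, Real.norm_eq_abs, abs_of_nonneg (sq_nonneg (f t))]
      exact hle t
    · simp [ht]
  have s0 : ∀ t, 0 ≤ ∑ i, gx i u t ^ 2 := fun z => Finset.sum_nonneg fun i _ => sq_nonneg _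
  have sv := sqi u 1 hv (fun t => by simp only [QQ]; linarith [s0 t])
  have sg : ∀ i, Integrable (fun z => K.indicator (gx i u) z ^ 2) := fun i =>
    sqi _ 1 (g1 i) (fun t => by
      have : gx i u t ^ 2 ≤ ∑ i, gx i u t ^ 2 :=
        Finset.single_le_sum (f := fun i => gx i u t ^ 2) (fun i _ => sq_nonneg _) (Finset.mem_univ i)
      simp only [QQ]; nlinarith [sq_nonneg (u t)])
  have off : ∀ t ∉ K, P.1 t = 0 := fun t ht => image_eq_zero_of_notMem_tsupport fun h' => ht (hz h')
  have offD : ∀ w, ∀ t ∉ K, (DD w P).1 t = 0 := fun w t ht =>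
    image_eq_zero_of_notMem_tsupport fun h' => ht (hz (DD_ts _ _ h'))
  have offDD : ∀ w w', ∀ t ∉ K, (DD w (DD w' P)).1 t = 0 := fun w w' t ht =>
    image_eq_zero_of_notMem_tsupport fun h' => ht (hz (DD_ts _ _ (DD_ts _ _ h')))
  -- first derivatives
  have eD : ∀ w, (DD w (mol ρ hρ _ hv)).1 z = - ∫ t, (DD w P).1 t * u t := fun w => by
    rw [DD_mol, mol_val, ← integral_neg]
    refine integral_congr_ae (ae_of_all _ fun t => ?_)
    have e : (DD w P).1 t = - (DD w ρ).1 (z - t) := by rw [hP, DD_rt]; rfl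
    by_cases ht : t ∈ K
    · simp only [indicator_of_mem ht, e]; ring
    · simp only [indicator_of_notMem ht, offD w t ht]; simp
  have eDD : ∀ w, (DD w (DD w (mol ρ hρ _ hv))).1 z = ∫ t, (DD w (DD w P)).1 t * u t := fun w => by
    rw [DD_mol, DD_mol, mol_val]
    refine integral_congr_ae (ae_of_all _ fun t => ?_)
    have e : (DD w (DD w P)).1 t = (DD w (DD w ρ)).1 (z - t) := by
      rw [hP, DD_rt, map_neg, DD_rt, neg_neg]; rfl
    by_cases ht : t ∈ K
    · simp only [indicator_of_mem ht, e]; ring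
    · simp only [indicator_of_notMem ht, offDD w w t ht]; simp
  have eX : ∀ i, (XX i (mol ρ hρ _ hv)).1 z = ∫ t, K.indicator (gx i u) t * ρ.1 (z - t) := fun i => by
    rw [XX, eD]
    have := weak1 h P hPc hPs i
    rw [XX] at this
    rw [← this]
    refine integral_congr_ae (ae_of_all _ fun t => ?_)
    by_cases ht : t ∈ K
    · simp only [indicator_of_mem ht]; exact mul_comm _ _
    · simp only [indicator_of_notMem ht, off t ht]; simp
  have eq0 : (mol ρ hρ _ hq).1 z = ∫ t, K.indicator (QQ u) t * ρ.1 (z - t) := mol_val _ _ _ _ _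
  refine ⟨?_, ?_, fun i hg => eX i⟩
  · have j1 := jens' ρ hρ h0 h1 hv sv z
    have j2 := fun i => jens' ρ hρ h0 h1 (g1 i) (sg i) z
    rw [mol_val, eq0]
    simp only [eX]
    refine (add_le_add j1 (Finset.sum_le_sum fun i _ => j2 i)).trans (le_of_eq ?_)
    rw [← integral_finsetSum _ fun i _ => mol_int ρ hρ _ (sg i) z, ← integral_add (mol_int ρ hρ _ sv z)
      (integrable_finsetSum _ fun i _ => mol_int ρ hρ _ (sg i) z)]
    refine integral_congr_ae (ae_of_all _ fun t => ?_)
    by_cases ht : t ∈ K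
    · simp only [indicator_of_mem ht, QQ, add_mul, Finset.sum_mul]
    · simp [indicator_of_notMem ht]
  · set a : ZZ n → ℝ := fun t => M * (|u t| + √(∑ i, gx i u t ^ 2)) with ha
    have ia : Integrable (K.indicator a) := IntegrableOn.integrable_indicator (f := a) (show IntegrableOn a K volume from (q3.abs.add q4).const_mul M) hm
    have hale : ∀ t, a t ^ 2 ≤ (2 * M ^ 2) * QQ u t := fun t => by
      simp only [ha, QQ]
      have e1 := sq_abs (u t)
      have e2 := Real.sq_sqrt (s0 t)
      have e3 := sq_nonneg (|u t| - √(∑ i, gx i u t ^ 2))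
      have : (|u t| + √(∑ i, gx i u t ^ 2)) ^ 2 ≤ 2 * (u t ^ 2 + ∑ i, gx i u t ^ 2) := by nlinarith
      rw [mul_pow]
      nlinarith [sq_nonneg M]
    have sa := sqi a _ ia hale
    have j1 := jens' ρ hρ h0 h1 ia sa z
    have w2 := weak2 h P hPc hPs (fun t => h0 _)
    have e1 : (LL (mol ρ hρ _ hv)).1 z + (TT (mol ρ hρ _ hv)).1 z =
        ∫ t, ((LL P).1 t - (TT P).1 t) * u t := by
      rw [LL_val, TT, eD]
      simp only [XX, eDD]
      have ii : ∀ w, Integrable (fun t => (DD w (DD w P)).1 t * u t) := fun w =>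
        int_test hK q3 (scd _).continuous (offDD w w)
      rw [← integral_finsetSum _ fun i _ => ii _, ← sub_eq_add_neg, ← integral_sub
        (integrable_finsetSum _ fun i _ => ii _) (int_test hK q3 (scd _).continuous (offD _))]
      refine integral_congr_ae (ae_of_all _ fun t => ?_)
      simp only [LL_val, XX, ← Finset.sum_mul]; ring
    have e2 : ∫ t, P.1 t * (M * (|u t| + √(∑ i, gx i u t ^ 2))) = ∫ t, K.indicator a t * ρ.1 (z - t) := by
      refine integral_congr_ae (ae_of_all _ fun t => ?_)
      by_cases ht : t ∈ K
      · simp only [indicator_of_mem ht]; exact mul_comm _ _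
      · simp only [indicator_of_notMem ht, off t ht]; simp
    rw [e1, ← sq_abs]
    rw [e2] at w2
    refine (pow_le_pow_left₀ (abs_nonneg _) w2 2).trans (j1.trans ?_)
    rw [eq0, ← integral_const_mul]
    refine integral_mono (mol_int ρ hρ _ sa z) ((mol_int ρ hρ _ hq z).const_mul _) fun t => ?_
    by_cases ht : t ∈ K
    · simp only [indicator_of_mem ht]
      rw [← mul_assoc]
      exact mul_le_mul_of_nonneg_right (hale t) (h0 _)
    · simp [indicator_of_notMem ht]

section carlu
variable {n : ℕ}

theorem SS_sum_val (s : Fin n → SS n) (z : ZZ n) : (∑ i, s i).1 z = ∑ i, (s i).1 z := by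
  rw [← ev_def, map_sum]; rfl

theorem XX_mul_val (χ U : SS n) (w z : ZZ n) :
    (DD w (χ * U)).1 z = χ.1 z * (DD w U).1 z + U.1 z * (DD w χ).1 z := by
  rw [Derivation.leibniz]; rfl

theorem LT_mul_val (χ U : SS n) (z : ZZ n) :
    (LL (χ * U)).1 z + (TT (χ * U)).1 z = χ.1 z * ((LL U).1 z + (TT U).1 z)
      + 2 * ∑ i, (XX i χ).1 z * (XX i U).1 z + U.1 z * ((LL χ).1 z + (TT χ).1 z) := by
  have e : ∀ i, (XX i (XX i (χ * U))).1 z = χ.1 z * (XX i (XX i U)).1 z + 2 * ((XX i χ).1 z * (XX i U).1 z)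
      + U.1 z * (XX i (XX i χ)).1 z := fun i => by
    simp only [XX, Derivation.leibniz, map_add, smul_eq_mul]
    show χ.1 z * _ + _ * _ + (U.1 z * _ + _ * _) = _
    ring
  simp only [LL_val, e, Finset.sum_add_distrib, ← Finset.mul_sum, TT, XX_mul_val]
  ring

/-- the lower order cutoff terms -/
noncomputable def JJ (χ : SS n) (z : ZZ n) : ℝ := ∑ i, (XX i χ).1 z ^ 2 + ((LL χ).1 z + (TT χ).1 z) ^ 2

theorem cutoff_pt (χ0 U0 L m Lc M A : ℝ) (dc dU : Fin n → ℝ) (hA : 0 ≤ A) (h1 : U0 ^ 2 + ∑ i, dU i ^ 2 ≤ m)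
    (h2 : L ^ 2 ≤ 2 * M ^ 2 * m) :
    A / 4 * (χ0 ^ 2 * (U0 ^ 2 + ∑ i, dU i ^ 2)) + (χ0 * L + 2 * ∑ i, dc i * dU i + U0 * Lc) ^ 2 ≤
    A * ((χ0 * U0) ^ 2 + 1 / 2 * ∑ i, (χ0 * dU i + U0 * dc i) ^ 2) +
    (6 * M ^ 2 * χ0 ^ 2 + (12 + A / 2) * ∑ i, dc i ^ 2 + 3 * Lc ^ 2) * m := by
  have cs := Finset.sum_mul_sq_le_sq_mul_sq Finset.univ dc dU
  set S := ∑ i, dc i * dU i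
  set c := ∑ i, dc i ^ 2
  set d := ∑ i, dU i ^ 2
  have c0 : 0 ≤ c := Finset.sum_nonneg fun i _ => sq_nonneg _
  have d0 : 0 ≤ d := Finset.sum_nonneg fun i _ => sq_nonneg _
  have e : ∑ i, (χ0 * dU i + U0 * dc i) ^ 2 = χ0 ^ 2 * d + 2 * χ0 * U0 * S + U0 ^ 2 * c := by
    simp only [d, S, c, Finset.mul_sum, ← Finset.sum_add_distrib]
    exact Finset.sum_congr rfl fun i _ => by ring
  have hl : 1 / 2 * χ0 ^ 2 * d - U0 ^ 2 * c ≤ ∑ i, (χ0 * dU i + U0 * dc i) ^ 2 := by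
    simp only [d, c, Finset.mul_sum, ← Finset.sum_sub_distrib]
    exact Finset.sum_le_sum fun i _ => by nlinarith [sq_nonneg (χ0 * dU i + 2 * (U0 * dc i))]
  have h3 : (χ0 * L + 2 * S + U0 * Lc) ^ 2 ≤ 3 * (χ0 ^ 2 * L ^ 2) + 12 * S ^ 2 + 3 * (U0 ^ 2 * Lc ^ 2) := by
    nlinarith [sq_nonneg (χ0 * L - 2 * S), sq_nonneg (χ0 * L - U0 * Lc), sq_nonneg (2 * S - U0 * Lc)]
  have um : U0 ^ 2 ≤ m := by linarith
  have dm : d ≤ m := by nlinarith [sq_nonneg U0]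
  have k1 := mul_le_mul_of_nonneg_left h2 (sq_nonneg χ0)
  have k2 := mul_le_mul_of_nonneg_left dm c0
  have k3 := mul_le_mul_of_nonneg_left um (sq_nonneg Lc)
  have k4 := mul_le_mul_of_nonneg_left um (mul_nonneg hA c0)
  have k5 := mul_le_mul_of_nonneg_left hl hA
  have k6 : 0 ≤ A * (χ0 ^ 2 * U0 ^ 2) := by positivity
  nlinarith

theorem carl_step {Ω : Set (EE n)} {T M : ℝ} {u : ZZ n → ℝ} (h : Sol Ω T M u)
    (χ φ F : SS n) (hc : HasCompactSupport χ.1)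
    {K : Set (ZZ n)} (hK : IsCompact K) (hs : K ⊆ Ω ×ˢ Iio T) (hv : Integrable (K.indicator u))
    (hqi : Integrable (K.indicator (QQ u)))
    (ρ : SS n) (hρ : HasCompactSupport ρ.1) (h0 : ∀ z, 0 ≤ ρ.1 z) (h1 : ∫ z, ρ.1 z = 1)
    (hz : ∀ z ∈ tsupport χ.1, tsupport (rt ρ z).1 ⊆ K)
    {A t₀ : ℝ} (hA : 0 ≤ A) (ht₀ : ∀ z, ρ.1 z ≠ 0 → |z.2| ≤ t₀)
    (hq : ∀ z ∈ tsupport χ.1, - t₀ ≤ z.2 → ∀ ξ : Fin n → ℝ, A * ∑ i, ξ i ^ 2 ≤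
      4 * (∑ j, ∑ i, (XX j (XX i φ)).1 z * ξ i * ξ j) + 2 * F.1 z * ∑ i, ξ i ^ 2)
    (hp : ∀ z ∈ tsupport χ.1, - t₀ ≤ z.2 → A * (1 + ∑ i, (XX i φ).1 z ^ 2) ≤ (pot φ F).1 z) :
    A / 4 * ∫ z, Real.exp (φ.1 z) ^ 2 * (χ.1 z ^ 2 * ((mol ρ hρ _ hv).1 z ^ 2 +
        ∑ i, (XX i (mol ρ hρ _ hv)).1 z ^ 2)) ≤
      ∫ z, (Real.exp (φ.1 z) ^ 2 * (6 * M ^ 2 * χ.1 z ^ 2 + (12 + A / 2) * ∑ i, (XX i χ).1 z ^ 2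
        + 3 * ((LL χ).1 z + (TT χ).1 z) ^ 2)) * (mol ρ hρ _ hqi).1 z := by
  set U := mol ρ hρ _ hv with hU
  set m := mol ρ hρ _ hqi with hm
  have o1 : ∀ z ∉ tsupport χ.1, χ.1 z = 0 := fun z hz => image_eq_zero_of_notMem_tsupport hz
  have o2 : ∀ v, ∀ z ∉ tsupport χ.1, (DD v χ).1 z = 0 :=
    fun v z hz => image_eq_zero_of_notMem_tsupport fun h' => hz (DD_ts χ _ h')
  have o3 : ∀ v w, ∀ z ∉ tsupport χ.1, (DD v (DD w χ)).1 z = 0 :=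
    fun v w z hz => image_eq_zero_of_notMem_tsupport fun h' => hz (DD_ts χ _ (DD_ts _ _ h'))
  have o4 : ∀ z ∉ tsupport χ.1, (LL χ).1 z = 0 := fun z hz => by
    rw [LL_val]; exact Finset.sum_eq_zero fun i _ => o3 _ _ z hz
  have hUneg : ∀ z : ZZ n, z.2 < - t₀ → U.1 z = 0 := fun z hz' => by
    rw [hU, mol_val]
    have : ∀ t, K.indicator u t * ρ.1 (z - t) = 0 := fun t => by
      by_cases h2 : ρ.1 (z - t) = 0
      · simp [h2]
      · have := (abs_le.1 (ht₀ _ h2)).1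
        simp only [Prod.snd_sub] at this
        have e : u t = 0 := h.zero t.1 t.2 (by linarith)
        by_cases h3 : t ∈ K <;> simp [h3, e]
    simp [this]
  have hts : tsupport (χ * U).1 ⊆ tsupport χ.1 ∩ {z | - t₀ ≤ z.2} := by
    refine closure_minimal (fun z hz' => ⟨?_, ?_⟩)
      ((isClosed_tsupport _).inter (isClosed_le continuous_const continuous_snd))
    · exact subset_tsupport _ (fun h' => hz' (by show χ.1 z * U.1 z = 0; simp [h']))
    · by_contra h'
      exact hz' (by show χ.1 z * U.1 z = 0; simp [hUneg z (not_le.1 h')])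
  have hVc : HasCompactSupport (χ * U).1 :=
    hc.mono' ((subset_tsupport _).trans (hts.trans inter_subset_left))
  have C := carl1 (χ * U) φ F hVc hA (fun z hz => hq z (hts hz).1 (hts hz).2)
    (fun z hz => hp z (hts hz).1 (hts hz).2)
  have pt := fun z => XX_mul_val χ U z
  have ce : Continuous fun z => Real.exp (φ.1 z) ^ 2 := (Real.continuous_exp.comp (scd φ).continuous).pow 2
  have cs : ∀ f : SS n, Continuous f.1 := fun f => (scd f).continuous
  have cX : ∀ f : SS n, Continuous fun z => ∑ i, (XX i f).1 z ^ 2 := fun f =>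
    continuous_finsetSum _ fun i _ => (cs _).pow 2
  have intg : ∀ f : ZZ n → ℝ, Continuous f → (∀ z ∉ tsupport χ.1, f z = 0) → Integrable f :=
    fun f hf h0 => hf.integrable_of_hasCompactSupport (HasCompactSupport.intro hc h0)
  have i1 := intg (fun z => Real.exp (φ.1 z) ^ 2 * (χ.1 z ^ 2 * (U.1 z ^ 2 + ∑ i, (XX i U).1 z ^ 2)))
    (ce.mul (((cs _).pow 2).mul (((cs _).pow 2).add (cX _)))) (fun z hz => by simp [o1 z hz])
  have i2 := intg (fun z => (Real.exp (φ.1 z) ^ 2 * (6 * M ^ 2 * χ.1 z ^ 2 + (12 + A / 2) * ∑ i, (XX i χ).1 z ^ 2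
        + 3 * ((LL χ).1 z + (TT χ).1 z) ^ 2)) * m.1 z)
    ((ce.mul ((((cs χ).pow 2).const_mul _).add ((cX χ).const_mul _) |>.add
      ((((cs _).add (cs _)).pow 2).const_mul 3))).mul (cs _))
    (fun z hz => by simp [o1 z hz, o2 _ z hz, o4 z hz, XX, TT])
  have i3 := intg (fun z => Real.exp (φ.1 z) ^ 2 * ((χ * U).1 z ^ 2 + 1 / 2 * ∑ i, (XX i (χ * U)).1 z ^ 2))
    (ce.mul (((cs _).pow 2).add ((cX _).const_mul _)))
    (fun z hz => by
      have : (χ * U).1 z = 0 := by show χ.1 z * U.1 z = 0; simp [o1 z hz]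
      simp [this, XX, o1 z hz, o2 _ z hz])
  have i4 := intg (fun z => Real.exp (φ.1 z) ^ 2 * ((LL (χ * U)).1 z + (TT (χ * U)).1 z) ^ 2)
    (ce.mul (((cs _).add (cs _)).pow 2))
    (fun z hz => by rw [LT_mul_val]; simp [o1 z hz, o2 _ z hz, o4 z hz, XX, TT])
  have key := integral_mono ((i1.const_mul (A / 4)).add i4) ((i3.const_mul A).add i2) (fun z => by
    simp only [Pi.add_apply]
    by_cases hzχ : z ∈ tsupport χ.1
    · obtain ⟨b1, b2, -⟩ := mol_bounds h hK hs hv hqi ρ hρ h0 h1 (hz z hzχ)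
      have := cutoff_pt (χ.1 z) (U.1 z) ((LL U).1 z + (TT U).1 z) (m.1 z) ((LL χ).1 z + (TT χ).1 z) M A
        (fun i => (XX i χ).1 z) (fun i => (XX i U).1 z) hA b1 b2
      rw [LT_mul_val]
      simp only [XX, pt]
      have e : (χ * U).1 z = χ.1 z * U.1 z := rfl
      rw [e]
      have := mul_le_mul_of_nonneg_left this (sq_nonneg (Real.exp (φ.1 z)))
      simp only [XX] at this
      linarith
    · rw [LT_mul_val]
      have e : (χ * U).1 z = 0 := by show χ.1 z * U.1 z = 0; simp [o1 z hzχ]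
      simp [e, o1 z hzχ, o2 _ z hzχ, o4 z hzχ, XX, TT])
  rw [integral_add' (i1.const_mul _) i4, integral_add' (i3.const_mul _) i2, integral_const_mul,
    integral_const_mul] at key
  linarith

theorem carlu {Ω : Set (EE n)} {T M : ℝ} {u : ZZ n → ℝ} (h : Sol Ω T M u)
    (χ φ F : SS n) (hc : HasCompactSupport χ.1) (hχ : tsupport χ.1 ⊆ Ω ×ˢ Iio T)
    {A t₀ : ℝ} (hA : 48 * M ^ 2 + 8 ≤ A) (ht₀ : 0 < t₀)
    (hq : ∀ z ∈ tsupport χ.1, - t₀ ≤ z.2 → ∀ ξ : Fin n → ℝ, A * ∑ i, ξ i ^ 2 ≤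
      4 * (∑ j, ∑ i, (XX j (XX i φ)).1 z * ξ i * ξ j) + 2 * F.1 z * ∑ i, ξ i ^ 2)
    (hp : ∀ z ∈ tsupport χ.1, - t₀ ≤ z.2 → A * (1 + ∑ i, (XX i φ).1 z ^ 2) ≤ (pot φ F).1 z) :
    ∫ z, Real.exp (φ.1 z) ^ 2 * χ.1 z ^ 2 * QQ u z ≤
      16 * ∫ z, Real.exp (φ.1 z) ^ 2 * JJ χ z * QQ u z := by
  have hA0 : 0 ≤ A := by nlinarith [sq_nonneg M]
  obtain ⟨δ, hδ, hδs⟩ := (show IsCompact (tsupport χ.1) from hc).exists_cthickening_subset_open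
    (h.op.prod isOpen_Iio) hχ
  set K := Metric.cthickening δ (tsupport χ.1) with hKdef
  have hK : IsCompact K := (show IsCompact (tsupport χ.1) from hc).cthickening
  obtain ⟨q1, q2, q3, q4⟩ := QQ_int h hK hδs
  have hv := q3.integrable_indicator hK.measurableSet
  have hqi := q1.integrable_indicator hK.measurableSet
  have hgi := fun i => (q2 i).integrable_indicator hK.measurableSet
  have hr : ∀ k : ℕ, 0 < min δ t₀ / (k + 1) := fun k => by positivity
  let B : ℕ → ContDiffBump (0 : ZZ n) := fun k => ⟨min δ t₀ / (k + 1) / 2, min δ t₀ / (k + 1), by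
    have := hr k; positivity, by linarith [hr k]⟩
  have hB : ∀ k, (B k).rOut = min δ t₀ / (k + 1) := fun k => rfl
  have hBle : ∀ k, (B k).rOut ≤ min δ t₀ := fun k => by
    rw [hB]; exact div_le_self (by positivity) (by linarith [(Nat.cast_nonneg k : (0:ℝ) ≤ k)])
  let ρ : ℕ → SS n := fun k => ⟨(B k).normed volume, (B k).contDiff_normed⟩
  have hρ : ∀ k, HasCompactSupport (ρ k).1 := fun k => (B k).hasCompactSupport_normed
  have hρ0 : ∀ k z, 0 ≤ (ρ k).1 z := fun k z => (B k).nonneg_normed z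
  have hρ1 : ∀ k, ∫ z, (ρ k).1 z = 1 := fun k => (B k).integral_normed
  have hρs : ∀ k z, (ρ k).1 z ≠ 0 → ‖z‖ < (B k).rOut := fun k z hz => by
    have : z ∈ Function.support ((B k).normed volume) := hz
    rw [(B k).support_normed_eq] at this
    simpa using this
  have hlim : Tendsto (fun k => (B k).rOut) atTop (𝓝 0) := by
    simp only [hB]
    simpa [div_eq_mul_inv] using (tendsto_one_div_add_atTop_nhds_zero_nat (𝕜 := ℝ)).const_mul (min δ t₀)
  have conv : ∀ f (hf : Integrable f), ∀ᵐ z, Tendsto (fun k => (mol (ρ k) (hρ k) f hf).1 z) atTop (𝓝 (f z)) := by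
    intro f hf
    have := ContDiffBump.ae_convolution_tendsto_right_of_locallyIntegrable (φ := B) (K := 2) hlim
      (Eventually.of_forall fun k => by
        show min δ t₀ / (k + 1) ≤ 2 * (min δ t₀ / (k + 1) / 2); linarith) hf.locallyIntegrable
    filter_upwards [this] with z hz
    refine hz.congr fun k => ?_
    rw [mol_val, convolution_lsmul_swap]
    exact integral_congr_ae (ae_of_all _ fun t => mul_comm _ _)
  have hz : ∀ k, ∀ z ∈ tsupport χ.1, tsupport (rt (ρ k) z).1 ⊆ K := fun k z hz => by
    refine closure_minimal (fun t ht => ?_) Metric.isClosed_cthickening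
    have h1 := hρs k (z - t) ht
    refine Metric.mem_cthickening_of_dist_le t z δ _ hz ?_
    rw [dist_comm, dist_eq_norm]
    linarith [hBle k, min_le_left δ t₀]
  have hts : ∀ k z, (ρ k).1 z ≠ 0 → |z.2| ≤ t₀ := fun k z hz => by
    have h1 := hρs k z hz
    have h2 := norm_snd_le z
    rw [Real.norm_eq_abs] at h2
    linarith [hBle k, min_le_right δ t₀]
  have step := fun k => carl_step h χ φ F hc hK hδs hv hqi (ρ k) (hρ k) (hρ0 k) (hρ1 k) (hz k) hA0 (hts k) hq hp
  have ce : Continuous fun z => Real.exp (φ.1 z) ^ 2 := (Real.continuous_exp.comp (scd φ).continuous).pow 2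
  have cs : ∀ f : SS n, Continuous f.1 := fun f => (scd f).continuous
  have cX : ∀ f : SS n, Continuous fun z => ∑ i, (XX i f).1 z ^ 2 := fun f =>
    continuous_finsetSum _ fun i _ => (cs _).pow 2
  set H : ZZ n → ℝ := fun z => Real.exp (φ.1 z) ^ 2 * (6 * M ^ 2 * χ.1 z ^ 2 + (12 + A / 2) * ∑ i, (XX i χ).1 z ^ 2
        + 3 * ((LL χ).1 z + (TT χ).1 z) ^ 2) with hH
  have Hc : Continuous H := ce.mul ((((cs χ).pow 2).const_mul _).add ((cX χ).const_mul _) |>.add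
      ((((cs _).add (cs _)).pow 2).const_mul 3))
  have o1 : ∀ z ∉ tsupport χ.1, χ.1 z = 0 := fun z hz => image_eq_zero_of_notMem_tsupport hz
  have o2 : ∀ v, ∀ z ∉ tsupport χ.1, (DD v χ).1 z = 0 :=
    fun v z hz => image_eq_zero_of_notMem_tsupport fun h' => hz (DD_ts χ _ h')
  have o4 : ∀ z ∉ tsupport χ.1, (LL χ).1 z = 0 := fun z hz => by
    rw [LL_val]; exact Finset.sum_eq_zero fun i _ =>
      image_eq_zero_of_notMem_tsupport fun h' => hz (DD_ts χ _ (DD_ts _ _ h'))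
  have Ho : ∀ z ∉ tsupport χ.1, H z = 0 := fun z hz => by simp [hH, o1 z hz, o2 _ z hz, o4 z hz, XX, TT]
  have Hcs : HasCompactSupport H := HasCompactSupport.intro hc Ho
  have hsK : tsupport χ.1 ⊆ K := Metric.self_subset_cthickening _
  have itest : ∀ f : ZZ n → ℝ, Continuous f → (∀ z ∉ tsupport χ.1, f z = 0) → Integrable fun z => f z * QQ u z :=
    fun f hf h0 => int_test hK q1 hf fun z hz => h0 z fun h' => hz (hsK h')
  have hind : ∀ f : ZZ n → ℝ, (∀ z ∉ tsupport χ.1, f z = 0) → ∀ z, K.indicator (QQ u) z * f z = f z * QQ u z := by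
    intro f h0 z
    by_cases hz : z ∈ K
    · simp [hz, mul_comm]
    · simp [h0 z fun h' => hz (hsK h')]
  have key : ∀ η > 0, A / 4 * ∫ z, Real.exp (φ.1 z) ^ 2 * χ.1 z ^ 2 * QQ u z ≤
      (∫ z, H z * QQ u z) + η * ∫ z, K.indicator (QQ u) z := by
    intro η hη
    rw [← integral_const_mul]
    have hconvm := conv _ hv
    have hconvg : ∀ᵐ z, ∀ i, Tendsto (fun k => (mol (ρ k) (hρ k) (K.indicator (gx i u)) (hgi i)).1 z) atTop
      (𝓝 (K.indicator (gx i u) z)) := ae_all_iff.2 fun i => conv _ (hgi i)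
    have huc := Hcs.uniformContinuous_of_continuous Hc
    obtain ⟨ε, hε, hε2⟩ := Metric.uniformContinuous_iff.1 huc η hη
    refine fatou_real (f := fun k z => A / 4 * (Real.exp (φ.1 z) ^ 2 * (χ.1 z ^ 2 *
      ((mol (ρ k) (hρ k) _ hv).1 z ^ 2 + ∑ i, (XX i (mol (ρ k) (hρ k) _ hv)).1 z ^ 2)))) (fun k => ?_)
      (fun k z => ?_) ?_ ?_ ?_
    · refine Integrable.const_mul ?_ _
      exact (ce.mul (((cs _).pow 2).mul (((cs _).pow 2).add (cX _)))).integrable_of_hasCompactSupport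
        (HasCompactSupport.intro hc fun z hz => by simp [o1 z hz])
    · have : 0 ≤ ∑ i, (XX i (mol (ρ k) (hρ k) _ hv)).1 z ^ 2 := Finset.sum_nonneg fun i _ => sq_nonneg _
      positivity
    · exact (itest _ (ce.mul ((cs χ).pow 2)) fun z hz => by simp [o1 z hz]).const_mul _
    · filter_upwards [hconvm, hconvg] with z h1 h2
      by_cases hzχ : z ∈ tsupport χ.1
      · have e : ∀ k i, (XX i (mol (ρ k) (hρ k) _ hv)).1 z = (mol (ρ k) (hρ k) (K.indicator (gx i u)) (hgi i)).1 z :=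
          fun k i => (mol_bounds h hK hδs hv hqi (ρ k) (hρ k) (hρ0 k) (hρ1 k) (hz k z hzχ)).2.2 i (hgi i)
        simp only [e]
        have := (((h1.pow 2).add (tendsto_finsetSum Finset.univ fun i _ => (h2 i).pow 2)).const_mul
          (χ.1 z ^ 2)).const_mul (Real.exp (φ.1 z) ^ 2) |>.const_mul (A / 4)
        have e2 : A / 4 * (Real.exp (φ.1 z) ^ 2 * χ.1 z ^ 2 * QQ u z) = A / 4 * (Real.exp (φ.1 z) ^ 2 *
            (χ.1 z ^ 2 * (K.indicator u z ^ 2 + ∑ i, K.indicator (gx i u) z ^ 2))) := by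
          simp only [indicator_of_mem (hsK hzχ), QQ]
          ring
        rw [e2]
        exact this
      · simp [o1 z hzχ]
    · have := hlim.eventually (gt_mem_nhds hε)
      filter_upwards [this] with k hk
      rw [integral_const_mul]
      refine (step k).trans ?_
      have mp := mol_pair (ρ k) (hρ k) _ hqi (fun z => indicator_nonneg (fun z _ => QQ_nonneg u z) z) (hρ0 k)
        (hρ1 k) Hc Hcs (η := η) (fun z t hzt => by
          have h1 := hρs k _ hzt
          have h2 := hε2 (a := z) (b := t) (by rw [dist_eq_norm]; linarith)
          rw [Real.dist_eq] at h2
          linarith [(abs_lt.1 h2).2]) ((itest H Hc Ho).congr (ae_of_all _ fun z => (hind H Ho z).symm))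
      refine mp.trans (le_of_eq ?_)
      simp only [mul_add]
      rw [integral_add ((itest H Hc Ho).congr (ae_of_all _ fun z => (hind H Ho z).symm)) (hqi.mul_const η),
        integral_mul_const]
      simp only [hind H Ho]
      ring
  have key0 : A / 4 * ∫ z, Real.exp (φ.1 z) ^ 2 * χ.1 z ^ 2 * QQ u z ≤ ∫ z, H z * QQ u z := by
    set I := ∫ z, K.indicator (QQ u) z
    have I0 : 0 ≤ I := integral_nonneg fun z => indicator_nonneg (fun z _ => QQ_nonneg u z) z
    refine le_of_forall_pos_le_add fun ε hε => ?_
    have := key (ε / (I + 1)) (by positivity)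
    have : ε / (I + 1) * I ≤ ε := by
      rw [div_mul_eq_mul_div, div_le_iff₀ (by positivity)]; nlinarith
    linarith
  have j1 : Integrable fun z => Real.exp (φ.1 z) ^ 2 * χ.1 z ^ 2 * QQ u z := itest _ (ce.mul ((cs χ).pow 2)) fun z hz => by simp [o1 z hz]
  have JJc : Continuous (JJ χ) := (cX χ).add (((cs _).add (cs _)).pow 2)
  have j2 : Integrable fun z => Real.exp (φ.1 z) ^ 2 * JJ χ z * QQ u z := itest _ (ce.mul JJc) fun z hz => by
    simp [JJ, o2 _ z hz, o4 z hz, XX, TT]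
  have fin : ∫ z, H z * QQ u z ≤ 6 * M ^ 2 * (∫ z, Real.exp (φ.1 z) ^ 2 * χ.1 z ^ 2 * QQ u z) +
      2 * A * ∫ z, Real.exp (φ.1 z) ^ 2 * JJ χ z * QQ u z := by
    rw [← integral_const_mul, ← integral_const_mul, ← integral_add (j1.const_mul _) (j2.const_mul _)]
    refine integral_mono (itest H Hc Ho) ((j1.const_mul _).add (j2.const_mul _)) fun z => ?_
    simp only [hH, JJ]
    have s0 : 0 ≤ ∑ i, (XX i χ).1 z ^ 2 := Finset.sum_nonneg fun i _ => sq_nonneg _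
    have s1 := sq_nonneg ((LL χ).1 z + (TT χ).1 z)
    have hA8 : 8 ≤ A := by nlinarith [sq_nonneg M]
    have : 6 * M ^ 2 * χ.1 z ^ 2 + (12 + A / 2) * ∑ i, (XX i χ).1 z ^ 2 + 3 * ((LL χ).1 z + (TT χ).1 z) ^ 2 ≤
      6 * M ^ 2 * χ.1 z ^ 2 + 2 * A * (∑ i, (XX i χ).1 z ^ 2 + ((LL χ).1 z + (TT χ).1 z) ^ 2) := by nlinarith
    have := mul_le_mul_of_nonneg_left this (mul_nonneg (sq_nonneg (Real.exp (φ.1 z))) (QQ_nonneg u z))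
    linarith
  have I0 : 0 ≤ ∫ z, Real.exp (φ.1 z) ^ 2 * χ.1 z ^ 2 * QQ u z :=
    integral_nonneg fun z => mul_nonneg (by positivity) (QQ_nonneg u z)
  set I := ∫ z, Real.exp (φ.1 z) ^ 2 * χ.1 z ^ 2 * QQ u z
  set J := ∫ z, Real.exp (φ.1 z) ^ 2 * JJ χ z * QQ u z
  have hA8 : 8 ≤ A := by nlinarith [sq_nonneg M]
  have : A / 8 * I ≤ 2 * A * J := by
    have : 6 * M ^ 2 * I ≤ A / 8 * I := mul_le_mul_of_nonneg_right (by linarith) I0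
    linarith
  have : A * I ≤ A * (16 * J) := by linarith
  exact le_of_mul_le_mul_left this (by linarith)
end carlu

section tools
variable {n : ℕ}

theorem SS_ext {f : ZZ n → ℝ} {O K : Set (ZZ n)} (hO : IsOpen O) (hf : ContDiffOn ℝ ∞ f O)
    (hK : IsCompact K) (hKO : K ⊆ O) : ∃ g : SS n, ∀ z ∈ K, g.1 =ᶠ[𝓝 z] f := by
  obtain ⟨P, p1, p2, p3, p4, -⟩ := bump_cpt hK hO hKO
  refine ⟨⟨fun z => P z * f z, glue hO p1 p3 hf⟩, fun z hz => ?_⟩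
  filter_upwards [p4.filter_mono (nhds_le_nhdsSet hz)] with y hy
  simp [hy]

theorem DD_line {g : SS n} {f : ZZ n → ℝ} {z w : ZZ n} {d : ℝ} (he : g.1 =ᶠ[𝓝 z] f)
    (hd : HasDerivAt (fun s : ℝ => f (z + s • w)) d 0) : (DD w g).1 z = d := by
  have e1 : HasDerivAt (fun s : ℝ => z + s • w) w 0 := by
    simpa using ((hasDerivAt_id (0 : ℝ)).smul_const w).const_add z
  have e2 := ((scd g).differentiable (by simp) (z + (0 : ℝ) • w)).hasFDerivAt.comp_hasDerivAt (0 : ℝ) e1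
  have e3 : (g.1 ∘ fun s : ℝ => z + s • w) =ᶠ[𝓝 0] fun s : ℝ => f (z + s • w) := by
    have : Tendsto (fun s : ℝ => z + s • w) (𝓝 0) (𝓝 z) := by
      simpa using e1.continuousAt.tendsto
    exact this.eventually he
  have := (e2.congr_of_eventuallyEq e3.symm).unique hd
  show fderiv ℝ g.1 z w = d
  simpa using this

theorem DD_ev {g : SS n} {f f' : ZZ n → ℝ} {z w : ZZ n} {O : Set (ZZ n)} (hO : IsOpen O) (hz : z ∈ O)
    (he : g.1 =ᶠ[𝓝 z] f) (hd : ∀ y ∈ O, HasDerivAt (fun s : ℝ => f (y + s • w)) (f' y) 0) :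
    (DD w g).1 =ᶠ[𝓝 z] f' := by
  filter_upwards [he.eventually_nhds, hO.mem_nhds hz] with y h1 h2
  exact DD_line h1 (hd y h2)

theorem DD_glob {g : SS n} {f' : ZZ n → ℝ} {w : ZZ n}
    (hd : ∀ y, HasDerivAt (fun s : ℝ => g.1 (y + s • w)) (f' y) 0) :
    (DD w g).1 = f' := by
  ext z
  exact DD_line (EventuallyEq.refl _ _) (hd z)

theorem ln_q (x₀ : EE n) (z : ZZ n) (i : Fin n) :
    HasDerivAt (fun s : ℝ => ‖(z + s • ((bb i, 0) : ZZ n)).1 - x₀‖ ^ 2) (2 * (z.1 i - x₀ i)) 0 := by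
  have e : ∀ s : ℝ, ‖(z + s • ((bb i, 0) : ZZ n)).1 - x₀‖ ^ 2 =
      ‖z.1 - x₀‖ ^ 2 + 2 * s * (z.1 i - x₀ i) + s ^ 2 := fun s => by
    have : (z + s • ((bb i, 0) : ZZ n)).1 - x₀ = (z.1 - x₀) + s • bb i := by
      simp only [Prod.fst_add, Prod.smul_fst]; abel
    rw [this, norm_add_sq_real, inner_smul_right, norm_smul]
    simp [bb, EuclideanSpace.inner_single_right]
    ring
  simp only [e]
  have h1 := ((hasDerivAt_id (0 : ℝ)).const_mul 2).mul_const (z.1 i - x₀ i) |>.const_add (‖z.1 - x₀‖ ^ 2)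
  have h2 := h1.add ((hasDerivAt_id (0 : ℝ)).pow 2)
  exact h2.congr_deriv (by simp)

theorem ln_p (z : ZZ n) (i j : Fin n) (s : ℝ) : (z + s • ((bb i, 0) : ZZ n)).1 j = z.1 j + s * (if i = j then 1 else 0) := by
  by_cases h : i = j
  · subst h; simp [bb]
  · simp [bb, h, Ne.symm h]

theorem ln_pd (z : ZZ n) (i j : Fin n) :
    HasDerivAt (fun s : ℝ => (z + s • ((bb i, 0) : ZZ n)).1 j) (if i = j then 1 else 0) 0 := by
  simp only [ln_p]
  simpa using ((hasDerivAt_id (0 : ℝ)).mul_const (if i = j then (1:ℝ) else 0)).const_add (z.1 j)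

@[simp] theorem ln_t (z : ZZ n) (i : Fin n) (s : ℝ) : (z + s • ((bb i, 0) : ZZ n)).2 = z.2 := by simp
@[simp] theorem ln_t1 (z : ZZ n) (s : ℝ) : (z + s • ((0, 1) : ZZ n)).1 = z.1 := by simp
@[simp] theorem ln_t2 (z : ZZ n) (s : ℝ) : (z + s • ((0, 1) : ZZ n)).2 = z.2 + s := by simp

theorem ln_td (z : ZZ n) : HasDerivAt (fun s : ℝ => (z + s • ((0, 1) : ZZ n)).2) 1 0 := by
  simp only [ln_t2]; simpa using (hasDerivAt_id (0 : ℝ)).const_add z.2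

theorem pot_val (φ F : SS n) (z : ZZ n) : (pot φ F).1 z =
    4 * (∑ j, ∑ i, (XX j (XX i φ)).1 z * (XX i φ).1 z * (XX j φ).1 z)
      - 4 * (∑ i, (XX i φ).1 z * (XX i (TT φ)).1 z) + (TT (TT φ)).1 z
    - (LL (LL φ)).1 z - 2 * F.1 z * (∑ i, (XX i φ).1 z ^ 2 - (TT φ).1 z) - (LL F).1 z - F.1 z ^ 2 := by
  simp only [← ev_def]
  simp only [pot, VV, map_sub, map_add, map_mul, map_sum, map_pow, map_ofNat]

theorem carluL {Ω : Set (EE n)} {T M : ℝ} {u : ZZ n → ℝ} (h : Sol Ω T M u)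
    (χ : SS n) (hc : HasCompactSupport χ.1) (hχ : tsupport χ.1 ⊆ Ω ×ˢ Iio T)
    {φ F : ZZ n → ℝ} {O : Set (ZZ n)} (hO : IsOpen O) (hχO : tsupport χ.1 ⊆ O)
    (hφ : ContDiffOn ℝ ∞ φ O) (hF : ContDiffOn ℝ ∞ F O)
    {A : ℝ} (hA : 48 * M ^ 2 + 8 ≤ A)
    (hyp : ∀ z ∈ tsupport χ.1, ∀ φ' F' : SS n, φ'.1 =ᶠ[𝓝 z] φ → F'.1 =ᶠ[𝓝 z] F →
      (∀ ξ : Fin n → ℝ, A * ∑ i, ξ i ^ 2 ≤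
      4 * (∑ j, ∑ i, (XX j (XX i φ')).1 z * ξ i * ξ j) + 2 * F'.1 z * ∑ i, ξ i ^ 2) ∧
      A * (1 + ∑ i, (XX i φ').1 z ^ 2) ≤ (pot φ' F').1 z) :
    ∫ z, Real.exp (φ z) ^ 2 * χ.1 z ^ 2 * QQ u z ≤
      16 * ∫ z, Real.exp (φ z) ^ 2 * JJ χ z * QQ u z := by
  obtain ⟨φ', h1⟩ := SS_ext hO hφ hc hχO
  obtain ⟨F', h2⟩ := SS_ext hO hF hc hχO
  have := carlu h χ φ' F' hc hχ hA one_pos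
    (fun z hz _ => (hyp z hz φ' F' (h1 z hz) (h2 z hz)).1)
    (fun z hz _ => (hyp z hz φ' F' (h1 z hz) (h2 z hz)).2)
  have o1 : ∀ z ∉ tsupport χ.1, χ.1 z = 0 := fun z hz => image_eq_zero_of_notMem_tsupport hz
  have o2 : ∀ v, ∀ z ∉ tsupport χ.1, (DD v χ).1 z = 0 :=
    fun v z hz => image_eq_zero_of_notMem_tsupport fun h' => hz (DD_ts χ _ h')
  have o4 : ∀ z ∉ tsupport χ.1, (LL χ).1 z = 0 := fun z hz => by
    rw [LL_val]; exact Finset.sum_eq_zero fun i _ =>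
      image_eq_zero_of_notMem_tsupport fun h' => hz (DD_ts χ _ (DD_ts _ _ h'))
  have e1 : ∀ z, Real.exp (φ'.1 z) ^ 2 * χ.1 z ^ 2 * QQ u z = Real.exp (φ z) ^ 2 * χ.1 z ^ 2 * QQ u z := fun z => by
    by_cases hz : z ∈ tsupport χ.1
    · rw [(h1 z hz).self_of_nhds]
    · simp [o1 z hz]
  have e2 : ∀ z, Real.exp (φ'.1 z) ^ 2 * JJ χ z * QQ u z = Real.exp (φ z) ^ 2 * JJ χ z * QQ u z := fun z => by
    by_cases hz : z ∈ tsupport χ.1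
    · rw [(h1 z hz).self_of_nhds]
    · simp [JJ, o2 _ z hz, o4 z hz, XX, TT]
  simpa only [e1, e2] using this

theorem Sol.QQ_zero {Ω : Set (EE n)} {T M : ℝ} {u : ZZ n → ℝ} (h : Sol Ω T M u) {z : ZZ n} (hz : z.2 ≤ 0) :
    QQ u z = 0 := by
  have e : ∀ y : EE n, u (y, z.2) = 0 := fun y => h.zero y _ hz
  simp [QQ, gx, e]
end tools

/-- properties of a one-dimensional cutoff -/
structure Stp (θ : ℝ → ℝ) (C : ℝ) : Prop where
  cd : ContDiff ℝ ∞ θ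
  one : ∀ r ≤ 3 / 4, θ r = 1
  zero : ∀ r, 1 ≤ r → θ r = 0
  mem : ∀ r, θ r ∈ Icc (0 : ℝ) 1
  d1 : ∀ r, |deriv θ r| ≤ C
  d2 : ∀ r, |deriv (deriv θ) r| ≤ C

theorem stp_exists : ∃ θ C, Stp θ C := by
  let θ : ℝ → ℝ := fun r => Real.smoothTransition (4 * (1 - r))
  have cd : ContDiff ℝ ∞ θ := Real.smoothTransition.contDiff.comp (by fun_prop)
  have h1 : ∀ r ≤ 3 / 4, θ r = 1 := fun r hr => Real.smoothTransition.one_of_one_le (by linarith)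
  have h0 : ∀ r, 1 ≤ r → θ r = 0 := fun r hr => Real.smoothTransition.zero_of_nonpos (by linarith)
  have k1 : ∀ r < 3 / 4, deriv θ r = 0 := fun r hr => by
    have : θ =ᶠ[𝓝 r] fun _ => 1 := by filter_upwards [Iio_mem_nhds hr] with s hs using h1 s (le_of_lt hs)
    rw [this.deriv_eq]; simp
  have k2 : ∀ r, 1 < r → deriv θ r = 0 := fun r hr => by
    have : θ =ᶠ[𝓝 r] fun _ => 0 := by filter_upwards [Ioi_mem_nhds hr] with s hs using h0 s (le_of_lt hs)
    rw [this.deriv_eq]; simp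
  have cd1 : ContDiff ℝ ∞ (deriv θ) := ((contDiff_infty_iff_deriv).1 cd).2
  have cd2 : ContDiff ℝ ∞ (deriv (deriv θ)) := ((contDiff_infty_iff_deriv).1 cd1).2
  have s1 : HasCompactSupport (deriv θ) := HasCompactSupport.intro (isCompact_Icc (a := (3/4 : ℝ)) (b := 1))
    fun r hr => by
      by_contra h
      exact hr ⟨not_lt.1 fun h' => h (k1 r h'), not_lt.1 fun h' => h (k2 r h')⟩
  obtain ⟨C1, c1⟩ := s1.exists_bound_of_continuous cd1.continuous
  obtain ⟨C2, c2⟩ := (s1.deriv).exists_bound_of_continuous cd2.continuous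
  exact ⟨θ, max C1 C2, cd, h1, h0, fun r => ⟨Real.smoothTransition.nonneg _, Real.smoothTransition.le_one _⟩,
    fun r => (c1 r).trans (le_max_left _ _), fun r => (c2 r).trans (le_max_right _ _)⟩

section stp
variable {θ : ℝ → ℝ} {C : ℝ} 
theorem Stp.cd1 (S : Stp θ C) : ContDiff ℝ ∞ (deriv θ) := ((contDiff_infty_iff_deriv).1 S.cd).2
theorem Stp.hd (S : Stp θ C) (r : ℝ) : HasDerivAt θ (deriv θ r) r := (S.cd.differentiable (by simp) r).hasDerivAt
theorem Stp.hd1 (S : Stp θ C) (r : ℝ) : HasDerivAt (deriv θ) (deriv (deriv θ) r) r :=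
  (S.cd1.differentiable (by simp) r).hasDerivAt
theorem Stp.C0 (S : Stp θ C) : 0 ≤ C := (abs_nonneg _).trans (S.d1 0)
theorem Stp.lo (S : Stp θ C) {r : ℝ} (hr : r < 3 / 4) : deriv θ r = 0 ∧ deriv (deriv θ) r = 0 := by
  have h1 : ∀ r < 3 / 4, deriv θ r = 0 := fun r hr => by
    have : θ =ᶠ[𝓝 r] fun _ => 1 := by filter_upwards [Iio_mem_nhds hr] with s hs using S.one s (le_of_lt hs)
    rw [this.deriv_eq]; simp
  have : deriv θ =ᶠ[𝓝 r] fun _ => 0 := by filter_upwards [Iio_mem_nhds hr] with s hs using h1 s hs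
  exact ⟨h1 r hr, by rw [this.deriv_eq]; simp⟩
theorem Stp.hi (S : Stp θ C) {r : ℝ} (hr : 1 < r) : deriv θ r = 0 ∧ deriv (deriv θ) r = 0 := by
  have h1 : ∀ r, 1 < r → deriv θ r = 0 := fun r hr => by
    have : θ =ᶠ[𝓝 r] fun _ => 0 := by filter_upwards [Ioi_mem_nhds hr] with s hs using S.zero s (le_of_lt hs)
    rw [this.deriv_eq]; simp
  have : deriv θ =ᶠ[𝓝 r] fun _ => 0 := by filter_upwards [Ioi_mem_nhds hr] with s hs using h1 s hs
  exact ⟨h1 r hr, by rw [this.deriv_eq]; simp⟩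
end stp

/-- radial cutoff times a function of time, derivatives -/
theorem radcut {n : ℕ} {θ ζ : ℝ → ℝ} {C : ℝ} (S : Stp θ C) (hζ : ContDiff ℝ ∞ ζ) (x₀ : EE n) {ρ : ℝ} (hρ : 1 ≤ ρ) :
    ∃ χ : SS n, (∀ z, χ.1 z = θ (‖z.1 - x₀‖ ^ 2 / ρ ^ 2) * ζ z.2) ∧
    (∀ z, ∑ i, (XX i χ).1 z ^ 2 ≤ 4 * C ^ 2 * ζ z.2 ^ 2) ∧
    (∀ z, |(LL χ).1 z| ≤ (4 * C + 2 * n * C) * |ζ z.2|) ∧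
    (∀ z, (TT χ).1 z = θ (‖z.1 - x₀‖ ^ 2 / ρ ^ 2) * deriv ζ z.2) ∧
    (∀ z, ‖z.1 - x₀‖ ^ 2 / ρ ^ 2 < 3 / 4 → (∀ i, (XX i χ).1 z = 0) ∧ (LL χ).1 z = 0) := by
  have hρ0 : ρ ≠ 0 := by linarith
  let χ : SS n := ⟨fun z => θ (‖z.1 - x₀‖ ^ 2 / ρ ^ 2) * ζ z.2, by
    refine ContDiff.mul (S.cd.comp (((contDiff_fst.sub contDiff_const).norm_sq ℝ).div_const _))
      (hζ.comp contDiff_snd)⟩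
  have hζd : ∀ t, HasDerivAt ζ (deriv ζ t) t := fun t => (hζ.differentiable (by simp) t).hasDerivAt
  have lq : ∀ (z : ZZ n) i, HasDerivAt (fun s : ℝ => ‖(z + s • ((bb i, 0) : ZZ n)).1 - x₀‖ ^ 2 / ρ ^ 2)
    (2 * (z.1 i - x₀ i) / ρ ^ 2) 0 := fun z i => (ln_q x₀ z i).div_const _
  have e0 : ∀ (z : ZZ n) w, z + (0 : ℝ) • w = z := fun z w => by simp
  have X1 : ∀ i, (XX i χ).1 = fun z => deriv θ (‖z.1 - x₀‖ ^ 2 / ρ ^ 2) * (2 * (z.1 i - x₀ i) / ρ ^ 2) * ζ z.2 := by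
    intro i
    refine DD_glob fun z => ?_
    have h1 := (S.hd (‖(z + (0:ℝ) • ((bb i, 0) : ZZ n)).1 - x₀‖ ^ 2 / ρ ^ 2)).comp (0 : ℝ) (lq z i)
    rw [e0] at h1
    show HasDerivAt (fun s : ℝ => θ (‖(z + s • ((bb i, 0) : ZZ n)).1 - x₀‖ ^ 2 / ρ ^ 2) *
      ζ (z + s • ((bb i, 0) : ZZ n)).2) _ 0
    simp only [ln_t]
    exact h1.mul_const _
  have X2 : ∀ i, (XX i (XX i χ)).1 = fun z => (deriv (deriv θ) (‖z.1 - x₀‖ ^ 2 / ρ ^ 2) *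
      (4 * (z.1 i - x₀ i) ^ 2 / ρ ^ 4) + deriv θ (‖z.1 - x₀‖ ^ 2 / ρ ^ 2) * (2 / ρ ^ 2)) * ζ z.2 := by
    intro i
    refine DD_glob fun z => ?_
    have h1 := (S.hd1 (‖(z + (0:ℝ) • ((bb i, 0) : ZZ n)).1 - x₀‖ ^ 2 / ρ ^ 2)).comp (0 : ℝ) (lq z i)
    rw [e0] at h1
    have h2 := (((ln_pd z i i).sub_const (x₀ i)).const_mul 2).div_const (ρ ^ 2)
    rw [X1]
    simp only [ln_t]
    refine ((h1.mul h2).mul_const (ζ z.2)).congr_deriv ?_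
    simp only [Function.comp, e0, if_true]
    field_simp
    ring
  have nsq : ∀ z : ZZ n, ∑ i, (z.1 i - x₀ i) ^ 2 = ‖z.1 - x₀‖ ^ 2 := fun z => by
    rw [EuclideanSpace.norm_sq_eq]; simp
  have XS : ∀ z, ∑ i, (XX i χ).1 z ^ 2 = deriv θ (‖z.1 - x₀‖ ^ 2 / ρ ^ 2) ^ 2 *
      (4 * (‖z.1 - x₀‖ ^ 2 / ρ ^ 2) / ρ ^ 2) * ζ z.2 ^ 2 := fun z => by
    simp only [X1, ← nsq, Finset.mul_sum, Finset.sum_mul, Finset.sum_div]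
    exact Finset.sum_congr rfl fun i _ => by field_simp; ring
  have LS : ∀ z, (LL χ).1 z = (deriv (deriv θ) (‖z.1 - x₀‖ ^ 2 / ρ ^ 2) *
      (4 * (‖z.1 - x₀‖ ^ 2 / ρ ^ 2) / ρ ^ 2) + deriv θ (‖z.1 - x₀‖ ^ 2 / ρ ^ 2) * (2 * n / ρ ^ 2)) * ζ z.2 := fun z => by
    rw [LL_val]
    simp only [X2, ← Finset.sum_mul, Finset.sum_add_distrib, ← Finset.mul_sum, ← Finset.sum_div, nsq]
    simp only [Finset.sum_const, Finset.card_univ, Fintype.card_fin, nsmul_eq_mul]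
    field_simp
  have C0 := S.C0
  have hρ2 : 1 ≤ ρ ^ 2 := by nlinarith
  have bd : ∀ r D : ℝ, 0 ≤ r → |D| ≤ C → (1 < r → D = 0) → |D| * (4 * r / ρ ^ 2) ≤ 4 * C := by
    intro r D hr hD h1
    rcases le_or_gt r 1 with h | h
    · have : 4 * r / ρ ^ 2 ≤ 4 := by rw [div_le_iff₀ (by positivity)]; nlinarith
      calc |D| * (4 * r / ρ ^ 2) ≤ C * 4 := mul_le_mul hD this (by positivity) C0
        _ = _ := by ring
    · simp [h1 h]; exact C0
  refine ⟨χ, fun z => rfl, fun z => ?_, fun z => ?_, fun z => ?_, fun z hz => ?_⟩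
  · rw [XS]
    refine mul_le_mul_of_nonneg_right ?_ (sq_nonneg _)
    have := bd (‖z.1 - x₀‖ ^ 2 / ρ ^ 2) _ (by positivity) (S.d1 _) (fun h => (S.hi h).1)
    rw [← sq_abs]
    have h2 := S.d1 (‖z.1 - x₀‖ ^ 2 / ρ ^ 2)
    nlinarith [abs_nonneg (deriv θ (‖z.1 - x₀‖ ^ 2 / ρ ^ 2))]
  · rw [LS, abs_mul]
    refine mul_le_mul_of_nonneg_right ((abs_add_le _ _).trans (add_le_add ?_ ?_)) (abs_nonneg _)
    · rw [abs_mul, abs_of_nonneg (a := 4 * (‖z.1 - x₀‖ ^ 2 / ρ ^ 2) / ρ ^ 2) (by positivity)]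
      exact bd _ _ (by positivity) (S.d2 _) (fun h => (S.hi h).2)
    · rw [abs_mul, abs_of_nonneg (a := 2 * n / ρ ^ 2) (by positivity), mul_comm]
      refine mul_le_mul ?_ (S.d1 _) (abs_nonneg _) (by positivity)
      exact div_le_self (by positivity) hρ2
  · refine DD_line (EventuallyEq.refl _ _) ?_
    show HasDerivAt (fun s : ℝ => θ (‖(z + s • ((0, 1) : ZZ n)).1 - x₀‖ ^ 2 / ρ ^ 2) *
      ζ (z + s • ((0, 1) : ZZ n)).2) _ 0
    simp only [ln_t1]
    have h1 := (hζd ((z + (0:ℝ) • ((0, 1) : ZZ n)).2)).comp (0 : ℝ) (ln_td z)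
    rw [e0] at h1
    refine (h1.const_mul _).congr_deriv (by ring)
  · obtain ⟨h1, h2⟩ := S.lo hz
    exact ⟨fun i => by rw [X1]; simp [h1], by rw [LS, h1, h2]; simp⟩

section decay
variable {n : ℕ}

theorem JJ_off (χ : SS n) {z : ZZ n} (hz : z ∉ tsupport χ.1) : JJ χ z = 0 := by
  have o2 : ∀ v, (DD v χ).1 z = 0 :=
    fun v => image_eq_zero_of_notMem_tsupport fun h' => hz (DD_ts χ _ h')
  have o4 : (LL χ).1 z = 0 := by
    rw [LL_val]; exact Finset.sum_eq_zero fun i _ =>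
      image_eq_zero_of_notMem_tsupport fun h' => hz (DD_ts χ _ (DD_ts _ _ h'))
  simp [JJ, o2 _, o4, XX, TT]

theorem JJ_nonneg (χ : SS n) (z : ZZ n) : 0 ≤ JJ χ z :=
  add_nonneg (Finset.sum_nonneg fun _ _ => sq_nonneg _) (sq_nonneg _)

theorem carlK {Ω : Set (EE n)} {T M : ℝ} {u : ZZ n → ℝ} (h : Sol Ω T M u)
    (χ : SS n) (hc : HasCompactSupport χ.1) (hχ : tsupport χ.1 ⊆ Ω ×ˢ Iio T)
    {φ F : ZZ n → ℝ} {O : Set (ZZ n)} (hO : IsOpen O) (hχO : tsupport χ.1 ⊆ O)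
    (hφ : ContDiffOn ℝ ∞ φ O) (hF : ContDiffOn ℝ ∞ F O)
    {A : ℝ} (hA : 48 * M ^ 2 + 8 ≤ A)
    (hyp : ∀ z ∈ tsupport χ.1, ∀ φ' F' : SS n, φ'.1 =ᶠ[𝓝 z] φ → F'.1 =ᶠ[𝓝 z] F →
      (∀ ξ : Fin n → ℝ, A * ∑ i, ξ i ^ 2 ≤
      4 * (∑ j, ∑ i, (XX j (XX i φ')).1 z * ξ i * ξ j) + 2 * F'.1 z * ∑ i, ξ i ^ 2) ∧
      A * (1 + ∑ i, (XX i φ').1 z ^ 2) ≤ (pot φ' F').1 z)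
    {K0 : Set (ZZ n)} (hm : MeasurableSet K0) {b : ℝ} (hK0 : ∀ z ∈ K0, χ.1 z = 1 ∧ b ≤ φ z)
    {W : ZZ n → ℝ} (hW : Integrable W) (hW0 : ∀ z, 0 ≤ W z)
    (hJ : ∀ z ∈ tsupport χ.1, 0 < z.2 → Real.exp (φ z) ^ 2 * JJ χ z * QQ u z ≤ W z) :
    Real.exp b ^ 2 * ∫ z in K0, QQ u z ≤ 16 * ∫ z, W z := by
  have c1 := carluL h χ hc hχ hO hχO hφ hF hA hyp
  have hK0s : K0 ⊆ tsupport χ.1 := fun z hz => subset_tsupport _ (by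
    rw [Function.mem_support, (hK0 z hz).1]; exact one_ne_zero)
  have q1 := (QQ_int h hc hχ).1
  have cc : Continuous fun z => Real.exp (φ z) ^ 2 * χ.1 z ^ 2 := by
    have h1 : Continuous fun z => χ.1 z * Real.exp (φ z) :=
      glueC hO (scd χ).continuous hχO (Real.continuous_exp.comp_continuousOn hφ.continuousOn)
    refine (h1.pow 2).congr fun z => by simp only [Pi.pow_apply]; ring
  have i1 : Integrable fun z => Real.exp (φ z) ^ 2 * χ.1 z ^ 2 * QQ u z :=
    int_test hc q1 cc fun z hz => by rw [image_eq_zero_of_notMem_tsupport hz]; simp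
  have c2 : ∫ z, Real.exp (φ z) ^ 2 * JJ χ z * QQ u z ≤ ∫ z, W z := by
    refine integral_mono_of_nonneg (Eventually.of_forall fun z => ?_) hW (Eventually.of_forall fun z => ?_)
    · exact mul_nonneg (mul_nonneg (sq_nonneg _) (JJ_nonneg _ _)) (QQ_nonneg _ _)
    · by_cases hz : z ∈ tsupport χ.1
      · rcases le_or_gt z.2 0 with ht | ht
        · simpa [h.QQ_zero ht] using hW0 z
        · exact hJ z hz ht
      · simpa [JJ_off χ hz] using hW0 z
  have c3 : Real.exp b ^ 2 * ∫ z in K0, QQ u z ≤ ∫ z in K0, Real.exp (φ z) ^ 2 * χ.1 z ^ 2 * QQ u z := by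
    rw [← integral_const_mul]
    refine setIntegral_mono_on ((q1.mono_set hK0s).const_mul _) i1.integrableOn hm fun z hz => ?_
    rw [(hK0 z hz).1, one_pow, mul_one]
    have := Real.exp_le_exp.2 (hK0 z hz).2
    have := QQ_nonneg u z
    gcongr
  have c4 := setIntegral_le_integral (s := K0) i1 (Eventually.of_forall fun z => mul_nonneg
    (mul_nonneg (sq_nonneg _) (sq_nonneg _)) (QQ_nonneg _ _))
  linarith

/-- weight for the Gaussian decay -/
theorem gauss_wt {x₀ : EE n} {τ A A₀ : ℝ} (hA : 8 ≤ A) (hτ : 0 < τ)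
    (hτA : τ ≤ 1 / (8 * A)) (hA₀ : 7 ≤ A₀) {z : ZZ n} (hz1 : -(τ / 2) ≤ z.2) (hz2 : z.2 ≤ 5 * τ)
    {φ F : SS n} (h1 : φ.1 =ᶠ[𝓝 z] fun z => (A₀ - ‖z.1 - x₀‖ ^ 2 / 16) / (z.2 + τ))
    (h2 : F.1 =ᶠ[𝓝 z] fun z => 7 / 8 / (z.2 + τ)) :
    (∀ ξ : Fin n → ℝ, A * ∑ i, ξ i ^ 2 ≤
      4 * (∑ j, ∑ i, (XX j (XX i φ)).1 z * ξ i * ξ j) + 2 * F.1 z * ∑ i, ξ i ^ 2) ∧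
      A * (1 + ∑ i, (XX i φ).1 z ^ 2) ≤ (pot φ F).1 z := by
  set O : Set (ZZ n) := {z | 0 < z.2 + τ} with hOd
  have hO : IsOpen O := isOpen_lt continuous_const (by fun_prop)
  have hz : z ∈ O := by show 0 < z.2 + τ; linarith
  have e0 : ∀ (z : ZZ n) w, z + (0 : ℝ) • w = z := fun z w => by simp
  have nz : ∀ y ∈ O, y.2 + τ ≠ 0 := fun y hy => ne_of_gt hy
  have X1 : ∀ i, (XX i φ).1 =ᶠ[𝓝 z] fun z => -((z.1 i - x₀ i) / 8) / (z.2 + τ) := fun i => by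
    refine DD_ev hO hz h1 fun y hy => ?_
    simp only [ln_t]
    refine ((((ln_q x₀ y i).div_const 16).const_sub A₀).div_const (y.2 + τ)).congr_deriv (by ring)
  have X2 : ∀ j i, (XX j (XX i φ)).1 =ᶠ[𝓝 z] fun z => -((if j = i then 1 else 0) / 8) / (z.2 + τ) := fun j i => by
    refine DD_ev hO hz (X1 i) fun y hy => ?_
    simp only [ln_t]
    exact ((((ln_pd y j i).sub_const (x₀ i)).div_const 8).neg.div_const (y.2 + τ))
  have ti : ∀ y ∈ O, HasDerivAt (fun s : ℝ => ((y + s • ((0, 1) : ZZ n)).2 + τ)) 1 0 := fun y hy =>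
    (ln_td y).add_const τ
  have T1 : (TT φ).1 =ᶠ[𝓝 z] fun z => -(A₀ - ‖z.1 - x₀‖ ^ 2 / 16) / (z.2 + τ) ^ 2 := by
    refine DD_ev hO hz h1 fun y hy => ?_
    simp only [ln_t1]
    refine ((hasDerivAt_const (0:ℝ) _).div (ti y hy) (by rw [e0]; exact nz y hy)).congr_deriv ?_
    rw [e0]; ring
  have T2 : (TT (TT φ)).1 z = 2 * (A₀ - ‖z.1 - x₀‖ ^ 2 / 16) / (z.2 + τ) ^ 3 := by
    refine DD_line T1 ?_
    simp only [ln_t1]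
    refine ((hasDerivAt_const (0:ℝ) _).div ((ti z hz).pow 2)
      (by simp only [Pi.pow_apply, e0]; exact pow_ne_zero _ (nz z hz))).congr_deriv ?_
    have := nz z hz
    simp; field_simp; ring
  have XT : ∀ i, (XX i (TT φ)).1 z = ((z.1 i - x₀ i) / 8) / (z.2 + τ) ^ 2 := fun i => by
    refine DD_line T1 ?_
    simp only [ln_t]
    refine ((((ln_q x₀ z i).div_const 16).const_sub A₀).neg.div_const _).congr_deriv (by ring)
  have L1 : (LL φ).1 =ᶠ[𝓝 z] fun z => -(n / 8) / (z.2 + τ) := by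
    have := (eventually_all (ι := Fin n)).2 fun i => X2 i i
    filter_upwards [this] with y hy
    rw [LL_val]
    simp only [hy]
    simp; ring
  have L2 : (LL (LL φ)).1 z = 0 := by
    rw [LL_val]
    refine Finset.sum_eq_zero fun i _ => ?_
    have h3 : (XX i (LL φ)).1 =ᶠ[𝓝 z] fun _ => 0 := by
      refine DD_ev hO hz L1 fun y hy => ?_
      simp only [ln_t]; exact hasDerivAt_const _ _
    exact DD_line h3 (hasDerivAt_const _ _)
  have LF : (LL F).1 z = 0 := by
    rw [LL_val]
    refine Finset.sum_eq_zero fun i _ => ?_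
    have h3 : (XX i F).1 =ᶠ[𝓝 z] fun _ => 0 := by
      refine DD_ev hO hz h2 fun y hy => ?_
      simp only [ln_t]; exact hasDerivAt_const _ _
    exact DD_line h3 (hasDerivAt_const _ _)
  have nsq : ∑ i, (z.1 i - x₀ i) ^ 2 = ‖z.1 - x₀‖ ^ 2 := by
    rw [EuclideanSpace.norm_sq_eq]; simp
  set Y := ‖z.1 - x₀‖ ^ 2 with hY
  have hY0 : 0 ≤ Y := by positivity
  set σ := z.2 + τ with hσ
  have hσ0 : 0 < σ := hz
  have s0 := (X1 · |>.self_of_nhds)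
  have s1 := fun j i => (X2 j i).self_of_nhds
  have Q : ∀ ξ : Fin n → ℝ, ∑ j, ∑ i, (XX j (XX i φ)).1 z * ξ i * ξ j = -(1 / 8 / σ) * ∑ i, ξ i ^ 2 := fun ξ => by
    simp only [s1, Finset.mul_sum]
    refine Finset.sum_congr rfl fun j _ => ?_
    rw [Finset.sum_eq_single j]
    · simp only [if_true, ← hσ]; ring
    · intro i _ hi; simp [Ne.symm hi]
    · simp
  have N2 : ∑ i, (XX i φ).1 z ^ 2 = Y / 64 / σ ^ 2 := by
    simp only [s0, ← nsq, Finset.sum_div, ← hσ]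
    exact Finset.sum_congr rfl fun i _ => by field_simp; ring
  have NX : ∑ i, (XX i φ).1 z * (XX i (TT φ)).1 z = - (Y / 64 / σ ^ 3) := by
    simp only [s0, XT, ← nsq, Finset.sum_div, ← hσ, ← Finset.sum_neg_distrib]
    exact Finset.sum_congr rfl fun i _ => by field_simp; ring
  have hσA : σ * A ≤ 3 / 4 := by
    have : τ * A ≤ 1 / 8 := by
      rw [le_div_iff₀ (by positivity)] at hτA ⊢; linarith
    have : σ ≤ 6 * τ := by linarith
    nlinarith
  have f0 := h2.self_of_nhds
  have hσ1 : σ ≤ 3 / 32 := by nlinarith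
  constructor
  · intro ξ
    rw [Q, f0]
    have hs : 0 ≤ ∑ i, ξ i ^ 2 := Finset.sum_nonneg fun _ _ => sq_nonneg _
    have : 4 * (-(1 / 8 / σ) * ∑ i, ξ i ^ 2) + 2 * (7 / 8 / (z.2 + τ)) * ∑ i, ξ i ^ 2 =
      (5 / 4) / σ * ∑ i, ξ i ^ 2 := by rw [← hσ]; ring
    rw [this]
    refine mul_le_mul_of_nonneg_right ?_ hs
    rw [le_div_iff₀ hσ0]; linarith
  · rw [pot_val, Q, N2, NX, T2, L2, LF, T1.self_of_nhds, f0]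
    simp only [← hσ, ← hY]
    have e : 4 * (-(1 / 8 / σ) * (Y / 64 / σ ^ 2)) - 4 * -(Y / 64 / σ ^ 3) + 2 * (A₀ - Y / 16) / σ ^ 3 - 0 -
      2 * (7 / 8 / σ) * (Y / 64 / σ ^ 2 - -(A₀ - Y / 16) / σ ^ 2) - 0 - (7 / 8 / σ) ^ 2 =
      ((3 / 256) * Y + A₀ / 4 - 49 / 64 * σ) / σ ^ 3 := by field_simp; ring
    have e2 : A * (1 + Y / 64 / σ ^ 2) = (A * σ) * (σ ^ 2 + Y / 64) / σ ^ 3 := by field_simp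
    rw [e, e2]
    refine div_le_div_of_nonneg_right ?_ (by positivity)
    have : (A * σ) * (σ ^ 2 + Y / 64) ≤ 3 / 4 * (σ ^ 2 + Y / 64) :=
      mul_le_mul_of_nonneg_right (by linarith) (by positivity)
    nlinarith

end decay

section decay2
variable {n : ℕ}

theorem gauss_loc {Ω : Set (EE n)} {T M : ℝ} {u : ZZ n → ℝ} (h : Sol Ω T M u) {θ : ℝ → ℝ} {C : ℝ}
    (S : Stp θ C) {τ : ℝ} (hτ : 0 < τ) (hτA : τ ≤ 1 / (8 * (48 * M ^ 2 + 8))) (hT : 5 * τ < T)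
    (x₀ : EE n) {ρ : ℝ} (hρ : 15 ≤ ρ) (hΩ : Metric.closedBall x₀ ρ ⊆ Ω) :
    ∫ z in Metric.closedBall x₀ (ρ / 8) ×ˢ Icc 0 τ, QQ u z ≤
      16 * (4 * C ^ 2 + (4 * C + 2 * n * C + C / (5 * τ)) ^ 2) * Real.exp (-(ρ ^ 2 / (64 * τ))) *
        ∫ z in Metric.closedBall x₀ ρ ×ˢ Icc 0 (5 * τ), QQ u z := by
  set CJ := 4 * C ^ 2 + (4 * C + 2 * n * C + C / (5 * τ)) ^ 2 with hCJ
  have C0 := S.C0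
  have hCJ0 : 0 ≤ CJ := by positivity
  have hρ0 : 0 < ρ := by linarith
  set ζ : ℝ → ℝ := fun t => θ (t / (5 * τ)) * θ (-(2 * t) / τ) with hζ
  have hζc : ContDiff ℝ ∞ ζ := (S.cd.comp (by fun_prop)).mul (S.cd.comp (by fun_prop))
  have hζm : ∀ t, ζ t ∈ Icc (0:ℝ) 1 := fun t => ⟨mul_nonneg (S.mem _).1 (S.mem _).1,
    mul_le_one₀ (S.mem _).2 (S.mem _).1 (S.mem _).2⟩
  have hζd : ∀ t, 0 < t → deriv ζ t = deriv θ (t / (5 * τ)) / (5 * τ) := by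
    intro t ht
    have e : ζ =ᶠ[𝓝 t] fun s => θ (s / (5 * τ)) := by
      filter_upwards [Ioi_mem_nhds ht] with s hs
      have hs' : 0 < s := hs
      have : -(2 * s) / τ ≤ 3 / 4 := by rw [div_le_iff₀ hτ]; nlinarith
      simp [hζ, S.one _ this]
    rw [e.deriv_eq]
    have := (S.hd (t / (5 * τ))).comp t ((hasDerivAt_id t).div_const (5 * τ))
    rw [show (fun s => θ (s / (5 * τ))) = θ ∘ fun x => id x / (5 * τ) from rfl, this.deriv]; ring
  obtain ⟨χ, k1, k2, k3, k4, k5⟩ := radcut S hζc x₀ (ρ := ρ) (by linarith)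
  have hts : tsupport χ.1 ⊆ Metric.closedBall x₀ ρ ×ˢ Icc (-(τ / 2)) (5 * τ) := by
    refine closure_minimal (fun z hz => ?_) (Metric.isClosed_closedBall.prod isClosed_Icc)
    rw [Function.mem_support, k1] at hz
    have a1 : ‖z.1 - x₀‖ ^ 2 / ρ ^ 2 < 1 := by
      by_contra h'; exact hz (by rw [S.zero _ (not_lt.1 h'), zero_mul])
    have a2 : z.2 / (5 * τ) < 1 := by
      by_contra h'; exact hz (by simp [hζ, S.zero _ (not_lt.1 h')])
    have a3 : -(2 * z.2) / τ < 1 := by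
      by_contra h'; exact hz (by simp only [hζ, S.zero _ (not_lt.1 h'), mul_zero])
    rw [div_lt_one (by positivity)] at a1 a2 a3
    refine ⟨?_, by linarith, by linarith⟩
    rw [mem_closedBall_iff_norm]
    exact (pow_le_pow_iff_left₀ (norm_nonneg _) hρ0.le two_ne_zero).1 a1.le
  have hcs : HasCompactSupport χ.1 :=
    ((isCompact_closedBall x₀ ρ).prod isCompact_Icc).of_isClosed_subset (isClosed_tsupport _) hts
  set K : Set (ZZ n) := Metric.closedBall x₀ ρ ×ˢ Icc 0 (5 * τ) with hK
  have hKc : IsCompact K := (isCompact_closedBall x₀ ρ).prod isCompact_Icc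
  have hKi := (QQ_int h hKc (prod_mono hΩ fun t ht => ht.2.trans_lt hT)).1
  set c := Real.exp (ρ ^ 2 / (152 * τ)) ^ 2 * CJ with hcd
  have hO : IsOpen {z : ZZ n | 0 < z.2 + τ} := isOpen_lt continuous_const (by fun_prop)
  have main := carlK h χ hcs (hts.trans (prod_mono hΩ fun t ht => ht.2.trans_lt hT))
    (φ := fun z => (ρ ^ 2 / 32 - ‖z.1 - x₀‖ ^ 2 / 16) / (z.2 + τ)) (F := fun z => 7 / 8 / (z.2 + τ)) hO
    (fun z hz => by have := (hts hz).2.1; show 0 < z.2 + τ; linarith)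
    (ContDiffOn.div (contDiff_const.sub (((contDiff_fst.sub contDiff_const).norm_sq ℝ).div_const _)).contDiffOn
      (by fun_prop) fun z hz => ne_of_gt hz)
    (ContDiffOn.div contDiffOn_const (by fun_prop) fun z hz => ne_of_gt hz) le_rfl
    (fun z hz φ' F' h1 h2 => gauss_wt (by nlinarith [sq_nonneg M]) hτ hτA (by nlinarith) (hts hz).2.1 (hts hz).2.2 h1 h2)
    (K0 := Metric.closedBall x₀ (ρ / 8) ×ˢ Icc 0 τ) (b := 31 * ρ ^ 2 / (2048 * τ))
    (Metric.isClosed_closedBall.measurableSet.prod measurableSet_Icc)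
    (fun z hz => ?_) (W := K.indicator fun z => c * QQ u z)
    ((integrable_indicator_iff hKc.measurableSet).2 (hKi.const_mul c))
    (fun z => indicator_nonneg (fun z _ => mul_nonneg (by positivity) (QQ_nonneg _ _)) z)
    (fun z hz ht => ?_)
  · rw [integral_indicator hKc.measurableSet, integral_const_mul] at main
    set I := ∫ z in K, QQ u z
    have hI : 0 ≤ I := integral_nonneg fun z => QQ_nonneg _ _
    have hb : 0 < Real.exp (31 * ρ ^ 2 / (2048 * τ)) ^ 2 := by positivity
    rw [mul_comm, ← le_div_iff₀ hb] at main
    refine main.trans ?_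
    rw [div_le_iff₀ hb, hcd]
    have : Real.exp (ρ ^ 2 / (152 * τ)) ^ 2 ≤
      Real.exp (-(ρ ^ 2 / (64 * τ))) * Real.exp (31 * ρ ^ 2 / (2048 * τ)) ^ 2 := by
      rw [← Real.exp_nat_mul, ← Real.exp_nat_mul, ← Real.exp_add]
      refine Real.exp_le_exp.2 ?_
      have e1 : ((2:ℕ):ℝ) * (ρ ^ 2 / (152 * τ)) = (1 / 76) * (ρ ^ 2 / τ) := by push_cast; field_simp; norm_num
      have e2 : -(ρ ^ 2 / (64 * τ)) + ((2:ℕ):ℝ) * (31 * ρ ^ 2 / (2048 * τ)) = (15 / 1024) * (ρ ^ 2 / τ) := by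
        push_cast; field_simp; norm_num
      rw [e1, e2]
      exact mul_le_mul_of_nonneg_right (by norm_num) (by positivity)
    calc 16 * (Real.exp (ρ ^ 2 / (152 * τ)) ^ 2 * CJ * I) = (16 * CJ * I) * Real.exp (ρ ^ 2 / (152 * τ)) ^ 2 := by ring
      _ ≤ (16 * CJ * I) * (Real.exp (-(ρ ^ 2 / (64 * τ))) * Real.exp (31 * ρ ^ 2 / (2048 * τ)) ^ 2) :=
        mul_le_mul_of_nonneg_left this (by positivity)
      _ = _ := by ring
  · obtain ⟨a1, a2, a3⟩ := hz
    rw [mem_closedBall_iff_norm] at a1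
    have a4 : ‖z.1 - x₀‖ ^ 2 ≤ ρ ^ 2 / 64 := by nlinarith [norm_nonneg (z.1 - x₀)]
    constructor
    · rw [k1, S.one _ (by rw [div_le_iff₀ (by positivity)]; nlinarith)]
      simp only [hζ]
      rw [S.one _ (by rw [div_le_iff₀ (by positivity)]; nlinarith),
        S.one _ (by rw [div_le_iff₀ (by positivity)]; nlinarith)]; norm_num
    · show _ ≤ (ρ ^ 2 / 32 - ‖z.1 - x₀‖ ^ 2 / 16) / (z.2 + τ)
      rw [div_le_div_iff₀ (by positivity) (by linarith)]
      have : z.2 + τ ≤ 2 * τ := by linarith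
      calc 31 * ρ ^ 2 * (z.2 + τ) ≤ 31 * ρ ^ 2 * (2 * τ) := by gcongr
        _ = (31 * ρ ^ 2 / 1024) * (2048 * τ) := by ring
        _ ≤ _ := by gcongr; linarith
  · have hzt := hts hz
    have hzK : z ∈ K := ⟨hzt.1, ht.le, hzt.2.2⟩
    rw [indicator_of_mem hzK]
    refine mul_le_mul_of_nonneg_right ?_ (QQ_nonneg _ _)
    have JB : JJ χ z ≤ CJ := by
      have b1 : |ζ z.2| ≤ 1 := abs_le.2 ⟨by linarith [(hζm z.2).1], (hζm z.2).2⟩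
      have b2 : ζ z.2 ^ 2 ≤ 1 := by rw [← sq_abs]; exact pow_le_one₀ (abs_nonneg _) b1
      refine add_le_add ((k2 z).trans (by nlinarith [sq_nonneg C])) ?_
      rw [← sq_abs]
      refine pow_le_pow_left₀ (abs_nonneg _) ((abs_add_le _ _).trans (add_le_add ?_ ?_)) 2
      · exact (k3 z).trans (mul_le_of_le_one_right (by positivity) b1)
      · rw [k4, abs_mul, hζd _ ht, abs_div, abs_of_pos (a := 5 * τ) (by positivity)]
        have := S.mem (‖z.1 - x₀‖ ^ 2 / ρ ^ 2)
        rw [abs_of_nonneg this.1]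
        refine (mul_le_of_le_one_left (by positivity) this.2).trans ?_
        gcongr; exact S.d1 _
    have h0 : 0 ≤ JJ χ z := JJ_nonneg _ _
    rcases le_or_gt (3 / 4) (‖z.1 - x₀‖ ^ 2 / ρ ^ 2) with c1 | c1
    · rw [le_div_iff₀ (by positivity)] at c1
      refine mul_le_mul ?_ JB h0 (by positivity)
      refine pow_le_pow_left₀ (Real.exp_pos _).le (Real.exp_le_exp.2 ?_) 2
      have : (ρ ^ 2 / 32 - ‖z.1 - x₀‖ ^ 2 / 16) / (z.2 + τ) ≤ 0 :=
        div_nonpos_of_nonpos_of_nonneg (by nlinarith) (by linarith)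
      exact this.trans (by positivity)
    · rcases lt_or_ge (z.2 / (5 * τ)) (3 / 4) with c2 | c2
      · have : JJ χ z = 0 := by
          obtain ⟨q1, q2⟩ := k5 z c1
          simp [JJ, q1, q2, k4, hζd _ ht, (S.lo c2).1]
        rw [this, mul_zero]; positivity
      · rw [le_div_iff₀ (by positivity)] at c2
        refine mul_le_mul ?_ JB h0 (by positivity)
        refine pow_le_pow_left₀ (Real.exp_pos _).le (Real.exp_le_exp.2 ?_) 2
        rw [div_le_div_iff₀ (by linarith) (by positivity)]
        have : (19 / 4) * τ ≤ z.2 + τ := by linarith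
        calc (ρ ^ 2 / 32 - ‖z.1 - x₀‖ ^ 2 / 16) * (152 * τ) ≤ (ρ ^ 2 / 32) * (152 * τ) := by
              gcongr; linarith [sq_nonneg ‖z.1 - x₀‖]
          _ = ρ ^ 2 * ((19 / 4) * τ) := by ring
          _ ≤ _ := by gcongr

end decay2

section energy
variable {n : ℕ}

theorem vol_cb (x : EE n) {r : ℝ} (hr : 0 ≤ r) :
    volume.real (Metric.closedBall x r) = r ^ n * volume.real (Metric.ball (0 : EE n) 1) := by
  simp only [measureReal_def]
  rw [Measure.addHaar_closedBall _ _ hr, ENNReal.toReal_mul, ENNReal.toReal_ofReal (by positivity)]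
  simp

theorem energy {Ω : Set (EE n)} {T M : ℝ} {u : ZZ n → ℝ} (h : Sol Ω T M u) {θ : ℝ → ℝ} {C : ℝ}
    (S : Stp θ C) {b : ℝ} (hb0 : 0 ≤ b) (hb : b < T) (x₀ : EE n) {ρ G : ℝ} (hρ : 1 ≤ ρ)
    (hΩ : Metric.closedBall x₀ (2 * ρ) ⊆ Ω)
    (hG : ∀ x ∈ Metric.closedBall x₀ (2 * ρ), ∀ t < T, |u (x, t)| ≤ G) :
    ∫ z in Metric.closedBall x₀ ρ ×ˢ Icc 0 b, QQ u z ≤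
      (b + 1 + (2 * M + 2 * M ^ 2 + 8) * ((1 + 4 * C ^ 2) * b)) *
        ((2 * ρ) ^ n * volume.real (Metric.ball (0 : EE n) 1)) * G ^ 2 := by
  rw [← vol_cb x₀ (by linarith)]
  set B := Metric.closedBall x₀ (2 * ρ) with hB
  set V := volume.real B with hV
  have hV0 : 0 ≤ V := measureReal_nonneg
  obtain ⟨χ, k1, k2, -, -, -⟩ := radcut S (contDiff_const (c := (1:ℝ))) x₀ (ρ := 2 * ρ) (by linarith)
  simp only [mul_one] at k1
  set P : EE n → ℝ := fun y => χ.1 (y, 0) with hP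
  have hPc : ContDiff ℝ ∞ P := (scd χ).comp (by fun_prop)
  have hPd : ∀ y i, fderiv ℝ P y (bb i) = (XX i χ).1 (y, 0) := fun y i => by
    have h0 : HasFDerivAt (𝕜 := ℝ) (fun y : EE n => ((y, 0) : ZZ n)) ((ContinuousLinearMap.id ℝ (EE n)).prod 0) y :=
      (hasFDerivAt_id y).prodMk (hasFDerivAt_const (0:ℝ) y)
    have h2 : HasFDerivAt P _ y :=
      HasFDerivAt.comp (g := χ.1) y ((scd χ).differentiable (by simp) (y, 0)).hasFDerivAt h0
    rw [h2.fderiv]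
    rfl
  have hP01 : ∀ y, P y ∈ Icc (0:ℝ) 1 := fun y => by
    simp only [hP, k1]; exact S.mem _
  have hP2 : ∀ y, P y ^ 2 ≤ 1 := fun y => pow_le_one₀ (hP01 y).1 (hP01 y).2
  have hW : ∀ y, Wt P y ≤ 1 + 4 * C ^ 2 := fun y => by
    refine add_le_add (hP2 y) ?_
    simp only [hPd]; simpa using k2 (y, 0)
  have hW0 : ∀ y, 0 ≤ Wt P y := fun y =>
    add_nonneg (sq_nonneg _) (Finset.sum_nonneg fun _ _ => sq_nonneg _)
  have hts : tsupport P ⊆ B := by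
    refine closure_minimal (fun y hy => ?_) Metric.isClosed_closedBall
    rw [Function.mem_support, hP] at hy
    simp only [k1] at hy
    have a1 : ‖y - x₀‖ ^ 2 / (2 * ρ) ^ 2 < 1 := by
      by_contra h'; exact hy (by rw [S.zero _ (not_lt.1 h')])
    rw [div_lt_one (by positivity)] at a1
    rw [hB, mem_closedBall_iff_norm]
    exact (pow_le_pow_iff_left₀ (norm_nonneg _) (by linarith) two_ne_zero).1 a1.le
  have hBc : IsCompact B := isCompact_closedBall _ _
  have hPs : HasCompactSupport P := hBc.of_isClosed_subset (isClosed_tsupport _) hts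
  have hP1 : ∀ y ∈ Metric.closedBall x₀ ρ, P y = 1 := fun y hy => by
    rw [mem_closedBall_iff_norm] at hy
    simp only [hP, k1]
    exact S.one _ (by rw [div_le_iff₀ (by positivity)]; nlinarith [norm_nonneg (y - x₀)])
  have o1 : ∀ y ∉ B, P y = 0 := fun y hy => image_eq_zero_of_notMem_tsupport fun h' => hy (hts h')
  have o2 : ∀ y ∉ B, Wt P y = 0 := fun y hy => image_eq_zero_of_notMem_tsupport fun h' => hy (hts (Wt_ts h'))
  have hu2 : ∀ y ∈ B, ∀ t < T, u (y, t) ^ 2 ≤ G ^ 2 := fun y hy t ht => by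
    rw [← sq_abs]; exact pow_le_pow_left₀ (abs_nonneg _) (hG y hy t ht) 2
  have gen : ∀ (w : EE n → ℝ) (D t : ℝ), t < T → 0 ≤ D → (∀ y, 0 ≤ w y) → (∀ y, w y ≤ D) → (∀ y ∉ B, w y = 0) →
      ∫ y, w y * u (y, t) ^ 2 ≤ D * V * G ^ 2 := by
    intro w D t ht hD w0 w1 w2
    have : ∫ y, B.indicator (fun _ => D * G ^ 2) y = D * V * G ^ 2 := by
      rw [integral_indicator hBc.measurableSet, setIntegral_const, smul_eq_mul]; ring
    rw [← this]
    refine integral_mono_of_nonneg (Eventually.of_forall fun y => mul_nonneg (w0 y) (sq_nonneg _))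
      ((integrable_indicator_iff hBc.measurableSet).2 (integrableOn_const hBc.measure_lt_top.ne))
      (Eventually.of_forall fun y => ?_)
    by_cases hy : y ∈ B
    · rw [indicator_of_mem hy]
      exact mul_le_mul (w1 y) (hu2 y hy t ht) (sq_nonneg _) hD
    · simp [indicator_of_notMem hy, w2 y hy]
  have g1 := gen (fun y => P y ^ 2) 1 b hb zero_le_one (fun y => sq_nonneg _) hP2 (fun y hy => by simp [o1 y hy])
  have g2 : ∫ t in (0:ℝ)..b, ∫ y, Wt P y * u (y, t) ^ 2 ≤ (1 + 4 * C ^ 2) * V * G ^ 2 * b := by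
    have := intervalIntegral.norm_integral_le_of_norm_le_const (a := 0) (b := b)
      (f := fun t => ∫ y, Wt P y * u (y, t) ^ 2) (C := (1 + 4 * C ^ 2) * V * G ^ 2) fun t ht => by
        rw [uIoc_of_le hb0] at ht
        rw [Real.norm_of_nonneg (integral_nonneg fun y => mul_nonneg (hW0 y) (sq_nonneg _))]
        exact gen (Wt P) _ t (ht.2.trans_lt hb) (by positivity) hW0 hW o2
    rw [sub_zero, abs_of_nonneg hb0] at this
    exact (le_abs_self _).trans this
  obtain ⟨c1, c2⟩ := cacc h le_rfl hb0 hb hPc hPs (hts.trans hΩ)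
  set K : Set (ZZ n) := Metric.closedBall x₀ ρ ×ˢ Icc 0 b with hK
  have hKc : IsCompact K := (isCompact_closedBall x₀ ρ).prod isCompact_Icc
  have hsub : Metric.closedBall x₀ ρ ⊆ B := Metric.closedBall_subset_closedBall (by linarith)
  have hKi := (QQ_int h hKc (prod_mono (hsub.trans hΩ) fun t ht => ht.2.trans_lt hb)).1
  have c3 : IntegrableOn (fun z : ZZ n => P z.1 ^ 2 * ∑ i, gx i u z ^ 2) K :=
    c1.mono_set (prod_mono (subset_univ _) le_rfl)
  have ic : IntegrableOn (fun _ : ZZ n => G ^ 2) K := integrableOn_const hKc.measure_lt_top.ne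
  have c4 : ∫ z in K, QQ u z ≤ ∫ z in K, (G ^ 2 + P z.1 ^ 2 * ∑ i, gx i u z ^ 2) := by
    refine setIntegral_mono_on hKi (ic.add c3) hKc.measurableSet fun z hz => ?_
    rw [hP1 _ hz.1, one_pow, one_mul]
    exact add_le_add (hu2 _ (hsub hz.1) _ (hz.2.2.trans_lt hb)) le_rfl
  rw [integral_add ic c3, setIntegral_const, smul_eq_mul] at c4
  have c5 : ∫ z in K, P z.1 ^ 2 * ∑ i, gx i u z ^ 2 ≤ ∫ z in univ ×ˢ Icc 0 b, P z.1 ^ 2 * ∑ i, gx i u z ^ 2 :=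
    setIntegral_mono_set c1 (Eventually.of_forall fun z => mul_nonneg (sq_nonneg _)
      (Finset.sum_nonneg fun _ _ => sq_nonneg _)) (Eventually.of_forall (prod_mono (subset_univ _) le_rfl))
  have c6 : volume.real K ≤ V * b := by
    rw [hK, measureReal_def, Measure.volume_eq_prod, Measure.prod_prod, ENNReal.toReal_mul, Real.volume_Icc, sub_zero,
      ENNReal.toReal_ofReal hb0]
    exact mul_le_mul_of_nonneg_right (measureReal_mono hsub hBc.measure_lt_top.ne) hb0
  have M0 := h.M0
  calc ∫ z in K, QQ u z ≤ V * b * G ^ 2 + (1 * V * G ^ 2 + (2 * M + 2 * M ^ 2 + 8) * ((1 + 4 * C ^ 2) * V * G ^ 2 * b)) := by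
        refine c4.trans (add_le_add (mul_le_mul_of_nonneg_right c6 (sq_nonneg _)) (c5.trans (c2.trans (add_le_add g1 ?_))))
        exact mul_le_mul_of_nonneg_left g2 (by positivity)
    _ = _ := by ring

end energy

/-- open cone -/
def cn {n : ℕ} (i0 : Fin n) (c : ℝ) : Set (EE n) := {x | c * ‖x‖ < x i0}

section dglob
variable {n : ℕ}

theorem expn_cont : Continuous fun z : ZZ n => Real.exp (‖z.1‖ ^ 2) :=
  Real.continuous_exp.comp ((continuous_norm.comp continuous_fst).pow 2)

theorem coord_sub_le (i0 : Fin n) (x y : EE n) : |x i0 - y i0| ≤ ‖x - y‖ := by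
  have := PiLp.norm_apply_le (x - y) i0
  simpa using this

theorem cn_ball {i0 : Fin n} {c₁ c₀ r : ℝ} (h0 : 0 ≤ c₁) (h1 : c₁ < c₀) (h2 : c₀ ≤ 1) (hr : 0 < r)
    {x₀ : EE n} (hx : c₀ * ‖x₀‖ ≤ x₀ i0) (hx2 : r ≤ ‖x₀‖) :
    Metric.closedBall x₀ (2 * ((c₀ - c₁) / 8 * r)) ⊆ cn i0 c₁ := by
  intro x hxb
  rw [mem_closedBall_iff_norm] at hxb
  have a1 := (abs_le.1 (coord_sub_le i0 x x₀)).1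
  have a2 : ‖x‖ ≤ ‖x₀‖ + ‖x - x₀‖ := by
    calc ‖x‖ = ‖x₀ + (x - x₀)‖ := by congr 1; abel
      _ ≤ _ := norm_add_le _ _
  show c₁ * ‖x‖ < x i0
  have b1 := mul_le_mul_of_nonneg_left a2 h0
  have b2 : c₁ * ‖x - x₀‖ ≤ 1 * ‖x - x₀‖ := mul_le_mul_of_nonneg_right (by linarith) (norm_nonneg _)
  have b3 : (c₀ - c₁) * r ≤ (c₀ - c₁) * ‖x₀‖ := mul_le_mul_of_nonneg_left hx2 (by linarith)
  have b4 : 0 < (c₀ - c₁) * r := mul_pos (by linarith) hr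
  linarith

theorem decay_ann {i0 : Fin n} {c₁ c₀ M M' T : ℝ} (h0 : 0 ≤ c₁) (h1 : c₁ < c₀) (h2 : c₀ ≤ 1)
    (hM' : 0 ≤ M') (hM : 0 ≤ M) {τ : ℝ} (hτ : 0 < τ) (hτA : τ ≤ 1 / (8 * (48 * M ^ 2 + 8))) (hT : 5 * τ < T)
    (hτM : τ ≤ ((c₀ - c₁) / 8) ^ 2 / (64 * (32 * M' + 12))) :
    ∃ D, 0 ≤ D ∧ ∀ (u : ZZ n → ℝ) (C' : ℝ), 0 ≤ C' → Sol (cn i0 c₁) T M u →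
      (∀ x ∈ cn i0 c₁, ∀ t < T, |u (x, t)| ≤ C' * Real.exp (M' * ‖x‖ ^ 2)) →
      ∀ (r : ℝ) (x₀ : EE n), 15 / ((c₀ - c₁) / 8) ≤ r → c₀ * ‖x₀‖ ≤ x₀ i0 → r ≤ ‖x₀‖ → ‖x₀‖ ≤ 2 * r →
      IntegrableOn (fun z : ZZ n => Real.exp (‖z.1‖ ^ 2) * QQ u z)
        (Metric.closedBall x₀ ((c₀ - c₁) / 8 * r / 8) ×ˢ Icc 0 τ) ∧
      ∫ z in (Metric.closedBall x₀ ((c₀ - c₁) / 8 * r / 8) ×ˢ Icc 0 τ), Real.exp (‖z.1‖ ^ 2) * QQ u z ≤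
        D * C' ^ 2 * Real.exp (- 2 * r ^ 2) := by
  obtain ⟨θ, C, S⟩ := stp_exists
  set κ := (c₀ - c₁) / 8 with hκ
  have hκ0 : 0 < κ := by rw [hκ]; linarith
  have hκ1 : κ ≤ 1 / 8 := by rw [hκ]; linarith
  have C0 := S.C0
  set D1 := 16 * (4 * C ^ 2 + (4 * C + 2 * n * C + C / (5 * τ)) ^ 2) with hD1
  set v := volume.real (Metric.ball (0 : EE n) 1) with hv
  have hv0 : 0 ≤ v := measureReal_nonneg
  set D2 := (5 * τ + 1 + (2 * M + 2 * M ^ 2 + 8) * ((1 + 4 * C ^ 2) * (5 * τ))) * v with hD2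
  have hD10 : 0 ≤ D1 := by positivity
  have hD20 : 0 ≤ D2 := by positivity
  refine ⟨D1 * D2 * n.factorial, by positivity, fun u C' hC' h hu r x₀ hr hx hx1 hx2 => ?_⟩
  have hκr : 15 ≤ κ * r := by rw [div_le_iff₀ hκ0] at hr; linarith
  have hr1 : 1 ≤ r := le_trans (by rw [le_div_iff₀ hκ0]; linarith) hr
  have hr0 : 0 < r := by linarith
  have hkr2 : κ * r ≤ 1 / 8 * r := mul_le_mul_of_nonneg_right hκ1 hr0.le
  have hb2 : Metric.closedBall x₀ (2 * (κ * r)) ⊆ cn i0 c₁ := cn_ball h0 h1 h2 hr0 hx hx1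
  have hb1 : Metric.closedBall x₀ (κ * r) ⊆ cn i0 c₁ :=
    (Metric.closedBall_subset_closedBall (by linarith)).trans hb2
  set B : Set (ZZ n) := Metric.closedBall x₀ (κ * r / 8) ×ˢ Icc 0 τ with hB
  have hBc : IsCompact B := (isCompact_closedBall _ _).prod isCompact_Icc
  have hBi := (QQ_int h hBc (prod_mono ((Metric.closedBall_subset_closedBall (by linarith)).trans hb1)
    fun t ht => by have := ht.2; show t < T; linarith)).1
  have nb : ∀ x, ∀ d, x ∈ Metric.closedBall x₀ d → ‖x‖ ≤ 2 * r + d := fun x d hxd => by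
    rw [mem_closedBall_iff_norm] at hxd
    calc ‖x‖ = ‖x₀ + (x - x₀)‖ := by congr 1; abel
      _ ≤ ‖x₀‖ + ‖x - x₀‖ := norm_add_le _ _
      _ ≤ _ := by linarith
  have g := gauss_loc h S hτ hτA hT x₀ hκr hb1
  have e := energy h S (by positivity) hT x₀ (ρ := κ * r) (G := C' * Real.exp (16 * M' * r ^ 2)) (by linarith) hb2
    (fun x hxb t ht => (hu x (hb2 hxb) t ht).trans (by
      have := nb x _ hxb
      have : ‖x‖ ≤ 4 * r := by linarith
      have : ‖x‖ ^ 2 ≤ (4 * r) ^ 2 := pow_le_pow_left₀ (norm_nonneg _) this 2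
      refine mul_le_mul_of_nonneg_left (Real.exp_le_exp.2 ?_) hC'
      calc M' * ‖x‖ ^ 2 ≤ M' * (4 * r) ^ 2 := mul_le_mul_of_nonneg_left this hM'
        _ = _ := by ring))
  have hint : IntegrableOn (fun z : ZZ n => Real.exp (‖z.1‖ ^ 2) * QQ u z) B :=
    hBi.continuousOn_mul expn_cont.continuousOn hBc
  refine ⟨hint, ?_⟩
  have s1 : ∫ z in B, Real.exp (‖z.1‖ ^ 2) * QQ u z ≤ Real.exp (9 * r ^ 2) * ∫ z in B, QQ u z := by
    rw [← integral_const_mul]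
    refine setIntegral_mono_on hint (hBi.const_mul _) hBc.measurableSet fun z hz => ?_
    refine mul_le_mul_of_nonneg_right (Real.exp_le_exp.2 ?_) (QQ_nonneg _ _)
    have := nb _ _ hz.1
    have : ‖z.1‖ ≤ 3 * r := by linarith
    have := pow_le_pow_left₀ (norm_nonneg _) this 2
    linarith
  have s2 : (2 * (κ * r)) ^ n ≤ n.factorial * Real.exp (r ^ 2) := by
    have a1 : (2 * (κ * r)) ^ n ≤ r ^ n := pow_le_pow_left₀ (by positivity) (by linarith) n
    have a2 := Real.pow_div_factorial_le_exp r hr0.le n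
    rw [div_le_iff₀ (by positivity)] at a2
    have : Real.exp r ≤ Real.exp (r ^ 2) := Real.exp_le_exp.2 (by nlinarith)
    have hf : (0:ℝ) < n.factorial := by positivity
    refine (a1.trans a2).trans ?_
    rw [mul_comm]
    exact mul_le_mul_of_nonneg_left this hf.le
  have s3 : Real.exp (-((κ * r) ^ 2 / (64 * τ))) ≤ Real.exp (-(32 * M' + 12) * r ^ 2) := by
    refine Real.exp_le_exp.2 ?_
    rw [neg_mul, neg_le_neg_iff, le_div_iff₀ (by positivity)]
    rw [le_div_iff₀ (by positivity)] at hτM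
    calc (32 * M' + 12) * r ^ 2 * (64 * τ) = (τ * (64 * (32 * M' + 12))) * r ^ 2 := by ring
      _ ≤ κ ^ 2 * r ^ 2 := by gcongr
      _ = _ := by ring
  set I := ∫ z in Metric.closedBall x₀ (κ * r) ×ˢ Icc 0 (5 * τ), QQ u z with hI
  have e' : I ≤ D2 * (n.factorial * Real.exp (r ^ 2)) * (C' ^ 2 * Real.exp (16 * M' * r ^ 2) ^ 2) := by
    refine e.trans ?_
    rw [mul_pow C']
    refine mul_le_mul_of_nonneg_right ?_ (by positivity)
    calc _ = D2 * (2 * (κ * r)) ^ n := by rw [hD2]; ring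
      _ ≤ _ := by gcongr
  calc _ ≤ Real.exp (9 * r ^ 2) * ∫ z in B, QQ u z := s1
    _ ≤ Real.exp (9 * r ^ 2) * (D1 * Real.exp (-(32 * M' + 12) * r ^ 2) *
        (D2 * (n.factorial * Real.exp (r ^ 2)) * (C' ^ 2 * Real.exp (16 * M' * r ^ 2) ^ 2))) := by
        refine mul_le_mul_of_nonneg_left (g.trans ?_) (Real.exp_pos _).le
        refine mul_le_mul (mul_le_mul_of_nonneg_left s3 hD10) e' (integral_nonneg fun _ => QQ_nonneg _ _) (by positivity)
    _ = D1 * D2 * n.factorial * C' ^ 2 * (Real.exp (9 * r ^ 2) * Real.exp (-(32 * M' + 12) * r ^ 2) *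
        Real.exp (r ^ 2) * Real.exp (16 * M' * r ^ 2) ^ 2) := by ring
    _ = _ := by
        congr 1
        rw [← Real.exp_nat_mul, ← Real.exp_add, ← Real.exp_add, ← Real.exp_add]
        congr 1; push_cast; ring

theorem decay_glob {i0 : Fin n} {c₁ c₀ M M' T : ℝ} (h0 : 0 ≤ c₁) (h1 : c₁ < c₀) (h2 : c₀ ≤ 1)
    (hM' : 0 ≤ M') (hM : 0 ≤ M) {τ : ℝ} (hτ : 0 < τ) (hτA : τ ≤ 1 / (8 * (48 * M ^ 2 + 8))) (hT : 5 * τ < T)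
    (hτM : τ ≤ ((c₀ - c₁) / 8) ^ 2 / (64 * (32 * M' + 12)))
    {u : ZZ n → ℝ} {C' : ℝ} (hC' : 0 ≤ C') (h : Sol (cn i0 c₁) T M u)
    (hu : ∀ x ∈ cn i0 c₁, ∀ t < T, |u (x, t)| ≤ C' * Real.exp (M' * ‖x‖ ^ 2)) {r₁ : ℝ} (hr₁ : 0 < r₁) :
    IntegrableOn (fun z : ZZ n => Real.exp (‖z.1‖ ^ 2) * QQ u z)
      ({x | c₀ * ‖x‖ ≤ x i0 ∧ r₁ ≤ ‖x‖} ×ˢ Icc 0 τ) := by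
  obtain ⟨D, hD, H⟩ := decay_ann h0 h1 h2 hM' hM hτ hτA hT hτM (i0 := i0) (T := T)
  replace H := H u C' hC' h hu
  set κ := (c₀ - c₁) / 8 with hκ
  have hκ0 : 0 < κ := by rw [hκ]; linarith
  set R := 15 / κ with hR
  have hR1 : 1 ≤ R := by rw [hR, le_div_iff₀ hκ0]; linarith
  have clos : IsClosed {x : EE n | c₀ * ‖x‖ ≤ x i0} := isClosed_le (continuous_const.mul continuous_norm) (EuclideanSpace.proj (𝕜 := ℝ) i0).continuous
  have cA : ∀ a b : ℝ, IsCompact {x : EE n | c₀ * ‖x‖ ≤ x i0 ∧ a ≤ ‖x‖ ∧ ‖x‖ ≤ b} := fun a b =>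
    (isCompact_closedBall (0 : EE n) b).of_isClosed_subset
      (clos.inter ((isClosed_le continuous_const continuous_norm).inter (isClosed_le continuous_norm continuous_const)))
      fun x hx => by simpa using hx.2.2
  obtain ⟨s, hs1, hs2, hs3⟩ := (cA 1 2).finite_cover_balls (e := κ / 8) (by positivity)
  set B : EE n → ℕ → Set (ZZ n) := fun e k => Metric.closedBall ((R * 2 ^ k) • e) (κ * (R * 2 ^ k) / 8) ×ˢ Icc 0 τ with hB
  have iB : ∀ e ∈ s, IntegrableOn (fun z : ZZ n => Real.exp (‖z.1‖ ^ 2) * QQ u z) (⋃ k, B e k) := by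
    intro e he
    obtain ⟨q1, q2, q3⟩ := hs1 he
    have HH := fun k : ℕ => by
      have hk : (1:ℝ) ≤ 2 ^ k := one_le_pow₀ (by norm_num)
      have hp : 0 < R * 2 ^ k := by positivity
      have nn : ‖(R * 2 ^ k) • e‖ = R * 2 ^ k * ‖e‖ := by rw [norm_smul, Real.norm_of_nonneg hp.le]
      exact H (R * 2 ^ k) ((R * 2 ^ k) • e) (le_mul_of_one_le_right (by linarith) hk)
        (by rw [nn]; simp only [PiLp.smul_apply, smul_eq_mul]; rw [mul_left_comm]
            exact mul_le_mul_of_nonneg_left q1 hp.le)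
        (by rw [nn]; exact le_mul_of_one_le_right hp.le q2)
        (by rw [nn, mul_comm]; exact mul_le_mul_of_nonneg_right q3 hp.le)
    refine integrableOn_iUnion_of_summable_integral_norm
      (fun k => (HH k).1) ?_
    refine Summable.of_nonneg_of_le (fun k => integral_nonneg fun _ => norm_nonneg _) (fun k => ?_)
      ((Real.summable_exp_neg_nat).mul_left (D * C' ^ 2))
    have : ∀ z : ZZ n, ‖Real.exp (‖z.1‖ ^ 2) * QQ u z‖ = Real.exp (‖z.1‖ ^ 2) * QQ u z := fun z =>
      Real.norm_of_nonneg (mul_nonneg (Real.exp_pos _).le (QQ_nonneg _ _))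
    simp only [this]
    refine (HH k).2.trans (mul_le_mul_of_nonneg_left (Real.exp_le_exp.2 ?_) (by positivity))
    have k1 : (k : ℝ) ≤ 2 ^ k := by exact_mod_cast Nat.lt_two_pow_self.le
    have hk : (1:ℝ) ≤ 2 ^ k := one_le_pow₀ (by norm_num)
    have k2 : (2:ℝ) ^ k ≤ R * 2 ^ k := le_mul_of_one_le_left (by positivity) hR1
    have k3 : 1 * (R * 2 ^ k) ≤ (R * 2 ^ k) ^ 2 := by
      rw [sq]; exact mul_le_mul_of_nonneg_right (hk.trans k2) (by positivity)
    linarith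
  have i1 : IntegrableOn (fun z : ZZ n => Real.exp (‖z.1‖ ^ 2) * QQ u z) (⋃ e ∈ s, ⋃ k, B e k) :=
    (integrableOn_finite_biUnion hs2).2 iB
  have cK : IsCompact ({x : EE n | c₀ * ‖x‖ ≤ x i0 ∧ r₁ ≤ ‖x‖ ∧ ‖x‖ ≤ R} ×ˢ Icc 0 τ) := (cA r₁ R).prod isCompact_Icc
  have i2 : IntegrableOn (fun z : ZZ n => Real.exp (‖z.1‖ ^ 2) * QQ u z)
      ({x | c₀ * ‖x‖ ≤ x i0 ∧ r₁ ≤ ‖x‖ ∧ ‖x‖ ≤ R} ×ˢ Icc 0 τ) := by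
    refine (QQ_int h cK (prod_mono (fun x hx => ?_) fun t ht => ?_)).1.continuousOn_mul expn_cont.continuousOn cK
    · have := hx.1
      have : 0 < ‖x‖ := hr₁.trans_le hx.2.1
      show c₁ * ‖x‖ < x i0
      nlinarith
    · have := ht.2; show t < T; linarith
  refine (i2.union i1).mono_set ?_
  rintro ⟨x, t⟩ ⟨⟨hx1, hx2⟩, ht⟩
  rcases le_or_gt ‖x‖ R with hxR | hxR
  · exact Or.inl ⟨⟨hx1, hx2, hxR⟩, ht⟩
  · right
    have hR0 : 0 < R := by linarith
    obtain ⟨k, k1, k2⟩ := exists_nat_pow_near (x := ‖x‖ / R) (y := (2:ℝ)) (by rw [le_div_iff₀ hR0]; linarith) (by norm_num)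
    rw [le_div_iff₀ hR0] at k1
    rw [div_lt_iff₀ hR0, pow_succ] at k2
    have hp : 0 < R * 2 ^ k := by positivity
    set y : EE n := (R * 2 ^ k)⁻¹ • x with hy
    have ny : ‖y‖ = (R * 2 ^ k)⁻¹ * ‖x‖ := by rw [hy, norm_smul, Real.norm_of_nonneg (by positivity)]
    have hxy : x = (R * 2 ^ k) • y := by rw [hy, smul_smul, mul_inv_cancel₀ hp.ne', one_smul]
    have ym : y ∈ {x : EE n | c₀ * ‖x‖ ≤ x i0 ∧ 1 ≤ ‖x‖ ∧ ‖x‖ ≤ 2} := by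
      refine ⟨?_, ?_, ?_⟩
      · rw [ny, hy]; simp only [PiLp.smul_apply, smul_eq_mul]
        rw [mul_left_comm]
        exact mul_le_mul_of_nonneg_left hx1 (by positivity)
      · rw [ny, inv_mul_eq_div, le_div_iff₀ hp]; linarith
      · rw [ny, inv_mul_eq_div, div_le_iff₀ hp]; linarith
    obtain ⟨e, he, hye⟩ := mem_iUnion₂.1 (hs3 ym)
    refine mem_iUnion₂.2 ⟨e, he, mem_iUnion.2 ⟨k, ?_, ht⟩⟩
    rw [mem_ball_iff_norm] at hye
    rw [mem_closedBall_iff_norm]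
    show ‖x - _‖ ≤ _
    rw [hxy, ← smul_sub, norm_smul, Real.norm_of_nonneg hp.le]
    calc R * 2 ^ k * ‖y - e‖ ≤ R * 2 ^ k * (κ / 8) := by gcongr
      _ = _ := by ring

end dglob

theorem pE1 {z : ℝ} (h0 : (169/400) ≤ z) (h1 : z ≤ (3/4)) : 0 ≤ (-671/1000) * z ^ 0 + (627/1000) * z ^ 1 + (3993/1000) * z ^ 2 + (1327/200) * z ^ 3 + (-8409/250) * z ^ 4 + (1193/100) * z ^ 5 + (21859/500) * z ^ 6 + (-5941/125) * z ^ 7 + (17261/1000) * z ^ 8 + (-2103/1000) * z ^ 9 := by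
  have a := sub_nonneg.2 h0
  have b := sub_nonneg.2 h1
  have e : (11361656654439817571/262144000000000000000000) * ((-671/1000) * z ^ 0 + (627/1000) * z ^ 1 + (3993/1000) * z ^ 2 + (1327/200) * z ^ 3 + (-8409/250) * z ^ 4 + (1193/100) * z ^ 5 + (21859/500) * z ^ 6 + (-5941/125) * z ^ 7 + (17261/1000) * z ^ 8 + (-2103/1000) * z ^ 9) = (12314925122043762193730113/262144000000000000000000000) * ((z - (169/400)) ^ 0 * ((3/4) - z) ^ 9) + (2189608138563265152294183/2621440000000000000000000) * ((z - (169/400)) ^ 1 * ((3/4) - z) ^ 8) + (29475890549991600291001/6553600000000000000000) * ((z - (169/400)) ^ 2 * ((3/4) - z) ^ 7) + (780065080571692489067/65536000000000000000) * ((z - (169/400)) ^ 3 * ((3/4) - z) ^ 6) + (23632627226110973023/1310720000000000000) * ((z - (169/400)) ^ 4 * ((3/4) - z) ^ 5) + (216416439156079281/13107200000000000) * ((z - (169/400)) ^ 5 * ((3/4) - z) ^ 4) + (601660806223781/65536000000000) * ((z - (169/400)) ^ 6 * ((3/4) - z) ^ 3) + (1958007857751/655360000000) * ((z - (169/400)) ^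 7 * ((3/4) - z) ^ 2) + (13665068169/26214400000) * ((z - (169/400)) ^ 8 * ((3/4) - z) ^ 1) + (10392943/262144000) * ((z - (169/400)) ^ 9 * ((3/4) - z) ^ 0) := by ring
  refine nonneg_of_mul_nonneg_right (a := (11361656654439817571/262144000000000000000000)) ?_ (by norm_num)
  rw [e]; positivity

theorem pE2 {z : ℝ} (h0 : (3/4) ≤ z) (h1 : z ≤ (1)) : 0 ≤ (-671/1000) * z ^ 0 + (627/1000) * z ^ 1 + (3993/1000) * z ^ 2 + (1327/200) * z ^ 3 + (-8409/250) * z ^ 4 + (1193/100) * z ^ 5 + (21859/500) * z ^ 6 + (-5941/125) * z ^ 7 + (17261/1000) * z ^ 8 + (-2103/1000) * z ^ 9 := by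
  have a := sub_nonneg.2 h0
  have b := sub_nonneg.2 h1
  have e : (1/262144) * ((-671/1000) * z ^ 0 + (627/1000) * z ^ 1 + (3993/1000) * z ^ 2 + (1327/200) * z ^ 3 + (-8409/250) * z ^ 4 + (1193/100) * z ^ 5 + (21859/500) * z ^ 6 + (-5941/125) * z ^ 7 + (17261/1000) * z ^ 8 + (-2103/1000) * z ^ 9) = (10392943/262144000) * ((z - (3/4)) ^ 0 * ((1) - z) ^ 9) + (7578111/32768000) * ((z - (3/4)) ^ 1 * ((1) - z) ^ 8) + (463221/819200) * ((z - (3/4)) ^ 2 * ((1) - z) ^ 7) + (2090983/2048000) * ((z - (3/4)) ^ 3 * ((1) - z) ^ 6) + (562569/256000) * ((z - (3/4)) ^ 4 * ((1) - z) ^ 5) + (271517/64000) * ((z - (3/4)) ^ 5 * ((1) - z) ^ 4) + (335477/64000) * ((z - (3/4)) ^ 6 * ((1) - z) ^ 3) + (7517/2000) * ((z - (3/4)) ^ 7 * ((1) - z) ^ 2) + (5739/4000) * ((z - (3/4)) ^ 8 * ((1) - z) ^ 1) + (113/500) * ((z - (3/4)) ^ 9 * ((1) - z) ^ 0) := by 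ring
  refine nonneg_of_mul_nonneg_right (a := (1/262144)) ?_ (by norm_num)
  rw [e]; positivity

theorem pN {z : ℝ} (h0 : (169/400) ≤ z) (h1 : z ≤ (1)) : 0 ≤ (217/1000) * z ^ 0 + (-111/200) * z ^ 1 + (3433/1000) * z ^ 2 + (-263/200) * z ^ 3 + (-967/250) * z ^ 4 + (3003/1000) * z ^ 5 + (-519/1000) * z ^ 6 := by
  have a := sub_nonneg.2 h0
  have b := sub_nonneg.2 h1
  have e : (151939915084881/4096000000000000) * ((217/1000) * z ^ 0 + (-111/200) * z ^ 1 + (3433/1000) * z ^ 2 + (-263/200) * z ^ 3 + (-967/250) * z ^ 4 + (3003/1000) * z ^ 5 + (-519/1000) * z ^ 6) = (1680889212977971161/4096000000000000000) * ((z - (169/400)) ^ 0 * ((1) - z) ^ 6) + (30602514066188361/10240000000000000) * ((z - (169/400)) ^ 1 * ((1) - z) ^ 5) + (110938210755801/12800000000000) * ((z - (169/400)) ^ 2 * ((1) - z) ^ 4) + (791025582567/64000000000) * ((z - (169/400)) ^ 3 * ((1) - z) ^ 3) + (57136101/6400000) * ((z - (169/400)) ^ 4 * ((1) - z) ^ 2)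 + (245751/80000) * ((z - (169/400)) ^ 5 * ((1) - z) ^ 1) + (99/250) * ((z - (169/400)) ^ 6 * ((1) - z) ^ 0) := by ring
  refine nonneg_of_mul_nonneg_right (a := (151939915084881/4096000000000000)) ?_ (by norm_num)
  rw [e]; positivity

theorem pD {z : ℝ} (h0 : (169/400) ≤ z) (h1 : z ≤ (1)) : 0 ≤ (0) * z ^ 0 + (1/500) * z ^ 1 + (1169/1000) * z ^ 2 + (137/200) * z ^ 3 + (-389/200) * z ^ 4 + (259/500) * z ^ 5 := by
  have a := sub_nonneg.2 h0
  have b := sub_nonneg.2 h1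
  have e : (657748550151/10240000000000) * ((0) * z ^ 0 + (1/500) * z ^ 1 + (1169/1000) * z ^ 2 + (137/200) * z ^ 3 + (-389/200) * z ^ 4 + (259/500) * z ^ 5) = (1055631520119891/5120000000000000) * ((z - (169/400)) ^ 0 * ((1) - z) ^ 5) + (7798549831809/5120000000000) * ((z - (169/400)) ^ 1 * ((1) - z) ^ 4) + (53066361513/12800000000) * ((z - (169/400)) ^ 2 * ((1) - z) ^ 3) + (402977487/80000000) * ((z - (169/400)) ^ 3 * ((1) - z) ^ 2) + (208329/80000) * ((z - (169/400)) ^ 4 * ((1) - z) ^ 1) + (429/1000) * ((z - (169/400)) ^ 5 * ((1) - z) ^ 0) := by ring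
  refine nonneg_of_mul_nonneg_right (a := (657748550151/10240000000000)) ?_ (by norm_num)
  rw [e]; positivity

theorem pos_poly {c : ℝ} (h0 : 13 / 20 ≤ c) (h1 : c ≤ 1) {f fp fq fpp fpq fqq : ℝ}
    (hf : f = -346 / 1000 + 650 / 1000 * c ^ 2 + 450 / 1000 * c ^ 4 - 120 / 1000 * c ^ 6)
    (hp : fp = 650 / 1000 * 2 * c + 450 / 1000 * 4 * c ^ 3 - 120 / 1000 * 6 * c ^ 5)
    (hq : fq = -346 / 1000 * (999 / 1000) + 650 / 1000 * (-1 / 1000) * c ^ 2 + 450 / 1000 * (-1001 / 1000) * c ^ 4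
      - 120 / 1000 * (-2001 / 1000) * c ^ 6)
    (hpp : fpp = 650 / 1000 * 2 + 450 / 1000 * 12 * c ^ 2 - 120 / 1000 * 30 * c ^ 4)
    (hpq : fpq = 650 / 1000 * (-1 / 1000) * 2 * c + 450 / 1000 * (-1001 / 1000) * 4 * c ^ 3
      - 120 / 1000 * (-2001 / 1000) * 6 * c ^ 5)
    (hqq : fqq = -346 / 1000 * (999 / 1000) * (-1 / 1000) + 650 / 1000 * (-1 / 1000) * (-1001 / 1000) * c ^ 2 +
      450 / 1000 * (-1001 / 1000) * (-2001 / 1000) * c ^ 4 - 120 / 1000 * (-2001 / 1000) * (-3001 / 1000) * c ^ 6) :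
    1 / 100 ≤ fpp * (fp + 2 * fq * c) ^ 2 + 4 * fpq * (fp + 2 * fq * c) * (c * fp + 2 * fq) +
      4 * fqq * (c * fp + 2 * fq) ^ 2 + 4 * fq * (fp ^ 2 + 4 * c * fp * fq + 4 * fq ^ 2) ∧
    1 / 2 ≤ fp ^ 2 + 4 * c * fp * fq + 4 * fq ^ 2 + 2 * fq * f ∧ 1 ≤ fpp ∧ 0 ≤ fpp * fqq - fpq ^ 2 := by
  have hz0 : (169/400) ≤ c ^ 2 := by nlinarith
  have hz1 : c ^ 2 ≤ 1 := by nlinarith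
  have pw : ∀ i : ℕ, 0 ≤ (c ^ 2) ^ i := fun i => by positivity
  refine ⟨?_, ?_, ?_, ?_⟩
  · have k := (le_total (c ^ 2) (3 / 4)).elim (fun h => pE1 hz0 h) (fun h => pE2 h hz1)
    subst hf hp hq hpp hpq hqq
    linarith [k, pw 0, pw 1, pw 2, pw 3, pw 4, pw 5, pw 6, pw 7, pw 8, pw 9]
  · have k := pN hz0 (by linarith)
    subst hf hp hq hpp hpq hqq
    linarith [k, pw 0, pw 1, pw 2, pw 3, pw 4, pw 5, pw 6]
  · subst hpp
    nlinarith
  · have k := pD hz0 (by linarith)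
    subst hf hp hq hpp hpq hqq
    linarith [k, pw 0, pw 1, pw 2, pw 3, pw 4, pw 5, pw 6]

section hom
variable {n : ℕ}

/-- partial derivative -/
noncomputable def dd (i : Fin n) (f : EE n → ℝ) (x : EE n) : ℝ := fderiv ℝ f x (bb i)

/-- smooth homogeneous functions -/
structure HH (d : ℝ) (f : EE n → ℝ) : Prop where
  cd : ContDiffOn ℝ ∞ f {0}ᶜ
  hom : ∀ l > 0, ∀ x ≠ 0, f (l • x) = l ^ d * f x

theorem HH.da {d : ℝ} {f : EE n → ℝ} (h : HH d f) {x : EE n} (hx : x ≠ 0) : DifferentiableAt ℝ f x :=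
  ((h.cd.contDiffAt (isOpen_compl_singleton.mem_nhds hx)).differentiableAt (by simp))

theorem HH.dd {d : ℝ} {f : EE n → ℝ} (h : HH d f) (i : Fin n) : HH (d - 1) (dd i f) := by
  refine ⟨?_, fun l hl x hx => ?_⟩
  · exact (h.cd.fderiv_of_isOpen (m := ∞) isOpen_compl_singleton (by simp)).clm_apply contDiffOn_const
  · have hlx : l • x ≠ 0 := smul_ne_zero hl.ne' hx
    have e1 : HasFDerivAt (fun y => f (l • y)) ((fderiv ℝ f (l • x)).comp (l • ContinuousLinearMap.id ℝ (EE n))) x :=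
      (h.da hlx).hasFDerivAt.comp x ((hasFDerivAt_id x).const_smul l)
    have e2 : HasFDerivAt (fun y => l ^ d * f y) (l ^ d • fderiv ℝ f x) x := (h.da hx).hasFDerivAt.const_mul _
    have e3 : (fun y => f (l • y)) =ᶠ[𝓝 x] fun y => l ^ d * f y := by
      filter_upwards [isOpen_compl_singleton.mem_nhds hx] with y hy using h.hom l hl y hy
    have e4 := DFunLike.congr_fun ((e1.congr_of_eventuallyEq e3.symm).unique e2) (bb i)
    simp at e4
    show fderiv ℝ f (l • x) (bb i) = l ^ (d - 1) * fderiv ℝ f x (bb i)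
    rw [Real.rpow_sub_one hl.ne', div_mul_eq_mul_div, eq_div_iff hl.ne', ← e4]; ring

theorem HH.add {d : ℝ} {f g : EE n → ℝ} (hf : HH d f) (hg : HH d g) : HH d (fun x => f x + g x) :=
  ⟨hf.cd.add hg.cd, fun l hl x hx => by rw [hf.hom l hl x hx, hg.hom l hl x hx]; ring⟩

theorem HH.sum {d : ℝ} {ι : Type*} [Fintype ι] {f : ι → EE n → ℝ} (hf : ∀ i, HH d (f i)) : HH d (fun x => ∑ i, f i x) :=
  ⟨ContDiffOn.sum fun i _ => (hf i).cd, fun l hl x hx => by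
    simp only [(hf _).hom l hl x hx, Finset.mul_sum]⟩

theorem HH.cm {d : ℝ} {f : EE n → ℝ} (hf : HH d f) (c : ℝ) : HH d (fun x => c * f x) :=
  ⟨contDiffOn_const.mul hf.cd, fun l hl x hx => by rw [hf.hom l hl x hx]; ring⟩

theorem HH.mul {d e : ℝ} {f g : EE n → ℝ} (hf : HH d f) (hg : HH e g) : HH (d + e) (fun x => f x * g x) :=
  ⟨hf.cd.mul hg.cd, fun l hl x hx => by
    rw [hf.hom l hl x hx, hg.hom l hl x hx, Real.rpow_add hl]; ring⟩

theorem HH.unit {d : ℝ} {f : EE n → ℝ} (hf : HH d f) {x : EE n} (hx : x ≠ 0) :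
    ‖‖x‖⁻¹ • x‖ = 1 ∧ f x = ‖x‖ ^ d * f (‖x‖⁻¹ • x) := by
  have h := norm_pos_iff.2 hx
  constructor
  · rw [norm_smul]; simp [h.ne']
  · rw [← hf.hom _ h _ (smul_ne_zero (inv_ne_zero h.ne') hx), smul_inv_smul₀ h.ne']

theorem HH.bound {d : ℝ} {f : EE n → ℝ} (hf : HH d f) : ∃ C, 0 ≤ C ∧ ∀ x ≠ 0, |f x| ≤ C * ‖x‖ ^ d := by
  obtain ⟨C, hC⟩ := (isCompact_sphere (0 : EE n) 1).exists_bound_of_continuousOn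
    (hf.cd.continuousOn.mono fun x hx => by
      rintro rfl; simp at hx)
  refine ⟨max C 0, le_max_right _ _, fun x hx => ?_⟩
  obtain ⟨h1, h2⟩ := hf.unit hx
  have h3 := hC (‖x‖⁻¹ • x) (by simpa using h1)
  have h4 := Real.rpow_nonneg (norm_nonneg x) d
  rw [h2, abs_mul, mul_comm, abs_of_nonneg h4]
  exact mul_le_mul_of_nonneg_right (h3.trans (le_max_left _ _)) h4

theorem HH.low {d : ℝ} {f : EE n → ℝ} (hf : HH d f) {i0 : Fin n} {e : ℝ}
    (h : ∀ x : EE n, ‖x‖ = 1 → 13 / 20 ≤ x i0 → e ≤ f x) {x : EE n} (hx : x ≠ 0) (hc : 13 / 20 * ‖x‖ ≤ x i0) :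
    e * ‖x‖ ^ d ≤ f x := by
  obtain ⟨h1, h2⟩ := hf.unit hx
  have h0 := norm_pos_iff.2 hx
  rw [h2, mul_comm]
  refine mul_le_mul_of_nonneg_left (h _ h1 ?_) (by positivity)
  simp only [PiLp.smul_apply, smul_eq_mul]
  rw [inv_mul_eq_div, le_div_iff₀ h0]; exact hc

theorem dd_line {f : EE n → ℝ} {x : EE n} {i : Fin n} {d : ℝ} (h : DifferentiableAt ℝ f x)
    (hd : HasDerivAt (fun s : ℝ => f (x + s • bb i)) d 0) : dd i f x = d :=
  (h.lineDeriv_eq_fderiv (v := bb i)).symm.trans (HasLineDerivAt.lineDeriv hd)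

/-- sums of monomials -/
noncomputable def PM (i0 : Fin n) (b : Fin 4 → ℝ) (m : Fin 4 → ℕ) (β : Fin 4 → ℝ) (x : EE n) : ℝ :=
  ∑ k, b k * (x i0) ^ (m k) * (‖x‖ ^ 2) ^ (β k)

theorem PM_cd (i0 : Fin n) (b m β) : ContDiffOn ℝ ∞ (PM i0 b m β) {0}ᶜ := by
  refine ContDiffOn.sum fun k _ => ?_
  have h1 : ContDiff ℝ ∞ fun x : EE n => x i0 := (EuclideanSpace.proj (𝕜 := ℝ) i0).contDiff
  refine ((contDiffOn_const).mul (h1.contDiffOn.pow _)).mul ?_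
  exact (contDiff_norm_sq ℝ).contDiffOn.rpow_const_of_ne fun x hx => by
    have := norm_pos_iff.2 hx; positivity

theorem PM_HH (i0 : Fin n) (b m β) {d : ℝ} (h : ∀ k, (m k : ℝ) + 2 * β k = d) : HH d (PM i0 b m β) := by
  refine ⟨PM_cd i0 b m β, fun l hl x hx => ?_⟩
  simp only [PM, Finset.mul_sum]
  refine Finset.sum_congr rfl fun k _ => ?_
  have e : l ^ d = l ^ (m k) * (l ^ 2) ^ (β k) := by
    rw [← h k, Real.rpow_add hl, Real.rpow_natCast, Real.rpow_mul hl.le]; simp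
  rw [norm_smul, mul_pow, Real.mul_rpow (by positivity) (by positivity), e]
  simp only [PiLp.smul_apply, smul_eq_mul, mul_pow, Real.norm_eq_abs, sq_abs]
  ring

theorem PM_line (i0 : Fin n) (b m β) {x : EE n} (hx : x ≠ 0) (i : Fin n) :
    HasDerivAt (fun s : ℝ => PM i0 b m β (x + s • bb i))
      (PM i0 (fun k => b k * m k) (fun k => m k - 1) β x * (if i = i0 then 1 else 0) +
        2 * PM i0 (fun k => b k * β k) m (fun k => β k - 1) x * x i) 0 := by
  have h1 := ln_q 0 (x, (0 : ℝ)) i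
  have h2 := ln_pd (x, (0:ℝ)) i i0
  simp only [Prod.fst_add, Prod.smul_fst, sub_zero, PiLp.zero_apply] at h1 h2
  have h0 : ‖x + (0 : ℝ) • bb i‖ ^ 2 ≠ 0 := by simpa using hx
  have key := HasDerivAt.fun_sum (u := Finset.univ) fun (k : Fin 4) _ =>
    (((h2.pow (m k)).const_mul (b k)).mul (h1.rpow_const (p := β k) (Or.inl h0)))
  refine (key.congr_deriv ?_)
  simp only [PM, Finset.sum_mul, Finset.mul_sum, ← Finset.sum_add_distrib]
  refine Finset.sum_congr rfl fun k _ => ?_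
  simp only [Pi.pow_apply, zero_smul, add_zero]
  ring

theorem PM_dd (i0 : Fin n) (b m β) {x : EE n} (hx : x ≠ 0) (i : Fin n) :
    dd i (PM i0 b m β) x = PM i0 (fun k => b k * m k) (fun k => m k - 1) β x * (if i = i0 then 1 else 0) +
        2 * PM i0 (fun k => b k * β k) m (fun k => β k - 1) x * x i :=
  dd_line (((PM_cd i0 b m β).contDiffAt (isOpen_compl_singleton.mem_nhds hx)).differentiableAt (by simp))
    (PM_line i0 b m β hx i)

theorem PM_dd2 (i0 : Fin n) (b m β) {x : EE n} (hx : x ≠ 0) (i j : Fin n) :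
    dd j (dd i (PM i0 b m β)) x =
      PM i0 (fun k => b k * m k * (m k - 1 : ℕ)) (fun k => m k - 1 - 1) β x * (if i = i0 then 1 else 0) * (if j = i0 then 1 else 0)
      + 2 * PM i0 (fun k => b k * m k * β k) (fun k => m k - 1) (fun k => β k - 1) x *
        ((if i = i0 then 1 else 0) * x j + (if j = i0 then 1 else 0) * x i)
      + 4 * PM i0 (fun k => b k * β k * (β k - 1)) m (fun k => β k - 1 - 1) x * x i * x j
      + 2 * PM i0 (fun k => b k * β k) m (fun k => β k - 1) x * (if j = i then 1 else 0) := by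
  have h0 : DifferentiableAt ℝ (dd i (PM i0 b m β)) x := by
    have h := (PM_cd i0 b m β).fderiv_of_isOpen (m := ∞) isOpen_compl_singleton (by simp)
    exact ((h.clm_apply (contDiffOn_const (c := bb i))).contDiffAt
      (isOpen_compl_singleton.mem_nhds hx)).differentiableAt (by simp)
  refine dd_line h0 ?_
  have h2 := ln_pd (x, (0:ℝ)) j i
  simp only [Prod.fst_add, Prod.smul_fst] at h2
  have key := ((PM_line i0 (fun k => b k * m k) (fun k => m k - 1) β hx j).mul_const (if i = i0 then (1:ℝ) else 0)).add
    (((PM_line i0 (fun k => b k * β k) m (fun k => β k - 1) hx j).const_mul 2).mul h2)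
  refine (key.congr_deriv ?_).congr_of_eventuallyEq ?_
  · simp only [zero_smul, add_zero, mul_assoc, mul_comm (β _) (m _ : ℝ)]
    ring
  · have : Tendsto (fun s : ℝ => x + s • bb j) (𝓝 0) (𝓝 x) := by
      have : Continuous fun s : ℝ => x + s • bb j := by fun_prop
      simpa using this.tendsto 0
    filter_upwards [this.eventually (isOpen_compl_singleton.mem_nhds hx)] with s hs
    exact PM_dd i0 b m β hs i

end hom

section wgt
variable {n : ℕ}

theorem quad_alg (i0 : Fin n) (A B C D : ℝ) (x ξ : Fin n → ℝ) :
    ∑ j, ∑ i, (A * (if i = i0 then 1 else 0) * (if j = i0 then 1 else 0)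
      + 2 * B * ((if i = i0 then 1 else 0) * x j + (if j = i0 then 1 else 0) * x i)
      + 4 * C * x i * x j + 2 * D * (if j = i then 1 else 0)) * ξ i * ξ j =
    A * ξ i0 ^ 2 + 4 * B * ξ i0 * (∑ i, x i * ξ i) + 4 * C * (∑ i, x i * ξ i) ^ 2 + 2 * D * ∑ i, ξ i ^ 2 := by
  have h : ∀ a b : Fin n → ℝ, (∑ i, a i) * (∑ j, b j) = ∑ j, ∑ i, a i * b j := fun a b => by
    rw [Finset.sum_mul_sum, Finset.sum_comm]
  have hd : ξ i0 = ∑ i, (if i = i0 then 1 else 0) * ξ i := by simp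
  have h3 : ∑ i, ξ i ^ 2 = ∑ j, ∑ i, (if j = i then 1 else 0) * ξ i * ξ j := by simp [sq]
  have e1 := h (fun i => (if i = i0 then 1 else 0) * ξ i) (fun i => (if i = i0 then 1 else 0) * ξ i)
  have e2 := h (fun i => (if i = i0 then 1 else 0) * ξ i) (fun i => x i * ξ i)
  have e3 := h (fun i => x i * ξ i) (fun i => (if i = i0 then 1 else 0) * ξ i)
  have e4 := h (fun i => x i * ξ i) (fun i => x i * ξ i)
  rw [← hd] at e1 e2 e3
  rw [show A * ξ i0 ^ 2 + 4 * B * ξ i0 * (∑ i, x i * ξ i) + 4 * C * (∑ i, x i * ξ i) ^ 2 + 2 * D * ∑ i, ξ i ^ 2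
    = A * (ξ i0 * ξ i0) + 2 * B * (ξ i0 * (∑ i, x i * ξ i)) + 2 * B * ((∑ i, x i * ξ i) * ξ i0)
     + 4 * C * ((∑ i, x i * ξ i) * (∑ i, x i * ξ i)) + 2 * D * ∑ i, ξ i ^ 2 by ring, e1, e2, e3, e4, h3]
  simp only [Finset.mul_sum, ← Finset.sum_add_distrib]
  exact Finset.sum_congr rfl fun j _ => Finset.sum_congr rfl fun i _ => by ring

theorem HH.of {d d' : ℝ} {f g : EE n → ℝ} (h : HH d f) (hd : d = d') (hfg : ∀ x, f x = g x) : HH d' g := by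
  rw [← hd, ← funext hfg]; exact h

/-- the properties of the angular weight -/
structure Wgt (i0 : Fin n) (d : ℝ) (ψ μ : EE n → ℝ) : Prop where
  hd1 : 1 < d
  hd2 : d < 2
  Hψ : HH d ψ
  Hμ : HH (d - 2) μ
  quad : ∀ x ≠ 0, 13 / 20 * ‖x‖ ≤ x i0 → ∀ ξ : Fin n → ℝ,
    0 ≤ (∑ j, ∑ i, dd j (dd i ψ) x * ξ i * ξ j) + μ x * ∑ i, ξ i ^ 2
  E : ∀ x ≠ 0, 13 / 20 * ‖x‖ ≤ x i0 → 1 / 100 * ‖x‖ ^ (3 * d - 4) ≤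
    (∑ j, ∑ i, dd j (dd i ψ) x * dd i ψ x * dd j ψ x) - μ x * ∑ i, dd i ψ x ^ 2
  N : ∀ x ≠ 0, 13 / 20 * ‖x‖ ≤ x i0 → 1 / 2 * ‖x‖ ^ (2 * d - 2) ≤
    (∑ i, dd i ψ x ^ 2) - μ x * ψ x
  pos : ∀ x ≠ 0, 0 < ψ x → 0 < x i0 → 13 / 20 * ‖x‖ < x i0
  big : ∀ x ≠ 0, 9 / 10 * ‖x‖ ≤ x i0 → 0 < ψ x

theorem wgt_exists (i0 : Fin n) : ∃ ψ μ : EE n → ℝ, Wgt i0 (999 / 500) ψ μ := by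
  set b : Fin 4 → ℝ := ![-346 / 1000, 650 / 1000, 450 / 1000, -120 / 1000] with hb
  set m : Fin 4 → ℕ := ![0, 2, 4, 6] with hm
  set β : Fin 4 → ℝ := ![999 / 1000, -1 / 1000, -1001 / 1000, -2001 / 1000] with hβ
  set ψ : EE n → ℝ := PM i0 b m β with hψ
  set μ : EE n → ℝ := fun x => -2 * PM i0 (fun k => b k * β k) m (fun k => β k - 1) x with hμ
  have Hψ : HH (999 / 500) ψ := PM_HH i0 b m β fun k => by
    fin_cases k <;> norm_num [hm, hβ]
  have Hμ : HH (999 / 500 - 2) μ := (PM_HH i0 _ m _ fun k => by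
    fin_cases k <;> norm_num [hm, hβ]).cm _
  have H1 := fun i => Hψ.dd i
  have H2 := fun i j => (H1 i).dd j
  have HN : HH (2 * (999 / 500) - 2) (fun x => ∑ i, dd i ψ x ^ 2) := by
    have := HH.sum fun i => (H1 i).mul (H1 i)
    simp only [← sq] at this
    convert this using 1; norm_num
  -- unit evaluation
  have ev : ∀ x : EE n, ‖x‖ = 1 → ∀ b' m' β', PM i0 b' m' β' x = ∑ k, b' k * (x i0) ^ (m' k) := by
    intro x hx b' m' β'
    simp [PM, hx]
  have U : ∀ x : EE n, ‖x‖ = 1 → 13 / 20 ≤ x i0 →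
      (∀ ξ : Fin n → ℝ, 0 ≤ (∑ j, ∑ i, dd j (dd i ψ) x * ξ i * ξ j) + μ x * ∑ i, ξ i ^ 2) ∧
      1 / 100 ≤ (∑ j, ∑ i, dd j (dd i ψ) x * dd i ψ x * dd j ψ x) - μ x * ∑ i, dd i ψ x ^ 2 ∧
      1 / 2 ≤ (∑ i, dd i ψ x ^ 2) - μ x * ψ x := by
    intro x hx hc
    have hx0 : x ≠ 0 := by rintro rfl; simp at hx
    have hc1 : x i0 ≤ 1 := by
      have := PiLp.norm_apply_le x i0
      rw [hx, Real.norm_eq_abs] at this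
      exact (le_abs_self _).trans this
    obtain ⟨fp, hfp⟩ : ∃ y, y = PM i0 (fun k => b k * m k) (fun k => m k - 1) β x := ⟨_, rfl⟩
    obtain ⟨fq, hfq⟩ : ∃ y, y = PM i0 (fun k => b k * β k) m (fun k => β k - 1) x := ⟨_, rfl⟩
    obtain ⟨fpp, hpp⟩ : ∃ y, y = PM i0 (fun k => b k * m k * (m k - 1 : ℕ)) (fun k => m k - 1 - 1) β x := ⟨_, rfl⟩
    obtain ⟨fpq, hpq⟩ : ∃ y, y = PM i0 (fun k => b k * m k * β k) (fun k => m k - 1) (fun k => β k - 1) x := ⟨_, rfl⟩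
    obtain ⟨fqq, hqq⟩ : ∃ y, y = PM i0 (fun k => b k * β k * (β k - 1)) m (fun k => β k - 1 - 1) x := ⟨_, rfl⟩
    have hnn : ∑ i, x i * x i = 1 := by
      have := EuclideanSpace.norm_sq_eq x
      rw [hx] at this; simpa [sq] using this.symm
    have D1 : ∀ i, dd i ψ x = fp * (if i = i0 then 1 else 0) + 2 * fq * x i := fun i => by
      rw [hfp, hfq]; exact PM_dd i0 b m β hx0 i
    have D2 : ∀ i j, dd j (dd i ψ) x = fpp * (if i = i0 then 1 else 0) * (if j = i0 then 1 else 0)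
      + 2 * fpq * ((if i = i0 then 1 else 0) * x j + (if j = i0 then 1 else 0) * x i)
      + 4 * fqq * x i * x j + 2 * fq * (if j = i then 1 else 0) := fun i j => by
      rw [hpp, hfq, hpq, hqq]; exact PM_dd2 i0 b m β hx0 i j
    have Q : ∀ ξ : Fin n → ℝ, ∑ j, ∑ i, dd j (dd i ψ) x * ξ i * ξ j = _ := fun ξ => by
      simp only [D2]
      exact quad_alg i0 fpp fpq fqq fq x ξ
    have hμx : μ x = -2 * fq := by rw [hfq]
    have S1 : ∑ i, x i * dd i ψ x = x i0 * fp + 2 * fq := by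
      simp only [D1, mul_add, Finset.sum_add_distrib]
      have : ∑ i, x i * (2 * fq * x i) = 2 * fq * ∑ i, x i * x i := by
        rw [Finset.mul_sum]; exact Finset.sum_congr rfl fun i _ => by ring
      rw [this, hnn]; simp
    have S2 : ∑ i, dd i ψ x ^ 2 = fp ^ 2 + 4 * x i0 * fp * fq + 4 * fq ^ 2 := by
      have : ∑ i, dd i ψ x ^ 2 = fp * dd i0 ψ x + 2 * fq * ∑ i, x i * dd i ψ x := by
        rw [Finset.mul_sum]
        have e : fp * dd i0 ψ x = ∑ i, fp * (if i = i0 then 1 else 0) * dd i ψ x := by simp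
        rw [e, ← Finset.sum_add_distrib]
        exact Finset.sum_congr rfl fun i _ => by rw [D1]; ring
      rw [this, S1, D1]; simp; ring
    obtain ⟨f, hf⟩ : ∃ y, y = ψ x := ⟨_, rfl⟩
    obtain ⟨p1, p2, p3, p4⟩ := pos_poly (f := f) (fp := fp) (fq := fq) (fpp := fpp) (fpq := fpq) (fqq := fqq) hc hc1
      (by rw [hf, hψ, ev x hx]; simp [Fin.sum_univ_four, hb, hm]; ring)
      (by rw [hfp, ev x hx]; simp [Fin.sum_univ_four, hb, hm]; ring)
      (by rw [hfq, ev x hx]; simp [Fin.sum_univ_four, hb, hm, hβ]; ring)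
      (by rw [hpp, ev x hx]; simp [Fin.sum_univ_four, hb, hm]; ring)
      (by rw [hpq, ev x hx]; simp [Fin.sum_univ_four, hb, hm, hβ]; ring)
      (by rw [hqq, ev x hx]; simp [Fin.sum_univ_four, hb, hm, hβ]; ring)
    refine ⟨fun ξ => ?_, ?_, ?_⟩
    · rw [Q, hμx]
      have : 0 ≤ fpp * (fpp * ξ i0 ^ 2 + 4 * fpq * ξ i0 * (∑ i, x i * ξ i) + 4 * fqq * (∑ i, x i * ξ i) ^ 2) := by
        have e : fpp * (fpp * ξ i0 ^ 2 + 4 * fpq * ξ i0 * (∑ i, x i * ξ i) + 4 * fqq * (∑ i, x i * ξ i) ^ 2) =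
          (fpp * ξ i0 + 2 * fpq * (∑ i, x i * ξ i)) ^ 2 + 4 * (fpp * fqq - fpq ^ 2) * (∑ i, x i * ξ i) ^ 2 := by ring
        rw [e]; positivity
      have := nonneg_of_mul_nonneg_right this (by linarith)
      linarith
    · rw [Q, S1, S2, hμx]
      have : dd i0 ψ x = fp + 2 * fq * x i0 := by rw [D1]; simp
      rw [this]
      refine p1.trans (le_of_eq ?_); ring
    · rw [S2, hμx, ← hf]
      refine p2.trans (le_of_eq ?_); ring
  refine ⟨ψ, μ, by norm_num, by norm_num, Hψ, Hμ, fun x hx hc ξ => ?_, fun x hx hc => ?_, fun x hx hc => ?_, fun x hx h0 h1 => ?_, fun x hx hc => ?_⟩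
  · have HQ : HH (999 / 500 - 2) (fun x => (∑ j, ∑ i, dd j (dd i ψ) x * ξ i * ξ j) + μ x * ∑ i, ξ i ^ 2) := by
      have h1 := HH.sum fun j => HH.sum fun i => (H2 i j).cm (ξ i * ξ j)
      refine ((h1.of (d' := 999 / 500 - 2) (by norm_num) fun _ => rfl).add (Hμ.cm (∑ i, ξ i ^ 2))).of rfl fun x => ?_
      simp only [mul_comm (μ x)]
      congr 1
      exact Finset.sum_congr rfl fun j _ => Finset.sum_congr rfl fun i _ => by ring
    have := HQ.low (i0 := i0) (e := 0) (fun y hy h => (U y hy h).1 ξ) hx hc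
    simpa using this
  · have h1 := HH.sum fun j => HH.sum fun i => ((H2 i j).mul (H1 i)).mul (H1 j)
    have h2 := ((h1.of (d' := 3 * (999 / 500) - 4) (by norm_num) fun _ => rfl).add
      (((Hμ.mul HN).cm (-1)).of (by norm_num) fun _ => rfl)).of rfl fun x => (by
        show _ = (∑ j, ∑ i, dd j (dd i ψ) x * dd i ψ x * dd j ψ x) - μ x * ∑ i, dd i ψ x ^ 2
        ring)
    exact h2.low (i0 := i0) (fun y hy h => (U y hy h).2.1) hx hc
  · have h2 := (HN.add (((Hμ.mul Hψ).cm (-1)).of (by norm_num) fun _ => rfl)).of rfl fun x => (by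
        show _ = (∑ i, dd i ψ x ^ 2) - μ x * ψ x
        ring)
    exact h2.low (i0 := i0) (fun y hy h => (U y hy h).2.2) hx hc
  · obtain ⟨e1, e2⟩ := Hψ.unit hx
    have hn := norm_pos_iff.2 hx
    have hp : 0 < ψ (‖x‖⁻¹ • x) := by
      rw [e2] at h0; exact pos_of_mul_pos_right h0 (Real.rpow_nonneg hn.le _)
    rw [hψ, ev _ e1] at hp
    have hy : (‖x‖⁻¹ • x) i0 = x i0 / ‖x‖ := by simp [inv_mul_eq_div]
    rw [hy] at hp
    have hy0 : 0 < x i0 / ‖x‖ := by positivity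
    rw [← lt_div_iff₀ hn]
    generalize x i0 / ‖x‖ = c at *
    simp [Fin.sum_univ_four, hb, hm] at hp
    by_contra! hh
    have hz : c ^ 2 ≤ 169 / 400 := by nlinarith
    have hz0 : 0 ≤ c ^ 2 := sq_nonneg c
    have e4 : c ^ 4 = (c ^ 2) ^ 2 := by ring
    have e6 : c ^ 6 = (c ^ 2) ^ 3 := by ring
    rw [e4, e6] at hp
    generalize c ^ 2 = z at *
    nlinarith [mul_nonneg hz0 (sub_nonneg.2 hz), mul_nonneg (sq_nonneg z) (sub_nonneg.2 hz), sq_nonneg (z - 169 / 400),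
      mul_nonneg (sq_nonneg (z - 169 / 400)) (sub_nonneg.2 hz)]
  · obtain ⟨e1, e2⟩ := Hψ.unit hx
    have hn := norm_pos_iff.2 hx
    rw [e2, hψ]
    refine mul_pos (Real.rpow_pos_of_pos hn _) ?_
    rw [ev _ e1]
    have hy : (‖x‖⁻¹ • x) i0 = x i0 / ‖x‖ := by simp [inv_mul_eq_div]
    rw [hy]
    rw [← le_div_iff₀ hn] at hc
    have h1 : x i0 / ‖x‖ ≤ 1 := by
      rw [div_le_one hn]
      exact (le_abs_self _).trans (by simpa using PiLp.norm_apply_le x i0)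
    generalize x i0 / ‖x‖ = c at *
    simp [Fin.sum_univ_four, hb, hm]
    have hz : 81 / 100 ≤ c ^ 2 := by nlinarith
    have hz1 : c ^ 6 ≤ 1 := pow_le_one₀ (by linarith) h1
    have e4 : 0 ≤ c ^ 4 := by positivity
    linarith
end wgt

section wv
variable {n : ℕ}

theorem nz_open : IsOpen {z : ZZ n | z.1 ≠ 0} := isOpen_ne_fun continuous_fst continuous_const

theorem HH.ln {d : ℝ} {f : EE n → ℝ} (h : HH d f) {y : ZZ n} (hy : y.1 ≠ 0) (i : Fin n) :
    HasDerivAt (fun s : ℝ => f (y + s • ((bb i, 0) : ZZ n)).1) (_root_.dd i f y.1) 0 := by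
  have := (h.da hy).hasFDerivAt.hasLineDerivAt (bb i)
  exact this

theorem sv_k {d : ℝ} {f : EE n → ℝ} (h : HH d f) {c : ℝ → ℝ} {k : ℝ} {z : ZZ n} (hz : z.1 ≠ 0) {g : SS n}
    (hg : g.1 =ᶠ[𝓝 z] fun z => c z.2 * f z.1 + k) (i : Fin n) :
    (XX i g).1 =ᶠ[𝓝 z] fun z => c z.2 * dd i f z.1 := by
  refine DD_ev nz_open hz hg fun y hy => ?_
  simp only [ln_t]
  exact ((h.ln hy i).const_mul _).add_const _

theorem sv_x {d : ℝ} {f : EE n → ℝ} (h : HH d f) {c : ℝ → ℝ} {z : ZZ n} (hz : z.1 ≠ 0) {g : SS n}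
    (hg : g.1 =ᶠ[𝓝 z] fun z => c z.2 * f z.1) (i : Fin n) :
    (XX i g).1 =ᶠ[𝓝 z] fun z => c z.2 * dd i f z.1 :=
  sv_k (k := 0) h hz (by simpa using hg) i

theorem sv_t {f : EE n → ℝ} {c c' : ℝ → ℝ} (hc : ∀ t, HasDerivAt c (c' t) t) {z : ZZ n} {g : SS n}
    (hg : g.1 =ᶠ[𝓝 z] fun z => c z.2 * f z.1) :
    (TT g).1 =ᶠ[𝓝 z] fun z => c' z.2 * f z.1 := by
  refine DD_ev isOpen_univ (mem_univ z) hg fun y hy => ?_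
  simp only [ln_t1]
  have := ((hc (y + (0:ℝ) • ((0, 1) : ZZ n)).2).comp (0:ℝ) (ln_td y)).mul_const (f y.1)
  simpa using this

/-- Laplacian -/
noncomputable def la (f : EE n → ℝ) (x : EE n) : ℝ := ∑ i, dd i (dd i f) x

theorem HH.la {d : ℝ} {f : EE n → ℝ} (h : HH d f) : HH (d - 2) (la f) :=
  (HH.sum fun i => (h.dd i).dd i).of (by ring) fun _ => rfl

theorem sv_lk {d : ℝ} {f : EE n → ℝ} (h : HH d f) {c : ℝ → ℝ} {k : ℝ} {z : ZZ n} (hz : z.1 ≠ 0) {g : SS n}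
    (hg : g.1 =ᶠ[𝓝 z] fun z => c z.2 * f z.1 + k) :
    (LL g).1 =ᶠ[𝓝 z] fun z => c z.2 * la f z.1 := by
  have := (eventually_all (ι := Fin n)).2 fun i => sv_x (h.dd i) hz (sv_k h hz hg i) i
  filter_upwards [this] with y hy
  rw [LL_val, la, Finset.mul_sum]
  exact Finset.sum_congr rfl fun i _ => hy i

theorem sv_l {d : ℝ} {f : EE n → ℝ} (h : HH d f) {c : ℝ → ℝ} {z : ZZ n} (hz : z.1 ≠ 0) {g : SS n}
    (hg : g.1 =ᶠ[𝓝 z] fun z => c z.2 * f z.1) :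
    (LL g).1 =ᶠ[𝓝 z] fun z => c z.2 * la f z.1 :=
  sv_lk (k := 0) h hz (by simpa using hg)

theorem sσ (a τ t : ℝ) : HasDerivAt (fun t => a * (τ - t) ^ 2) (-2 * a * (τ - t)) t := by
  refine ((((hasDerivAt_id t).const_sub τ).pow 2).const_mul a).congr_deriv ?_
  simp; ring

theorem sσ' (a τ t : ℝ) : HasDerivAt (fun t => -2 * a * (τ - t)) (2 * a) t := by
  refine (((hasDerivAt_id t).const_sub τ).const_mul (-2 * a)).congr_deriv ?_
  ring

/-- pure algebra of the potential -/
theorem pot_alg {A C τ δ a σ Y k ψ μ N E L2 Lμ : ℝ} (hA : 8 ≤ A) (hC : 1 ≤ C) (hτ1 : 4 * A * τ ≤ 1)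
    (hτ2 : A * C * τ ≤ 1) (ha : 0 < a) (ha1 : 2 * C ≤ a * δ) (ha2 : 2 * C * (25 * (3 * C + 8 * C ^ 2)) ≤ a * δ)
    (ha3 : 8 * τ ^ 2 * (A + A ^ 2 / 2) ≤ a * δ)
    (hσ : 0 < σ) (hσ2 : σ ≤ 2 * τ) (hY : 0 < Y) (hk : 0 < k)
    (hδ : δ / 2 ≤ σ ^ 2 * ψ) (hψ : ψ ≤ C * Y) (hL2 : |L2| ≤ C * (Y * k ^ 2)) (hLμ : |Lμ| ≤ C * (Y * k ^ 2))
    (hμ : |μ| ≤ C * (Y * k)) (hN : N ≤ C * (Y ^ 2 * k)) (hE : 1 / 100 * (Y ^ 3 * k ^ 2) ≤ E - μ * N)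
    (hNμ : 1 / 2 * (Y ^ 2 * k) ≤ N - μ * ψ) :
    A * (1 + (a * σ ^ 2) ^ 2 * N) ≤
      4 * ((a * σ ^ 2) ^ 3 * E) - 4 * (-(a * σ ^ 2 * (2 * a * σ) * N)) + 2 * a * ψ - a * σ ^ 2 * L2
      - 2 * (2 * (a * σ ^ 2) * μ + A / 2) * ((a * σ ^ 2) ^ 2 * N - -2 * a * σ * ψ) - 2 * (a * σ ^ 2) * Lμ
      - (2 * (a * σ ^ 2) * μ + A / 2) ^ 2 := by
  have hs : 0 < a * σ ^ 2 := by positivity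
  have hX : a * δ / (2 * C) ≤ a * σ ^ 2 * Y := by
    rw [div_le_iff₀ (by positivity)]
    have : a * (δ / 2) ≤ a * (σ ^ 2 * (C * Y)) :=
      mul_le_mul_of_nonneg_left (hδ.trans (mul_le_mul_of_nonneg_left hψ (by positivity))) ha.le
    linarith
  have hX1 : 1 ≤ a * σ ^ 2 * Y := le_trans (by rw [le_div_iff₀ (by positivity)]; linarith) hX
  have hX2 : 25 * (3 * C + 8 * C ^ 2) ≤ a * σ ^ 2 * Y :=
    le_trans (by rw [le_div_iff₀ (by positivity)]; linarith) hX
  have haσ : a * σ = (a * σ ^ 2) / σ := by field_simp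
  have haψ : A + A ^ 2 / 2 ≤ a * ψ := by
    have h1 : a * δ ≤ 2 * (σ ^ 2 * (a * ψ)) := by
      have := mul_le_mul_of_nonneg_left hδ ha.le
      linarith
    have h2 : σ ^ 2 ≤ 4 * τ ^ 2 := by
      have := pow_le_pow_left₀ hσ.le hσ2 2
      linarith
    have h0 : 0 ≤ A + A ^ 2 / 2 := by positivity
    have h3 : 2 * (σ ^ 2 * (A + A ^ 2 / 2)) ≤ 2 * (σ ^ 2 * (a * ψ)) := by
      have := mul_le_mul_of_nonneg_right h2 h0
      linarith
    have := le_of_mul_le_mul_left h3 (by norm_num)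
    exact le_of_mul_le_mul_left this (by positivity)
  have haψ0 : 0 ≤ a * ψ := le_trans (by positivity) haψ
  set s := a * σ ^ 2 with hsd
  set X := s * Y with hXd
  have X0 : 0 < X := by positivity
  -- the pieces
  have q1 : 4 * (1 / 100) * (X ^ 3 * k ^ 2) ≤ 4 * s ^ 3 * (E - μ * N) := by
    have := mul_le_mul_of_nonneg_left hE (by positivity : 0 ≤ 4 * s ^ 3)
    rw [hXd]; linarith only [this]
  have q2 : 2 * A * C * (X ^ 2 * k) ≤ 8 * s * (a * σ) * (N - μ * ψ) := by
    have h1 : 8 * s * (a * σ) * (1 / 2 * (Y ^ 2 * k)) ≤ 8 * s * (a * σ) * (N - μ * ψ) :=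
      mul_le_mul_of_nonneg_left hNμ (by positivity)
    have h2 : 2 * A * C ≤ 4 / σ := by
      rw [le_div_iff₀ hσ]
      have : A * C * σ ≤ A * C * (2 * τ) := mul_le_mul_of_nonneg_left hσ2 (by positivity)
      linarith only [this, hτ2]
    have h3 : 2 * A * C * (X ^ 2 * k) ≤ 4 / σ * (X ^ 2 * k) := mul_le_mul_of_nonneg_right h2 (by positivity)
    have e : 8 * s * (a * σ) * (1 / 2 * (Y ^ 2 * k)) = 4 / σ * (X ^ 2 * k) := by
      rw [haσ, hXd]; field_simp; ring
    linarith only [h1, h3, e]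
  have q3 : s * L2 ≤ C * (X * k ^ 2) := by
    have := mul_le_mul_of_nonneg_left ((le_abs_self _).trans hL2) hs.le
    rw [hXd]; linarith only [this]
  have q4 : 2 * s * Lμ ≤ 2 * (C * (X * k ^ 2)) := by
    have := mul_le_mul_of_nonneg_left ((le_abs_self _).trans hLμ) hs.le
    rw [hXd]; linarith only [this]
  have q5 : (2 * s * μ + A / 2) ^ 2 ≤ 8 * (C ^ 2 * (X ^ 2 * k ^ 2)) + A ^ 2 / 2 := by
    have h1 : (s * μ) ^ 2 ≤ (C * (X * k)) ^ 2 := by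
      apply sq_le_sq'
      · have := mul_le_mul_of_nonneg_left (abs_le.1 hμ).1 hs.le
        rw [hXd]; linarith only [this]
      · have := mul_le_mul_of_nonneg_left (abs_le.1 hμ).2 hs.le
        rw [hXd]; linarith only [this]
    linarith only [h1, sq_nonneg (2 * s * μ - A / 2)]
  have q6 : s ^ 2 * N ≤ C * (X ^ 2 * k) := by
    have := mul_le_mul_of_nonneg_left hN (sq_nonneg s)
    rw [hXd]; linarith only [this]
  have q6' : 2 * A * (s ^ 2 * N) ≤ 2 * A * (C * (X ^ 2 * k)) := mul_le_mul_of_nonneg_left q6 (by positivity)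
  have q7 : 3 * C * (X * k ^ 2) + 8 * (C ^ 2 * (X ^ 2 * k ^ 2)) ≤ 4 * (1 / 100) * (X ^ 3 * k ^ 2) := by
    have h1 : 3 * C * X + 8 * C ^ 2 * X ^ 2 ≤ (3 * C + 8 * C ^ 2) * X ^ 2 := by
      have : X ≤ X ^ 2 := by rw [sq]; exact le_mul_of_one_le_left X0.le hX1
      have := mul_le_mul_of_nonneg_left this (by positivity : 0 ≤ 3 * C)
      linarith only [this]
    have h2 : (3 * C + 8 * C ^ 2) * X ^ 2 ≤ (1 / 25 * X) * X ^ 2 :=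
      mul_le_mul_of_nonneg_right (by linarith) (by positivity)
    have h3 := mul_le_mul_of_nonneg_right (h1.trans h2) (sq_nonneg k)
    linarith only [h3]
  have q8 : 2 * A * σ * (a * ψ) ≤ a * ψ := by
    have : 2 * A * σ ≤ 1 := by
      have := mul_le_mul_of_nonneg_left hσ2 (by positivity : 0 ≤ 2 * A)
      linarith only [this, hτ1]
    exact mul_le_of_le_one_left haψ0 this
  linarith only [q1, q2, q3, q4, q5, q6', q7, q8, haψ]

theorem wgt_hyp {i0 : Fin n} {d : ℝ} {ψ μ : EE n → ℝ} (w : Wgt i0 d ψ μ) {A : ℝ} (hA : 8 ≤ A) :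
    ∃ C, 1 ≤ C ∧ ∀ τ > 0, 4 * A * τ ≤ 1 → A * C * τ ≤ 1 → ∀ δ > 0, ∃ a₀, ∀ a > 0, a₀ ≤ a → ∀ z : ZZ n, z.1 ≠ 0 →
      13 / 20 * ‖z.1‖ ≤ z.1 i0 → 0 < τ - z.2 → τ - z.2 ≤ 2 * τ → δ / 2 ≤ (τ - z.2) ^ 2 * ψ z.1 →
      ∀ φ F : SS n, (φ.1 =ᶠ[𝓝 z] fun z => a * (τ - z.2) ^ 2 * ψ z.1) →
      (F.1 =ᶠ[𝓝 z] fun z => 2 * (a * (τ - z.2) ^ 2) * μ z.1 + A / 2) →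
      (∀ ξ : Fin n → ℝ, A * ∑ i, ξ i ^ 2 ≤
      4 * (∑ j, ∑ i, (XX j (XX i φ)).1 z * ξ i * ξ j) + 2 * F.1 z * ∑ i, ξ i ^ 2) ∧
      A * (1 + ∑ i, (XX i φ).1 z ^ 2) ≤ (pot φ F).1 z := by
  obtain ⟨C1, c1, b1⟩ := w.Hψ.bound
  obtain ⟨C2, c2, b2⟩ := w.Hμ.bound
  obtain ⟨C3, c3, b3⟩ := w.Hψ.la.la.bound
  obtain ⟨C4, c4, b4⟩ := w.Hμ.la.bound
  obtain ⟨C5, c5, b5⟩ := (HH.sum fun i => (w.Hψ.dd i).mul (w.Hψ.dd i)).bound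
  refine ⟨1 + C1 + C2 + C3 + C4 + C5, by linarith, ?_⟩
  generalize hCd : 1 + C1 + C2 + C3 + C4 + C5 = C
  intro τ hτ hτ1 hτ2 δ hδ
  refine ⟨(2 * C + 2 * C * (25 * (3 * C + 8 * C ^ 2)) + 8 * τ ^ 2 * (A + A ^ 2 / 2)) / δ, fun a ha haa z hz hc hs hs2 hδψ φ F hφ hF => ?_⟩
  rw [div_le_iff₀ hδ] at haa
  have hC1 : 1 ≤ C := by linarith
  have X1 := sv_x (c := fun t => a * (τ - t) ^ 2) w.Hψ hz hφ
  have X2 := fun i => sv_x (c := fun t => a * (τ - t) ^ 2) (w.Hψ.dd i) hz (X1 i)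
  have T1 := sv_t (sσ a τ) hφ
  have T2 := (sv_t (sσ' a τ) T1).self_of_nhds
  have XT := fun i => (sv_x (c := fun t => -2 * a * (τ - t)) w.Hψ hz T1 i).self_of_nhds
  have L2 := (sv_l (c := fun t => a * (τ - t) ^ 2) w.Hψ.la hz (sv_l (c := fun t => a * (τ - t) ^ 2) w.Hψ hz hφ)).self_of_nhds
  have LF := (sv_lk (c := fun t => 2 * (a * (τ - t) ^ 2)) w.Hμ hz hF).self_of_nhds
  have x1 := fun i => (X1 i).self_of_nhds
  have x2 := fun i j => (X2 i j).self_of_nhds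
  have f0 := hF.self_of_nhds
  have t1 := T1.self_of_nhds
  simp only at T2 XT L2 LF x1 x2 f0 t1
  set σ := τ - z.2 with hσd
  have QQ1 : ∀ ξ : Fin n → ℝ, ∑ j, ∑ i, (XX j (XX i φ)).1 z * ξ i * ξ j =
      a * σ ^ 2 * ∑ j, ∑ i, dd j (dd i ψ) z.1 * ξ i * ξ j := fun ξ => by
    simp only [x2, Finset.mul_sum]
    exact Finset.sum_congr rfl fun j _ => Finset.sum_congr rfl fun i _ => by ring
  constructor
  · intro ξ
    have := w.quad z.1 hz hc ξ
    have := mul_nonneg (by positivity : 0 ≤ 4 * (a * σ ^ 2)) this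
    rw [QQ1, f0]
    linarith
  · have N1 : ∑ i, (XX i φ).1 z ^ 2 = (a * σ ^ 2) ^ 2 * ∑ i, dd i ψ z.1 ^ 2 := by
      simp only [x1, Finset.mul_sum]
      exact Finset.sum_congr rfl fun i _ => by ring
    have E1 : ∑ j, ∑ i, (XX j (XX i φ)).1 z * (XX i φ).1 z * (XX j φ).1 z =
        (a * σ ^ 2) ^ 3 * ∑ j, ∑ i, dd j (dd i ψ) z.1 * dd i ψ z.1 * dd j ψ z.1 := by
      simp only [x1, x2, Finset.mul_sum]
      exact Finset.sum_congr rfl fun j _ => Finset.sum_congr rfl fun i _ => by ring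
    have M1 : ∑ i, (XX i φ).1 z * (XX i (TT φ)).1 z = -(a * σ ^ 2 * (2 * a * σ) * ∑ i, dd i ψ z.1 ^ 2) := by
      simp only [x1, XT, Finset.mul_sum, ← Finset.sum_neg_distrib]
      exact Finset.sum_congr rfl fun i _ => by ring
    rw [pot_val, E1, M1, N1, T2, L2, t1, LF, f0]
    have hR := norm_pos_iff.2 hz
    have r2 : ∀ e : ℝ, ‖z.1‖ ^ (e - 2) = ‖z.1‖ ^ e * (‖z.1‖ ^ 2)⁻¹ := fun e => by
      rw [Real.rpow_sub hR, Real.rpow_two, div_eq_mul_inv]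
    have hY := Real.rpow_pos_of_pos hR d
    have hk : 0 < (‖z.1‖ ^ 2)⁻¹ := by positivity
    have d2 : ‖z.1‖ ^ (2 * d) = (‖z.1‖ ^ d) ^ 2 := by rw [mul_comm, Real.rpow_mul hR.le, Real.rpow_two]
    have d3 : ‖z.1‖ ^ (3 * d) = (‖z.1‖ ^ d) ^ 3 := by
      rw [mul_comm, Real.rpow_mul hR.le]; exact_mod_cast Real.rpow_natCast _ 3
    have g1 := b1 z.1 hz
    have g2 := b2 z.1 hz
    have g3 := b3 z.1 hz
    have g4 := b4 z.1 hz
    have g5 := b5 z.1 hz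
    have g6 := w.E z.1 hz hc
    have g7 := w.N z.1 hz hc
    rw [show 3 * d - 4 = 3 * d - 2 - 2 by ring, r2, r2, d3] at g6
    rw [r2, d2] at g7
    rw [show d - 1 + (d - 1) = 2 * d - 2 by ring, r2, d2] at g5
    rw [r2] at g2
    rw [r2, r2] at g3 g4
    simp only [← sq] at g5
    generalize ‖z.1‖ ^ d = Y at *
    generalize (‖z.1‖ ^ 2)⁻¹ = k at *
    have up : ∀ D y v : ℝ, 0 ≤ v → D ≤ C → y ≤ D * v → y ≤ C * v := fun D y v hv hD h =>
      h.trans (mul_le_mul_of_nonneg_right hD hv)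
    refine pot_alg (Y := Y) (k := k) (C := C) (δ := δ) hA hC1 hτ1 hτ2 ha ?_ ?_ ?_ hs hs2 hY hk hδψ
      (up C1 _ _ hY.le (by linarith) ((le_abs_self _).trans g1))
      (up C3 _ _ (by positivity) (by linarith) (by rw [sq, ← mul_assoc Y]; exact g3))
      (up C4 _ _ (by positivity) (by linarith) (by rw [sq, ← mul_assoc Y]; exact g4))
      (up C2 _ _ (by positivity) (by linarith) g2)
      (up C5 _ _ (by positivity) (by linarith) ((le_abs_self _).trans g5))
      (by rw [sq, ← mul_assoc]; simpa [mul_assoc] using g6) (by simpa [mul_assoc] using g7)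
    · have : 0 ≤ 2 * C * (25 * (3 * C + 8 * C ^ 2)) := by positivity
      have : 0 ≤ 8 * τ ^ 2 * (A + A ^ 2 / 2) := by positivity
      linarith
    · have : 0 ≤ 8 * τ ^ 2 * (A + A ^ 2 / 2) := by positivity
      linarith
    · have : 0 ≤ 2 * C * (25 * (3 * C + 8 * C ^ 2)) := by positivity
      linarith

end wv

section cutw
variable {n : ℕ}

theorem DD_congr {f g : SS n} {z : ZZ n} (h : f.1 =ᶠ[𝓝 z] g.1) (v : ZZ n) : (DD v f).1 =ᶠ[𝓝 z] (DD v g).1 := by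
  filter_upwards [h.fderiv (𝕜 := ℝ)] with y hy
  show fderiv ℝ f.1 y v = fderiv ℝ g.1 y v
  rw [hy]

theorem JJ_congr {f g : SS n} {z : ZZ n} (h : f.1 =ᶠ[𝓝 z] g.1) : JJ f z = JJ g z := by
  have h1 : ∀ v, (DD v f).1 z = (DD v g).1 z := fun v => (DD_congr h v).eq_of_nhds
  have h2 : (LL f).1 z = (LL g).1 z := by
    rw [LL_val, LL_val]
    exact Finset.sum_congr rfl fun i _ => (DD_congr (DD_congr h _) _).eq_of_nhds
  simp only [JJ, XX, TT, h1, h2]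

theorem DD_hd (U : SS n) (y v : ZZ n) : HasDerivAt (fun s : ℝ => U.1 (y + s • v)) ((DD v U).1 y) 0 :=
  ((scd U).differentiable (by simp) y).hasFDerivAt.hasLineDerivAt v

/-- composition with a step -/
noncomputable def tc {θ : ℝ → ℝ} {C : ℝ} (S : Stp θ C) (U : SS n) : SS n :=
  ⟨fun z => 1 - θ (U.1 z), contDiff_const.sub (S.cd.comp (scd U))⟩

variable {θ : ℝ → ℝ} {C : ℝ}

theorem tc_X (S : Stp θ C) (U : SS n) (v : ZZ n) :
    (DD v (tc S U)).1 = fun z => -(deriv θ (U.1 z) * (DD v U).1 z) := by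
  refine DD_glob fun y => ?_
  have h := DD_hd U y v
  have h2 := (S.hd (U.1 (y + (0 : ℝ) • v))).comp (0 : ℝ) h
  have h3 := h2.const_sub 1
  exact h3.congr_deriv (by simp)

theorem tc_XX (S : Stp θ C) (U : SS n) (v z : ZZ n) :
    (DD v (DD v (tc S U))).1 z =
      -(deriv (deriv θ) (U.1 z) * (DD v U).1 z ^ 2 + deriv θ (U.1 z) * (DD v (DD v U)).1 z) := by
  refine DD_line (EventuallyEq.of_eq (tc_X S U v)) ?_
  have h2 := (S.hd1 (U.1 (z + (0 : ℝ) • v))).comp (0 : ℝ) (DD_hd U z v)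
  have h3 := (h2.mul (DD_hd (DD v U) z v)).neg
  refine h3.congr_deriv ?_
  simp; ring

theorem JJ_prod (η H : SS n) (z : ZZ n) (h1 : |η.1 z| ≤ 1) (h2 : |H.1 z| ≤ 1) {s h l p : ℝ}
    (hs : ∑ i, (XX i η).1 z ^ 2 ≤ s) (hh : ∑ i, (XX i H).1 z ^ 2 ≤ h)
    (hl : |(LL η).1 z + (TT η).1 z| ≤ l) (hp : |(LL H).1 z + (TT H).1 z| ≤ p) :
    JJ (η * H) z ≤ 2 * (s + h) + (p + h + s + l) ^ 2 := by
  have a1 : ∑ i, (XX i (η * H)).1 z ^ 2 ≤ 2 * (s + h) := by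
    have e : ∀ i, (XX i (η * H)).1 z ^ 2 ≤ 2 * ((XX i η).1 z ^ 2 + (XX i H).1 z ^ 2) := fun i => by
      rw [show (XX i (η * H)).1 z = _ from XX_mul_val η H _ z]
      change (η.1 z * (XX i H).1 z + H.1 z * (XX i η).1 z) ^ 2 ≤ _
      have b1 : η.1 z ^ 2 ≤ 1 := by rw [sq_le_one_iff_abs_le_one]; exact h1
      have b2 : H.1 z ^ 2 ≤ 1 := by rw [sq_le_one_iff_abs_le_one]; exact h2
      have b3 := mul_le_mul_of_nonneg_right b1 (sq_nonneg ((XX i H).1 z))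
      have b4 := mul_le_mul_of_nonneg_right b2 (sq_nonneg ((XX i η).1 z))
      have b5 := sq_nonneg (η.1 z * (XX i H).1 z - H.1 z * (XX i η).1 z)
      linarith only [b3, b4, b5]
    refine (Finset.sum_le_sum fun i _ => e i).trans ?_
    rw [← Finset.mul_sum, Finset.sum_add_distrib]
    linarith only [hs, hh]
  have a2 : |2 * ∑ i, (XX i η).1 z * (XX i H).1 z| ≤ h + s := by
    have e : ∑ i, |2 * ((XX i η).1 z * (XX i H).1 z)| ≤ ∑ i, ((XX i η).1 z ^ 2 + (XX i H).1 z ^ 2) :=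
      Finset.sum_le_sum fun i _ => by
        rw [abs_le]; constructor
        · linarith only [sq_nonneg ((XX i η).1 z + (XX i H).1 z)]
        · linarith only [sq_nonneg ((XX i η).1 z - (XX i H).1 z)]
    rw [Finset.sum_add_distrib] at e
    rw [Finset.mul_sum]
    exact (Finset.abs_sum_le_sum_abs _ _).trans (by linarith only [e, hs, hh])
  have a3 : |(LL (η * H)).1 z + (TT (η * H)).1 z| ≤ p + h + s + l := by
    rw [LT_mul_val]
    refine (abs_add_three _ _ _).trans ?_
    have c1 : |η.1 z * ((LL H).1 z + (TT H).1 z)| ≤ p := by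
      rw [abs_mul]; exact (mul_le_of_le_one_left (abs_nonneg _) h1).trans hp
    have c2 : |H.1 z * ((LL η).1 z + (TT η).1 z)| ≤ l := by
      rw [abs_mul]; exact (mul_le_of_le_one_left (abs_nonneg _) h2).trans hl
    linarith only [c1, c2, a2]
  exact add_le_add a1 (by rw [← sq_abs]; exact pow_le_pow_left₀ (abs_nonneg _) a3 2)

theorem tc_bd (S : Stp θ C) (U : SS n) (z : ZZ n) {c : ℝ} (h1 : ∑ i, (XX i U).1 z ^ 2 ≤ c)
    (h2 : |(LL U).1 z| ≤ c) (h3 : |(TT U).1 z| ≤ c) {D : ℝ} (d1 : |deriv θ (U.1 z)| ≤ D)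
    (d2 : |deriv (deriv θ) (U.1 z)| ≤ D) :
    ∑ i, (XX i (tc S U)).1 z ^ 2 ≤ D ^ 2 * c ∧ |(LL (tc S U)).1 z + (TT (tc S U)).1 z| ≤ 3 * D * c := by
  have hD := (abs_nonneg _).trans d1
  have S0 : 0 ≤ ∑ i, (XX i U).1 z ^ 2 := Finset.sum_nonneg fun _ _ => sq_nonneg _
  constructor
  · have : ∑ i, (XX i (tc S U)).1 z ^ 2 = deriv θ (U.1 z) ^ 2 * ∑ i, (XX i U).1 z ^ 2 := by
      rw [Finset.mul_sum]
      refine Finset.sum_congr rfl fun i _ => ?_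
      rw [show (XX i (tc S U)).1 z = _ from congrFun (tc_X S U _) z]
      change (-(deriv θ (U.1 z) * (XX i U).1 z)) ^ 2 = _
      ring
    rw [this, ← sq_abs]
    gcongr
  · have e1 : (LL (tc S U)).1 z =
        -(deriv (deriv θ) (U.1 z) * (∑ i, (XX i U).1 z ^ 2) + deriv θ (U.1 z) * (LL U).1 z) := by
      rw [LL_val, LL_val, Finset.mul_sum, Finset.mul_sum, ← Finset.sum_add_distrib, ← Finset.sum_neg_distrib]
      exact Finset.sum_congr rfl fun i _ => tc_XX S U _ z
    have e2 : (TT (tc S U)).1 z = -(deriv θ (U.1 z) * (TT U).1 z) := congrFun (tc_X S U _) z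
    rw [e1, e2]
    have k1 : |deriv (deriv θ) (U.1 z) * (∑ i, (XX i U).1 z ^ 2)| ≤ D * c := by
      rw [abs_mul, abs_of_nonneg S0]; gcongr
    have k2 : |deriv θ (U.1 z) * (LL U).1 z| ≤ D * c := by rw [abs_mul]; gcongr
    have k3 : |deriv θ (U.1 z) * (TT U).1 z| ≤ D * c := by rw [abs_mul]; gcongr
    rw [abs_le] at *
    constructor <;> linarith only [k1.1, k1.2, k2.1, k2.2, k3.1, k3.2]

theorem rp_bd {r r₁ e : ℝ} (h0 : 0 < r₁) (h1 : r₁ ≤ 1) (hr : r₁ ≤ r) (e1 : -2 ≤ e) (e2 : e ≤ 2) :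
    r ^ e ≤ r₁⁻¹ ^ 2 * (1 + r ^ 2) := by
  have hr0 : 0 < r := h0.trans_le hr
  have k1 : 1 ≤ r₁⁻¹ := (one_le_inv₀ h0).2 h1
  have k2 : 1 ≤ r₁⁻¹ ^ 2 := one_le_pow₀ k1
  rcases le_total 1 r with h | h
  · have : r ^ e ≤ r ^ (2 : ℝ) := Real.rpow_le_rpow_of_exponent_le h e2
    rw [Real.rpow_two] at this
    have h5 := mul_le_mul_of_nonneg_right k2 (show 0 ≤ 1 + r ^ 2 by positivity)
    linarith only [this, h5]
  · have : r ^ e ≤ r ^ (-2 : ℝ) := Real.rpow_le_rpow_of_exponent_ge hr0 h e1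
    have h3 : r ^ (-2 : ℝ) = r⁻¹ ^ 2 := by
      rw [Real.rpow_neg hr0.le, Real.rpow_two, inv_pow]
    have h4 : r⁻¹ ^ 2 ≤ r₁⁻¹ ^ 2 := by gcongr
    have h5 : 0 ≤ r₁⁻¹ ^ 2 * r ^ 2 := by positivity
    linarith only [this, h3, h4, h5]

theorem sq_exp_bd (r : ℝ) : (1 + r ^ 2) ^ 2 ≤ 16 * Real.exp (r ^ 2 / 2) := by
  have h := Real.add_one_le_exp (r ^ 2 / 4)
  have h2 : 1 + r ^ 2 ≤ 4 * Real.exp (r ^ 2 / 4) := by linarith only [h, sq_nonneg r]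
  have h3 := pow_le_pow_left₀ (by positivity) h2 2
  rw [mul_pow, ← Real.exp_nat_mul] at h3
  refine h3.trans (le_of_eq ?_)
  congr 1
  · norm_num
  · congr 1; push_cast; ring
end cutw

section cutw2
variable {n : ℕ}

theorem wc_on {d : ℝ} {f : EE n → ℝ} (h : HH d f) (a τ k : ℝ) :
    ContDiffOn ℝ ∞ (fun z : ZZ n => a * (τ - z.2) ^ 2 * f z.1 + k) {z | z.1 ≠ 0} := by
  refine ContDiffOn.add (ContDiffOn.mul ?_ ?_) contDiffOn_const
  · exact (contDiff_const.mul ((contDiff_const.sub contDiff_snd).pow 2)).contDiffOn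
  · exact h.cd.comp contDiff_fst.contDiffOn fun z hz => hz

theorem cone_cl (i0 : Fin n) (c : ℝ) : IsClosed {x : EE n | c * ‖x‖ ≤ x i0} :=
  isClosed_le (continuous_const.mul continuous_norm) (EuclideanSpace.proj i0 : EE n →L[ℝ] ℝ).continuous

theorem cn_open (i0 : Fin n) (c : ℝ) : IsOpen (cn i0 c) :=
  isOpen_lt (continuous_const.mul continuous_norm) (EuclideanSpace.proj i0 : EE n →L[ℝ] ℝ).continuous

theorem Wgt.cut {i0 : Fin n} {d : ℝ} {ψ μ : EE n → ℝ} (w : Wgt i0 d ψ μ) {c₁ τ δ : ℝ}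
    (hc : 0 ≤ c₁) (hc1 : c₁ < 13 / 20) (hτ : 0 < τ) (hδ : 0 < δ) :
    ∃ r₁ B, 0 < r₁ ∧ 0 ≤ B ∧ ∀ R, 1 ≤ R → ∃ χ : SS n, HasCompactSupport χ.1 ∧
      (∀ z ∈ tsupport χ.1, 13 / 20 * ‖z.1‖ ≤ z.1 i0 ∧ r₁ ≤ ‖z.1‖ ∧ 0 < τ - z.2 ∧ τ - z.2 ≤ 2 * τ ∧
        δ / 2 ≤ (τ - z.2) ^ 2 * ψ z.1) ∧
      (∀ z : ZZ n, c₁ * ‖z.1‖ < z.1 i0 → ‖z.1‖ ^ 2 ≤ 3 / 4 * R ^ 2 → 0 ≤ z.2 → z.2 < τ →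
        δ ≤ (τ - z.2) ^ 2 * ψ z.1 → χ.1 z = 1) ∧
      ∀ z ∈ tsupport χ.1, 0 < z.2 → JJ χ z ≤ B * Real.exp (‖z.1‖ ^ 2 / 2) ∧
        (‖z.1‖ ^ 2 < 3 / 4 * R ^ 2 → δ < (τ - z.2) ^ 2 * ψ z.1 → JJ χ z = 0) := by
  obtain ⟨θ, C, S⟩ := stp_exists
  obtain ⟨C0, C00, hC0⟩ := w.Hψ.bound
  obtain ⟨C1, C10, hC1⟩ := (HH.sum fun i => (w.Hψ.dd i).mul (w.Hψ.dd i)).bound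
  obtain ⟨C2, C20, hC2⟩ := w.Hψ.la.bound
  have hd1 := w.hd1
  have hd2 := w.hd2
  set r₁ : ℝ := min 1 (δ / 2 / (4 * τ ^ 2 * (C0 + 1))) with hr₁
  have r0 : 0 < r₁ := lt_min one_pos (by positivity)
  have r1 : r₁ ≤ 1 := min_le_left _ _
  have rsm : ∀ x : EE n, x ≠ 0 → ‖x‖ < r₁ → 4 * τ ^ 2 * ψ x < δ / 2 := fun x hx hx2 => by
    have k1 : ‖x‖ ≤ 1 := hx2.le.trans r1
    have k2 : ‖x‖ ^ d ≤ ‖x‖ ^ (1 : ℝ) :=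
      Real.rpow_le_rpow_of_exponent_ge (norm_pos_iff.2 hx) k1 hd1.le
    rw [Real.rpow_one] at k2
    have k3 := lt_of_lt_of_le hx2 (min_le_right _ _)
    rw [lt_div_iff₀ (by positivity)] at k3
    have k4 : ψ x ≤ (C0 + 1) * ‖x‖ := (le_abs_self _).trans <| (hC0 x hx).trans <|
      mul_le_mul (by linarith) k2 (by positivity) (by positivity)
    have k5 := mul_le_mul_of_nonneg_left k4 (show 0 ≤ 4 * τ ^ 2 by positivity)
    linarith only [k3, k5]
  set q : ℝ := r₁⁻¹ ^ 2 with hq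
  set a : ℝ := 1 / δ with ha
  have a0 : 0 < a := by positivity
  have hq0 : 0 ≤ q := by positivity
  set c : ℝ := (a * τ ^ 2) ^ 2 * (C1 * q) + a * τ ^ 2 * (C2 * q) + 2 * a * τ * (C0 * q) with hcd
  have c0 : 0 ≤ c := by positivity
  have hC := S.C0
  set h₀ : ℝ := 4 * C ^ 2 with hh₀
  set p₀ : ℝ := 4 * C + 2 * n * C with hp₀
  have hh : 0 ≤ h₀ := by positivity
  have hp : 0 ≤ p₀ := by positivity
  refine ⟨r₁, (2 * (C ^ 2 * c + h₀) + (p₀ + h₀ + C ^ 2 * c + 3 * C * c) ^ 2) * 16, r0, by positivity,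
    fun R hR => ?_⟩
  have hR0 : 0 < R := by linarith
  have nz : ∀ x : EE n, r₁ ≤ ‖x‖ → x ≠ 0 := fun x hx h => by
    rw [h, norm_zero] at hx; linarith
  set K1 : Set (ZZ n) := ({x | 13 / 20 * ‖x‖ ≤ x i0} ∩ {x | r₁ ≤ ‖x‖} ∩ Metric.closedBall 0 R) ×ˢ Icc (-τ / 2) τ
    with hK1
  have K1c : IsCompact K1 :=
    (((isCompact_closedBall (0 : EE n) R).inter_left ((cone_cl i0 (13 / 20)).inter
      (isClosed_le continuous_const continuous_norm)))).prod isCompact_Icc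
  set V : ZZ n → ℝ := fun z => a * (τ - z.2) ^ 2 * ψ z.1 with hV
  have Vcd : ContDiffOn ℝ ∞ V {z | z.1 ≠ 0} := by simpa using wc_on w.Hψ a τ 0
  have K1n : K1 ⊆ {z : ZZ n | z.1 ≠ 0} := fun z hz => nz _ hz.1.1.2
  set K : Set (ZZ n) := K1 ∩ V ⁻¹' Ici (1 / 2) with hK
  have Kcl : IsClosed K := (Vcd.continuousOn.mono K1n).preimage_isClosed_of_isClosed K1c.isClosed isClosed_Ici
  have Kc : IsCompact K := K1c.of_isClosed_subset Kcl inter_subset_left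
  have VK : ∀ z, V z = (τ - z.2) ^ 2 * ψ z.1 / δ := fun z => by simp only [hV, ha]; ring
  set O : Set (ZZ n) := cn i0 c₁ ×ˢ Iio τ with hO
  have Oo : IsOpen O := (cn_open i0 c₁).prod isOpen_Iio
  have On : O ⊆ {z : ZZ n | z.1 ≠ 0} := fun z hz h => by
    have := hz.1
    change c₁ * ‖z.1‖ < z.1 i0 at this
    rw [h] at this; simp at this
  have KO : K ⊆ O := fun z hz => by
    obtain ⟨⟨⟨⟨b1, b2⟩, b3⟩, b4⟩, b5⟩ := hz
    change 1 / 2 ≤ V z at b5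
    refine ⟨lt_of_lt_of_le (mul_lt_mul_of_pos_right hc1 (r0.trans_le b2)) b1, lt_of_le_of_ne b4.2 fun h => ?_⟩
    rw [VK, h] at b5; norm_num at b5
  set ζ : ℝ → ℝ := fun t => θ (-2 * t / τ) with hζ
  have ζcd : ContDiff ℝ ∞ ζ := S.cd.comp ((contDiff_const.mul contDiff_id).div_const _)
  obtain ⟨H, H1, H2, H3, H4, H5⟩ := radcut (n := n) S ζcd 0 hR
  simp only [sub_zero] at H1 H4 H5
  obtain ⟨P, P1, P2, P3, P4, P5⟩ := bump_cpt Kc Oo KO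
  have χcd : ContDiff ℝ ∞ fun z => P z * ((1 - θ (V z)) * H.1 z) :=
    glue Oo P1 P3 ((contDiffOn_const.sub (S.cd.comp_contDiffOn (Vcd.mono On))).mul (scd H).contDiffOn)
  have mK : ∀ z ∈ O, (1 - θ (V z)) * H.1 z ≠ 0 → z ∈ K := fun z hz hne => by
    have e1 := left_ne_zero_of_mul hne
    have e2 := right_ne_zero_of_mul hne
    rw [H1] at e2
    have e3 := left_ne_zero_of_mul e2
    have e4 := right_ne_zero_of_mul e2
    have f1 : 3 / 4 < V z := not_le.1 fun h => e1 (by rw [S.one _ h, sub_self])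
    have f2 : ‖z.1‖ ^ 2 / R ^ 2 < 1 := not_le.1 fun h => e3 (S.zero _ h)
    have f3 : -2 * z.2 / τ < 1 := not_le.1 fun h => e4 (S.zero _ h)
    rw [div_lt_one (by positivity)] at f2 f3
    have f4 : ‖z.1‖ < R := lt_of_pow_lt_pow_left₀ 2 hR0.le f2
    have f5 : 3 / 4 * δ < (τ - z.2) ^ 2 * ψ z.1 := by rw [VK, lt_div_iff₀ hδ] at f1; exact f1
    have zn := On hz
    have ψp : 0 < ψ z.1 := by
      by_contra h
      have := mul_nonneg_of_nonpos_of_nonpos (neg_nonpos.2 (sq_nonneg (τ - z.2))) (not_lt.1 h)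
      linarith only [this, f5, hδ]
    have g1 : c₁ * ‖z.1‖ < z.1 i0 := hz.1
    have g2 : z.2 < τ := hz.2
    have g3 := w.pos _ zn ψp (lt_of_le_of_lt (by positivity) g1)
    have g4 : (τ - z.2) ^ 2 ≤ 4 * τ ^ 2 := by
      have : (τ - z.2) ^ 2 ≤ (2 * τ) ^ 2 := pow_le_pow_left₀ (by linarith) (by linarith) 2
      linarith only [this]
    have g5 := mul_le_mul_of_nonneg_right g4 ψp.le
    refine ⟨⟨⟨⟨g3.le, ?_⟩, ?_⟩, ?_, g2.le⟩, ?_⟩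
    · by_contra h
      have := rsm _ zn (not_le.1 h)
      linarith only [this, g5, f5, hδ]
    · rw [mem_closedBall_zero_iff]; exact f4.le
    · linarith only [f3]
    · change 1 / 2 ≤ V z
      linarith only [f1]
  let χ : SS n := ⟨fun z => P z * ((1 - θ (V z)) * H.1 z), χcd⟩
  have χsup : tsupport χ.1 ⊆ K := closure_minimal (fun z hz => by
    have hz : P z * ((1 - θ (V z)) * H.1 z) ≠ 0 := hz
    exact mK z (P3 (subset_tsupport _ (left_ne_zero_of_mul hz))) (right_ne_zero_of_mul hz)) Kcl
  obtain ⟨U, hU⟩ := SS_ext Oo (Vcd.mono On) Kc KO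
  refine ⟨χ, Kc.of_isClosed_subset (isClosed_tsupport _) χsup, fun z hz => ?_, fun z z1 z2 z3 z4 z5 => ?_,
    fun z hz ht => ?_⟩
  · have hz := χsup hz
    have hzO : z.2 < τ := (KO hz).2
    obtain ⟨⟨⟨⟨b1, b2⟩, b3⟩, b4⟩, b5⟩ := hz
    change 1 / 2 ≤ V z at b5
    rw [VK, le_div_iff₀ hδ] at b5
    exact ⟨b1, b2, by linarith, by linarith [b4.1], by linarith only [b5]⟩
  · have v1 : 1 ≤ V z := by rw [VK, le_div_iff₀ hδ]; linarith only [z5]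
    have e : (1 - θ (V z)) * H.1 z = 1 := by
      rw [S.zero _ v1, H1, S.one, hζ, sub_zero, one_mul, one_mul]
      · refine S.one _ ?_
        have : -2 * z.2 / τ ≤ 0 := div_nonpos_of_nonpos_of_nonneg (by linarith) hτ.le
        linarith
      · rw [div_le_iff₀ (by positivity)]; exact z2
    have zK := mK z ⟨z1, z4⟩ (by rw [e]; exact one_ne_zero)
    change P z * ((1 - θ (V z)) * H.1 z) = 1
    rw [e, (P4.filter_mono (nhds_le_nhdsSet zK)).self_of_nhds, one_mul]
  · have zK := χsup hz
    have zn := On (KO zK)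
    have zO : z.2 < τ := (KO zK).2
    have zr : r₁ ≤ ‖z.1‖ := zK.1.1.1.2
    have germ : χ.1 =ᶠ[𝓝 z] (tc S U * H).1 := by
      filter_upwards [P4.filter_mono (nhds_le_nhdsSet zK), hU z zK] with y y1 y2
      change P y * ((1 - θ (V y)) * H.1 y) = (1 - θ (U.1 y)) * H.1 y
      rw [y1, y2, one_mul]
    have Uz : U.1 z = V z := (hU z zK).eq_of_nhds
    have x1 := fun i => (sv_x (c := fun t => a * (τ - t) ^ 2) w.Hψ zn (hU z zK) i).eq_of_nhds
    have x2 := (sv_l (c := fun t => a * (τ - t) ^ 2) w.Hψ zn (hU z zK)).eq_of_nhds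
    have x3 := (sv_t (c := fun t => a * (τ - t) ^ 2) (sσ a τ) (hU z zK)).eq_of_nhds
    set E : ℝ := 1 + ‖z.1‖ ^ 2 with hE
    have E1 : 1 ≤ E := by rw [hE]; linarith [sq_nonneg ‖z.1‖]
    have E0 : 0 ≤ E := by linarith
    have s0 : 0 ≤ τ - z.2 := by linarith
    have s1 : τ - z.2 ≤ τ := by linarith
    have s2 : (τ - z.2) ^ 2 ≤ τ ^ 2 := pow_le_pow_left₀ s0 s1 2
    have as2 : a * (τ - z.2) ^ 2 ≤ a * τ ^ 2 := by gcongr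
    have as0 : 0 ≤ a * (τ - z.2) ^ 2 := by positivity
    have bd : ∀ {e k f : ℝ}, 0 ≤ k → -2 ≤ e → e ≤ 2 → |f| ≤ k * ‖z.1‖ ^ e → |f| ≤ k * q * E :=
      fun hk h1 h2 h3 => h3.trans (by
        rw [mul_assoc]; exact mul_le_mul_of_nonneg_left (rp_bd r0 r1 zr h1 h2) hk)
    have t1 : 0 ≤ (a * τ ^ 2) ^ 2 * (C1 * q) * E := by positivity
    have t2 : 0 ≤ a * τ ^ 2 * (C2 * q) * E := by positivity
    have t3 : 0 ≤ 2 * a * τ * (C0 * q) * E := by positivity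
    have b1 : ∑ i, (XX i U).1 z ^ 2 ≤ c * E := by
      have e : ∑ i, (XX i U).1 z ^ 2 = (a * (τ - z.2) ^ 2) ^ 2 * ∑ i, dd i ψ z.1 * dd i ψ z.1 := by
        rw [Finset.mul_sum]; exact Finset.sum_congr rfl fun i _ => by rw [x1 i]; ring
      have k1 := (le_abs_self _).trans (bd C10 (by linarith) (by linarith) (hC1 z.1 zn))
      have k2 : (a * (τ - z.2) ^ 2) ^ 2 * ∑ i, dd i ψ z.1 * dd i ψ z.1 ≤ (a * τ ^ 2) ^ 2 * (C1 * q * E) :=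
        mul_le_mul (pow_le_pow_left₀ as0 as2 2) k1 (Finset.sum_nonneg fun _ _ => mul_self_nonneg _) (by positivity)
      rw [e, hcd]; linarith only [k2, t2, t3]
    have b2 : |(LL U).1 z| ≤ c * E := by
      rw [x2, abs_mul, abs_of_nonneg as0]
      have k2 := mul_le_mul as2 (bd C20 (by linarith) (by linarith) (hC2 z.1 zn)) (abs_nonneg _) (by positivity)
      rw [hcd]; linarith only [k2, t1, t3]
    have b3 : |(TT U).1 z| ≤ c * E := by
      rw [x3, abs_mul, abs_mul, abs_of_nonneg s0, show |-2 * a| = 2 * a by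
        rw [abs_mul, abs_neg, abs_two, abs_of_pos a0]]
      have k2 := mul_le_mul (mul_le_mul_of_nonneg_left s1 (show 0 ≤ 2 * a by positivity))
        (bd C00 (by linarith) (by linarith) (hC0 z.1 zn)) (abs_nonneg _) (by positivity)
      rw [hcd]; linarith only [k2, t1, t2]
    have ab : ∀ r, |1 - θ r| ≤ 1 := fun r => by
      rw [abs_le]; constructor <;> linarith [(S.mem r).1, (S.mem r).2]
    have ab2 : ∀ r, |θ r| ≤ 1 := fun r => by
      rw [abs_le]; constructor <;> linarith [(S.mem r).1, (S.mem r).2]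
    have Hb : |H.1 z| ≤ 1 := by
      rw [H1, abs_mul]; exact mul_le_one₀ (ab2 _) (abs_nonneg _) (ab2 _)
    have ζd : deriv ζ z.2 = 0 := by
      have lin : HasDerivAt (fun t : ℝ => -2 * t / τ) (-2 * 1 / τ) z.2 := ((hasDerivAt_id _).const_mul _).div_const _
      have h := ((S.hd (-2 * z.2 / τ)).comp z.2 lin).deriv
      refine h.trans ?_
      have : -2 * z.2 / τ < 3 / 4 := lt_of_le_of_lt
        (div_nonpos_of_nonpos_of_nonneg (by linarith) hτ.le) (by norm_num)
      rw [(S.lo this).1, zero_mul]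
    have Ht : (TT H).1 z = 0 := by rw [H4, ζd, mul_zero]
    rw [JJ_congr germ]
    constructor
    · obtain ⟨m1, m2⟩ := tc_bd S U z b1 b2 b3 (S.d1 _) (S.d2 _)
      have m3 : ∑ i, (XX i H).1 z ^ 2 ≤ h₀ := (H2 z).trans
        (mul_le_of_le_one_right hh (by rw [sq_le_one_iff_abs_le_one]; exact ab2 _))
      have m4 : |(LL H).1 z + (TT H).1 z| ≤ p₀ := by
        rw [Ht, add_zero]; exact (H3 z).trans (mul_le_of_le_one_right hp (ab2 _))
      refine (JJ_prod (tc S U) H z (ab _) Hb m1 m3 m2 m4).trans ?_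
      have n1 : 2 * (C ^ 2 * (c * E) + h₀) ≤ 2 * (C ^ 2 * c + h₀) * E ^ 2 := by
        have o1 : E ≤ E ^ 2 := by rw [sq]; exact le_mul_of_one_le_left E0 E1
        have o2 := mul_le_mul_of_nonneg_left o1 (show 0 ≤ C ^ 2 * c by positivity)
        have o3 := mul_le_mul_of_nonneg_left (E1.trans o1) hh
        linarith only [o2, o3]
      have n2 : p₀ + h₀ + C ^ 2 * (c * E) + 3 * C * (c * E) ≤ (p₀ + h₀ + C ^ 2 * c + 3 * C * c) * E := by
        have o3 := mul_le_mul_of_nonneg_left E1 (add_nonneg hp hh)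
        linarith only [o3]
      have n3 := pow_le_pow_left₀ (by positivity) n2 2
      rw [mul_pow] at n3
      have n4 := mul_le_mul_of_nonneg_left (sq_exp_bd ‖z.1‖)
        (show 0 ≤ 2 * (C ^ 2 * c + h₀) + (p₀ + h₀ + C ^ 2 * c + 3 * C * c) ^ 2 by positivity)
      rw [← hE] at n4
      linarith only [n1, n3, n4]
    · intro y1 y2
      have v1 : 1 < U.1 z := by rw [Uz, VK, lt_div_iff₀ hδ]; linarith only [y2]
      obtain ⟨m1, m2⟩ := tc_bd S U z b1 b2 b3 (D := 0) (by rw [(S.hi v1).1, abs_zero]) (by rw [(S.hi v1).2, abs_zero])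
      obtain ⟨w1, w2⟩ := H5 z (by rw [div_lt_iff₀ (by positivity)]; exact y1)
      have := JJ_prod (tc S U) H z (ab _) Hb (h := 0) (p := 0) m1 (by simp [w1]) m2 (by simp [w2, Ht])
      refine le_antisymm (this.trans (le_of_eq (by ring))) (JJ_nonneg _ _)
end cutw2

section core
variable {n : ℕ}

theorem sub_quad {k d : ℝ} (hk : 0 ≤ k) (h1 : 0 < d) (h2 : d < 2) : ∃ D, ∀ r, 0 < r → k * r ^ d ≤ r ^ 2 / 2 + D := by
  have t := (tendsto_rpow_neg_atTop (show 0 < 2 - d by linarith)).const_mul k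
  rw [mul_zero] at t
  obtain ⟨L, hL⟩ := ((t.eventually (gt_mem_nhds (show (0 : ℝ) < 1 / 2 by norm_num))).and
    (eventually_ge_atTop 1)).exists_forall_of_atTop
  refine ⟨k * |L| ^ d, fun r hr => ?_⟩
  have h0 : 0 ≤ k * |L| ^ d := by positivity
  rcases le_total L r with h | h
  · have h3 := mul_le_mul_of_nonneg_right (hL r h).1.le (sq_nonneg r)
    have e : r ^ (-(2 - d)) * r ^ 2 = r ^ d := by
      rw [← Real.rpow_two, ← Real.rpow_add hr]; congr 1; ring
    rw [mul_assoc, e] at h3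
    linarith only [h3, h0]
  · have h3 : k * r ^ d ≤ k * |L| ^ d :=
      mul_le_mul_of_nonneg_left (Real.rpow_le_rpow hr.le (h.trans (le_abs_self _)) h1.le) hk
    linarith only [h3, sq_nonneg r]

theorem zero_of_exp {Q δ K a₀ : ℝ} (hQ : 0 ≤ Q) (hδ : 0 < δ)
    (h : ∀ a, 0 < a → a₀ ≤ a → Real.exp (2 * a * δ) ^ 2 * Q ≤ Real.exp (a * δ) ^ 2 * K) : Q = 0 := by
  by_contra hne
  have hQ' : 0 < Q := lt_of_le_of_ne hQ (Ne.symm hne)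
  set a := max (max a₀ 1) (K / (2 * δ * Q)) with ha
  have a1 : 0 < a := lt_of_lt_of_le one_pos ((le_max_right _ _).trans (le_max_left _ _))
  have h1 := h a a1 ((le_max_left _ _).trans (le_max_left _ _))
  have e : Real.exp (2 * a * δ) = Real.exp (a * δ) ^ 2 := by
    rw [← Real.exp_nat_mul]; congr 1; push_cast; ring
  have h2 : Real.exp (2 * a * δ) * Q ≤ K := by
    refine le_of_mul_le_mul_left ?_ (show 0 < Real.exp (a * δ) ^ 2 by positivity)
    refine le_trans (le_of_eq ?_) h1
    rw [e]; ring
  have h3 := mul_le_mul_of_nonneg_right (Real.add_one_le_exp (2 * a * δ)) hQ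
  have h4 : K / (2 * δ * Q) ≤ a := le_max_right _ _
  rw [div_le_iff₀ (by positivity)] at h4
  linarith only [h2, h3, h4, hQ']

theorem core {i0 : Fin n} {c₁ M M' T : ℝ} (hc : 0 ≤ c₁) (hc1 : c₁ < 13 / 20) (hM : 0 ≤ M) (hM' : 0 ≤ M')
    (hT : 0 < T) : ∃ τ, 0 < τ ∧ ∀ (u : ZZ n → ℝ) (C' : ℝ), 0 ≤ C' → Sol (cn i0 c₁) T M u →
      (∀ x ∈ cn i0 c₁, ∀ t < T, |u (x, t)| ≤ C' * Real.exp (M' * ‖x‖ ^ 2)) →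
      ∀ x : EE n, 9 / 10 * ‖x‖ < x i0 → ∀ t ∈ Ioo 0 τ, u (x, t) = 0 := by
  obtain ⟨ψ, μ, w⟩ := wgt_exists i0
  set A : ℝ := 48 * M ^ 2 + 8 with hA
  have A8 : 8 ≤ A := by rw [hA]; linarith [sq_nonneg M]
  obtain ⟨C, C1, hyp⟩ := wgt_hyp w A8
  obtain ⟨C0, C00, hC0⟩ := w.Hψ.bound
  set τ : ℝ := min (min (1 / (8 * A)) (1 / (A * C))) (min (T / 6) (((13 / 20 - c₁) / 8) ^ 2 / (64 * (32 * M' + 12))))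
    with hτd
  have hcc : 0 < 13 / 20 - c₁ := by linarith
  have hτ : 0 < τ := lt_min (lt_min (by positivity) (by positivity)) (lt_min (by positivity) (by positivity))
  have τ1 : τ ≤ 1 / (8 * A) := (min_le_left _ _).trans (min_le_left _ _)
  have τ2 : τ ≤ 1 / (A * C) := (min_le_left _ _).trans (min_le_right _ _)
  have τ3 : τ ≤ T / 6 := (min_le_right _ _).trans (min_le_left _ _)
  have τ4 : τ ≤ ((13 / 20 - c₁) / 8) ^ 2 / (64 * (32 * M' + 12)) := (min_le_right _ _).trans (min_le_right _ _)
  clear_value τ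
  have τ5 : τ < T := by linarith only [τ3, hT, hτ]
  have g1 : 4 * A * τ ≤ 1 := by
    rw [le_div_iff₀ (by positivity)] at τ1
    have := mul_pos (show 0 < A by linarith) hτ
    linarith only [τ1, this]
  have g2 : A * C * τ ≤ 1 := by rw [le_div_iff₀ (by positivity)] at τ2; linarith only [τ2]
  refine ⟨τ, hτ, fun u C' hC' h hu x hx t ht => ?_⟩
  have nz9 : ∀ y : EE n, 9 / 10 * ‖y‖ < y i0 → y ≠ 0 := fun y hy h0 => by
    rw [h0] at hy; simp at hy
  have hxn := nz9 x hx
  have ψx := w.big x hxn hx.le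
  have σ0 : 0 < τ - t := by linarith [ht.2]
  set δ : ℝ := (τ - t) ^ 2 * ψ x / 3 with hδd
  have hδ : 0 < δ := by positivity
  obtain ⟨r₁, B, r0, B0, cut⟩ := w.cut hc hc1 hτ hδ
  have I := decay_glob hc hc1 (by norm_num) hM' hM hτ τ1 (by linarith) τ4 hC' h hu r0
  obtain ⟨a₀, hyp⟩ := hyp τ hτ g1 g2 δ hδ
  set G : ZZ n → ℝ := fun z => Real.exp (‖z.1‖ ^ 2) * QQ u z with hG
  have G0 : ∀ z, 0 ≤ G z := fun z => mul_nonneg (Real.exp_pos _).le (QQ_nonneg u z)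
  set Sr : Set (ZZ n) := {x : EE n | 13 / 20 * ‖x‖ ≤ x i0 ∧ r₁ ≤ ‖x‖} ×ˢ Icc 0 τ with hSr
  have Srm : MeasurableSet Sr := (((cone_cl i0 (13 / 20)).inter
    (isClosed_le continuous_const continuous_norm)).prod isClosed_Icc).measurableSet
  -- neighbourhood
  set V : ZZ n → ℝ := fun z => (τ - z.2) ^ 2 * ψ z.1 with hV
  have Vc : ContinuousOn V {z | z.1 ≠ 0} := by simpa using (wc_on w.Hψ 1 τ 0).continuousOn
  set O : Set (ZZ n) := cn i0 (9 / 10) ×ˢ Ioo 0 τ with hO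
  have Oo : IsOpen O := (cn_open i0 _).prod isOpen_Ioo
  have On : O ⊆ {z : ZZ n | z.1 ≠ 0} := fun z hz => nz9 z.1 hz.1
  have No : IsOpen (O ∩ V ⁻¹' Ioi (2 * δ)) := (Vc.mono On).isOpen_inter_preimage Oo isOpen_Ioi
  have Nm : ((x, t) : ZZ n) ∈ O ∩ V ⁻¹' Ioi (2 * δ) := by
    refine ⟨⟨hx, ht⟩, ?_⟩
    change 2 * δ < (τ - t) ^ 2 * ψ x
    have : (τ - t) ^ 2 * ψ x = 3 * δ := by rw [hδd]; ring
    linarith only [this, hδ]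
  obtain ⟨ρ, ρ0, hρ⟩ := Metric.nhds_basis_closedBall.mem_iff.1 (No.mem_nhds Nm)
  set K0 := Metric.closedBall ((x, t) : ZZ n) ρ with hK0
  have K0c : IsCompact K0 := isCompact_closedBall _ _
  have c9 : ∀ y ∈ cn i0 (9 / 10), y ∈ cn i0 c₁ := fun y hy =>
    lt_of_le_of_lt (mul_le_mul_of_nonneg_right (by linarith) (norm_nonneg y)) hy
  have K0s : K0 ⊆ cn i0 c₁ ×ˢ Iio T := fun z hz =>
    ⟨c9 _ (hρ hz).1.1, (hρ hz).1.2.2.trans τ5⟩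
  have QI := (QQ_int h K0c K0s).1
  obtain ⟨R₀, hR₀⟩ := K0c.exists_bound_of_continuousOn (f := fun z : ZZ n => z.1) continuous_fst.continuousOn
  have key : ∀ a, 0 < a → a₀ ≤ a → Real.exp (2 * a * δ) ^ 2 * (∫ z in K0, QQ u z) ≤
      Real.exp (a * δ) ^ 2 * (16 * B * ∫ z in Sr, G z) := fun a a0 ha => by
    obtain ⟨D, hD⟩ := sub_quad (k := 2 * (a * τ ^ 2 * C0)) (by positivity)
      (show (0 : ℝ) < 999 / 500 by norm_num) (by norm_num)
    set s : ℕ → Set (ZZ n) := fun k => Sr ∩ {z | 3 / 4 * (k : ℝ) ^ 2 ≤ ‖z.1‖ ^ 2} with hs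
    have sm : ∀ k, MeasurableSet (s k) := fun k => Srm.inter
      (isClosed_le continuous_const ((continuous_norm.comp continuous_fst).pow 2)).measurableSet
    have tl := tendsto_setIntegral_of_antitone (μ := volume) (f := G) sm (fun k l hkl z hz => ⟨hz.1, by
        have h1 : (k : ℝ) ≤ l := by exact_mod_cast hkl
        have h2 := pow_le_pow_left₀ (Nat.cast_nonneg k) h1 2
        have h3 : 3 / 4 * (l : ℝ) ^ 2 ≤ ‖z.1‖ ^ 2 := hz.2
        change 3 / 4 * (k : ℝ) ^ 2 ≤ ‖z.1‖ ^ 2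
        linarith only [h2, h3]⟩) ⟨0, I.mono_set inter_subset_left⟩
    have emp : ⋂ k, s k = ∅ := by
      rw [eq_empty_iff_forall_notMem]
      intro z hz
      rw [mem_iInter] at hz
      obtain ⟨k, hk⟩ := exists_nat_gt (2 * ‖z.1‖ + 1)
      have h1 : 3 / 4 * (k : ℝ) ^ 2 ≤ ‖z.1‖ ^ 2 := (hz k).2
      have h2 := pow_le_pow_left₀ (by positivity) hk.le 2
      linarith only [h1, h2, norm_nonneg z.1, sq_nonneg ‖z.1‖]
    rw [emp, setIntegral_empty] at tl
    have tl2 := ((tl.const_mul (B * Real.exp D)).const_add (B * Real.exp (a * δ) ^ 2 * ∫ z in Sr, G z)).const_mul 16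
    have main : ∀ᶠ k : ℕ in atTop, Real.exp (2 * a * δ) ^ 2 * (∫ z in K0, QQ u z) ≤
        16 * (B * Real.exp (a * δ) ^ 2 * (∫ z in Sr, G z) + B * Real.exp D * ∫ z in s k, G z) := by
      filter_upwards [eventually_ge_atTop (⌈2 * |R₀| + 1⌉₊)] with k hk
      have hk : 2 * |R₀| + 1 ≤ k := Nat.ceil_le.1 hk
      have k1 : (1 : ℝ) ≤ k := by linarith only [hk, abs_nonneg R₀]
      obtain ⟨χ, χ1, χ2, χ3, χ4⟩ := cut k k1
      set W : ZZ n → ℝ := fun z => B * Real.exp (a * δ) ^ 2 * Sr.indicator G z + B * Real.exp D * (s k).indicator G z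
        with hW
      have i1 : Integrable (Sr.indicator G) := (integrable_indicator_iff Srm).2 I
      have i2 : Integrable ((s k).indicator G) := (integrable_indicator_iff (sm k)).2 (I.mono_set inter_subset_left)
      have n1 : ∀ z, 0 ≤ B * Real.exp (a * δ) ^ 2 * Sr.indicator G z := fun z =>
        mul_nonneg (by positivity) (indicator_nonneg (fun z _ => G0 z) z)
      have n2 : ∀ z, 0 ≤ B * Real.exp D * (s k).indicator G z := fun z =>
        mul_nonneg (by positivity) (indicator_nonneg (fun z _ => G0 z) z)
      have nz : ∀ z ∈ tsupport χ.1, z.1 ≠ 0 := fun z hz h0 => by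
        have := (χ2 z hz).2.1
        rw [h0, norm_zero] at this; linarith only [this, r0]
      have cK := carlK h χ χ1 (φ := fun z => a * (τ - z.2) ^ 2 * ψ z.1)
        (F := fun z => 2 * (a * (τ - z.2) ^ 2) * μ z.1 + A / 2) (O := {z | z.1 ≠ 0})
        (fun z hz => by
          obtain ⟨y1, y2, y3, y4, y5⟩ := χ2 z hz
          refine ⟨lt_of_lt_of_le (mul_lt_mul_of_pos_right hc1 (r0.trans_le y2)) y1, ?_⟩
          change z.2 < T
          linarith only [y3, τ5])
        nz_open nz (by simpa using wc_on w.Hψ a τ 0)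
        ((wc_on w.Hμ (2 * a) τ (A / 2)).congr fun z _ => by ring) (le_of_eq hA.symm)
        (fun z hz φ' F' hφ hF => by
          obtain ⟨y1, y2, y3, y4, y5⟩ := χ2 z hz
          exact hyp a a0 ha z (nz z hz) y1 y3 y4 y5 φ' F' hφ hF)
        K0c.measurableSet (b := 2 * a * δ)
        (fun z hz => by
          obtain ⟨⟨y1, y2⟩, y3⟩ := hρ hz
          have y3 : 2 * δ < (τ - z.2) ^ 2 * ψ z.1 := y3
          refine ⟨χ3 z (c9 _ y1) ?_ y2.1.le y2.2 (by linarith only [y3, hδ]), ?_⟩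
          · have h1 := (hR₀ z hz).trans (le_abs_self R₀)
            have h2 := pow_le_pow_left₀ (norm_nonneg _) h1 2
            have h3 := pow_le_pow_left₀ (by positivity) hk 2
            linarith only [h2, h3, abs_nonneg R₀, sq_nonneg |R₀|]
          · have := mul_le_mul_of_nonneg_left y3.le a0.le
            linarith only [this])
        (W := W) ((i1.const_mul _).add (i2.const_mul _)) (fun z => add_nonneg (n1 z) (n2 z))
        (fun z hz hz0 => by
          obtain ⟨y1, y2, y3, y4, y5⟩ := χ2 z hz
          obtain ⟨j1, j2⟩ := χ4 z hz hz0
          have zS : z ∈ Sr := ⟨⟨y1, y2⟩, hz0.le, by linarith only [y3]⟩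
          have q0 := QQ_nonneg u z
          have ee : Real.exp (‖z.1‖ ^ 2) = Real.exp (‖z.1‖ ^ 2 / 2) * Real.exp (‖z.1‖ ^ 2 / 2) := by
            rw [← Real.exp_add]; congr 1; ring
          have e1 : 1 ≤ Real.exp (‖z.1‖ ^ 2 / 2) := Real.one_le_exp (by positivity)
          rcases lt_or_ge (‖z.1‖ ^ 2) (3 / 4 * (k : ℝ) ^ 2) with hr | hr
          · refine le_trans ?_ (le_add_of_nonneg_right (n2 z))
            rcases lt_or_ge δ ((τ - z.2) ^ 2 * ψ z.1) with hl | hl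
            · rw [j2 hr hl, mul_zero, zero_mul]; exact n1 z
            · rw [indicator_of_mem zS]
              have p1 : Real.exp (a * (τ - z.2) ^ 2 * ψ z.1) ≤ Real.exp (a * δ) := by
                rw [Real.exp_le_exp, mul_assoc]; exact mul_le_mul_of_nonneg_left hl a0.le
              have p2 : B * Real.exp (‖z.1‖ ^ 2 / 2) ≤ B * Real.exp (‖z.1‖ ^ 2) := by
                rw [ee]; exact mul_le_mul_of_nonneg_left (le_mul_of_one_le_left (by positivity) e1) B0
              have p3 := mul_le_mul (pow_le_pow_left₀ (Real.exp_pos _).le p1 2) (j1.trans p2) (JJ_nonneg _ _)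
                (by positivity)
              refine (mul_le_mul_of_nonneg_right p3 q0).trans (le_of_eq ?_)
              simp only [hG]; ring
          · refine le_trans ?_ (le_add_of_nonneg_left (n1 z))
            rw [indicator_of_mem (show z ∈ s k from ⟨zS, hr⟩)]
            have p0 : a * (τ - z.2) ^ 2 * ψ z.1 ≤ a * τ ^ 2 * C0 * ‖z.1‖ ^ (999 / 500 : ℝ) := by
              have s2 : (τ - z.2) ^ 2 ≤ τ ^ 2 := pow_le_pow_left₀ y3.le (by linarith only [hz0]) 2
              have s3 := mul_le_mul (mul_le_mul_of_nonneg_left s2 a0.le) (hC0 z.1 (nz z hz)) (abs_nonneg _)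
                (by positivity)
              have s4 := mul_le_mul_of_nonneg_left (le_abs_self (ψ z.1))
                (show 0 ≤ a * (τ - z.2) ^ 2 by positivity)
              linarith only [s3, s4]
            have p1 : Real.exp (a * (τ - z.2) ^ 2 * ψ z.1) ^ 2 ≤ Real.exp D * Real.exp (‖z.1‖ ^ 2 / 2) := by
              rw [← Real.exp_nat_mul, ← Real.exp_add, Real.exp_le_exp]
              have := hD ‖z.1‖ (r0.trans_le y2)
              push_cast
              linarith only [this, p0]
            have p3 := mul_le_mul p1 j1 (JJ_nonneg _ _) (by positivity)
            refine (mul_le_mul_of_nonneg_right p3 q0).trans (le_of_eq ?_)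
            simp only [hG, ee]; ring)
      refine cK.trans (le_of_eq ?_)
      rw [hW, integral_add (i1.const_mul _) (i2.const_mul _), integral_const_mul, integral_const_mul,
        integral_indicator Srm, integral_indicator (sm k)]
    have := ge_of_tendsto tl2 main
    refine this.trans (le_of_eq ?_)
    ring
  have Q0 := zero_of_exp (setIntegral_nonneg K0c.measurableSet fun z _ => QQ_nonneg u z) hδ key
  rw [setIntegral_eq_zero_iff_of_nonneg_ae (Eventually.of_forall fun z => QQ_nonneg u z) QI] at Q0
  have bs : Metric.ball ((x, t) : ZZ n) ρ ⊆ K0 := Metric.ball_subset_closedBall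
  have ae : u =ᵐ[volume.restrict (Metric.ball ((x, t) : ZZ n) ρ)] fun _ => 0 := by
    have := ae_restrict_of_ae_restrict_of_subset bs Q0
    filter_upwards [this] with z hz
    have hz : u z ^ 2 + ∑ i, gx i u z ^ 2 = 0 := hz
    have h2 : 0 ≤ ∑ i, gx i u z ^ 2 := Finset.sum_nonneg fun _ _ => sq_nonneg _
    exact pow_eq_zero_iff (two_ne_zero) |>.1 (le_antisymm (by linarith only [hz, h2]) (sq_nonneg _))
  exact Measure.eqOn_open_of_ae_eq ae Metric.isOpen_ball (h.cont.mono (bs.trans K0s)) continuousOn_const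
    (Metric.mem_ball_self ρ0)
end core

section asm
variable {n : ℕ}

theorem lap_eq {g : EE n → ℝ} {x : EE n} (h : ContDiffAt ℝ 2 g x) : lap g x = ∑ i, d2 (bb i) g x := by
  refine Finset.sum_congr rfl fun i _ => ?_
  rw [iteratedFDeriv_two_apply]
  have hd : DifferentiableAt ℝ (fderiv ℝ g) x :=
    (h.fderiv_right (m := 1) (by norm_num)).differentiableAt (by norm_num)
  change fderiv ℝ (fderiv ℝ g) x (bb i) (bb i) = fderiv ℝ (fun y => fderiv ℝ g y (bb i)) x (bb i)
  rw [fderiv_clm_apply hd (differentiableAt_const _)]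
  simp

theorem grad_eq (g : EE n → ℝ) (x : EE n) : ‖gradient g x‖ = √(∑ i, (fderiv ℝ g x (bb i)) ^ 2) := by
  rw [EuclideanSpace.norm_eq]
  congr 1
  refine Finset.sum_congr rfl fun i _ => ?_
  rw [← inner_gradient_left, bb, EuclideanSpace.inner_single_right]
  simp

theorem step {i0 : Fin n} {c₁ M : ℝ} (hc : 0 ≤ c₁) (hc1 : c₁ < 13 / 20) (hM : 0 < M) :
    ∃ τ, 0 < τ ∧ ∀ u : EE n → ℝ → ℝ,
      ContinuousOn (fun p : ZZ n => u p.1 p.2) (cn i0 c₁ ×ˢ Ico 0 1) →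
      (∀ t ∈ Ioo (0 : ℝ) 1, ContDiffOn ℝ 2 (fun x => u x t) (cn i0 c₁)) →
      (∀ x ∈ cn i0 c₁, ContDiffOn ℝ 1 (u x) (Ioo 0 1)) →
      (∀ x ∈ cn i0 c₁, ∀ t ∈ Ioo (0 : ℝ) 1,
        |deriv (u x) t + lap (fun y => u y t) x| ≤ M * (|u x t| + ‖gradient (fun y => u y t) x‖)) →
      (∀ x ∈ cn i0 c₁, ∀ t ∈ Ioo (0 : ℝ) 1, |u x t| ≤ M * Real.exp (M * ‖x‖ ^ 2)) →
      ∀ s, 0 ≤ s → s ≤ 1 / 2 → (∀ x ∈ cn i0 c₁, u x s = 0) →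
      ∀ x ∈ cn i0 c₁, ∀ t ∈ Ioo 0 τ, u x (s + t) = 0 := by
  obtain ⟨τ, hτ, H⟩ := core (n := n) (i0 := i0) (M := M) (M' := 2 * M) (T := 1 / 2) hc hc1 hM.le
    (by positivity) (by norm_num)
  refine ⟨τ, hτ, fun u hcont hx ht heq hg s s0 s1 hs x hxc t htt => ?_⟩
  have Oc := cn_open i0 c₁
  have lc : Continuous fun l : ℝ => x - l • (bb i0 : EE n) :=
    continuous_const.sub (continuous_id.smul continuous_const)
  obtain ⟨l, hl, l0⟩ : ∃ l : ℝ, x - l • (bb i0 : EE n) ∈ cn i0 c₁ ∧ 0 < l := by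
    have h1 : ∀ᶠ l in 𝓝 (0 : ℝ), x - l • (bb i0 : EE n) ∈ cn i0 c₁ :=
      lc.continuousAt.eventually (Oc.mem_nhds (by simpa using hxc))
    have h2 : ∀ᶠ l in 𝓝[>] (0 : ℝ), 0 < l := self_mem_nhdsWithin
    exact ((h1.filter_mono nhdsWithin_le_nhds).and h2).exists
  set x₁ : EE n := x - l • (bb i0 : EE n) with hx₁
  have tr : ∀ y ∈ cn i0 c₁, x₁ + y ∈ cn i0 c₁ := fun y hy => by
    have h1 : c₁ * ‖x₁‖ < x₁ i0 := hl
    have h2 : c₁ * ‖y‖ < y i0 := hy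
    have h3 := mul_le_mul_of_nonneg_left (norm_add_le x₁ y) hc
    change c₁ * ‖x₁ + y‖ < x₁ i0 + y i0
    linarith only [h1, h2, h3]
  set v : ZZ n → ℝ := fun z => if z.2 ≤ 0 then 0 else u (x₁ + z.1) (s + z.2) with hv
  have vp : ∀ y t, 0 < t → v (y, t) = u (x₁ + y) (s + t) := fun y t h => if_neg (not_le.2 h)
  have vS : Sol (cn i0 c₁) (1 / 2) M v := by
    refine ⟨Oc, hM.le, fun y t h => if_pos h, ?_, fun t h => ?_, fun y hy t h => ?_⟩
    · have cm : ContinuousOn (fun z : ZZ n => u (x₁ + z.1) (s + max z.2 0)) (cn i0 c₁ ×ˢ Iio (1 / 2)) := by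
        refine hcont.comp (f := fun z : ZZ n => (x₁ + z.1, s + max z.2 0)) ?_ fun z hz => ⟨tr _ hz.1, ?_, ?_⟩
        · exact ((continuous_const.add continuous_fst).prodMk
            (continuous_const.add (continuous_snd.max continuous_const))).continuousOn
        · exact add_nonneg s0 (le_max_right _ _)
        · have : max z.2 0 < 1 / 2 := max_lt hz.2 (by norm_num)
          change s + max z.2 0 < 1
          linarith only [this, s1]
      refine cm.congr fun z hz => ?_
      simp only [hv]
      split_ifs with h
      · rw [max_eq_right h, add_zero, hs _ (tr _ hz.1)]
      · rw [max_eq_left (not_le.1 h).le]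
    · have e : (fun y => v (y, t)) = fun y => u (x₁ + y) (s + t) := funext fun y => vp y t h.1
      rw [e]
      exact (hx (s + t) ⟨by linarith [h.1], by linarith [h.2]⟩).comp
        (contDiff_const.add contDiff_id).contDiffOn fun y hy => tr y hy
    · have st : s + t ∈ Ioo (0 : ℝ) 1 := ⟨by linarith [h.1], by linarith [h.2]⟩
      have yc := tr y hy
      set g : EE n → ℝ := fun w => u w (s + t) with hg'
      have e : (fun y => v (y, t)) = fun y => g (x₁ + y) := funext fun y => vp y t h.1
      have gC : ContDiffAt ℝ 2 g (x₁ + y) := (hx _ st).contDiffAt (Oc.mem_nhds yc)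
      have f1 : ∀ i, gx i v (y, t) = fderiv ℝ g (x₁ + y) (bb i) := fun i => by
        change fderiv ℝ (fun y => v (y, t)) y (bb i) = _
        rw [e, fderiv_comp_add_left]
      have f2 : ∀ i, gx i (gx i v) (y, t) = d2 (bb i) g (x₁ + y) := fun i => by
        rw [gx_gx, e, d2, d2]
        simp only [fderiv_comp_add_left (f := g)]
        rw [fderiv_comp_add_left (f := fun y => fderiv ℝ g y (bb i))]
      refine ⟨deriv (u (x₁ + y)) (s + t), ?_, ?_⟩
      · have d1 : HasDerivAt (u (x₁ + y)) (deriv (u (x₁ + y)) (s + t)) (s + t) :=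
          (((ht _ yc).contDiffAt (isOpen_Ioo.mem_nhds st)).differentiableAt (by norm_num)).hasDerivAt
        have d3 := d1.comp_const_add s t
        refine d3.congr_of_eventuallyEq ?_
        filter_upwards [Ioi_mem_nhds h.1] with r hr using vp y r hr
      · have := heq _ yc _ st
        rw [lap_eq gC, grad_eq] at this
        simp only [f1, f2]
        rw [vp y t h.1]
        exact this
  have vg : ∀ y ∈ cn i0 c₁, ∀ t < (1 / 2 : ℝ), |v (y, t)| ≤ M * Real.exp (2 * M * ‖x₁‖ ^ 2) * Real.exp (2 * M * ‖y‖ ^ 2) := by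
    intro y hy t h
    rcases le_or_gt t 0 with h0 | h0
    · rw [show v (y, t) = 0 from if_pos h0, abs_zero]; positivity
    · rw [vp y t h0, mul_assoc, ← Real.exp_add]
      refine (hg _ (tr y hy) _ ⟨by linarith, by linarith⟩).trans (mul_le_mul_of_nonneg_left ?_ hM.le)
      rw [Real.exp_le_exp]
      have h1 := pow_le_pow_left₀ (norm_nonneg _) (norm_add_le x₁ y) 2
      have h2 := mul_le_mul_of_nonneg_left h1 hM.le
      have h3 := mul_nonneg hM.le (sq_nonneg (‖x₁‖ - ‖y‖))
      linarith only [h2, h3]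
  have fin := H v _ (by positivity) vS vg (l • bb i0) (by
    rw [norm_smul, bb, EuclideanSpace.norm_single]
    simp [abs_of_pos l0]
    linarith only [l0]) t htt
  rw [vp _ _ htt.1] at fin
  rwa [hx₁, sub_add_cancel] at fin

theorem fin_step {i0 : Fin n} {c₁ M : ℝ} (hc : 0 ≤ c₁) (hc1 : c₁ < 13 / 20) (hM : 0 < M) (u : EE n → ℝ → ℝ)
    (h1 : ContinuousOn (fun p : ZZ n => u p.1 p.2) (cn i0 c₁ ×ˢ Ico 0 1))
    (h2 : ∀ t ∈ Ioo (0 : ℝ) 1, ContDiffOn ℝ 2 (fun x => u x t) (cn i0 c₁))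
    (h3 : ∀ x ∈ cn i0 c₁, ContDiffOn ℝ 1 (u x) (Ioo 0 1))
    (h4 : ∀ x ∈ cn i0 c₁, ∀ t ∈ Ioo (0 : ℝ) 1,
        |deriv (u x) t + lap (fun y => u y t) x| ≤ M * (|u x t| + ‖gradient (fun y => u y t) x‖))
    (h5 : ∀ x ∈ cn i0 c₁, ∀ t ∈ Ioo (0 : ℝ) 1, |u x t| ≤ M * Real.exp (M * ‖x‖ ^ 2))
    (h6 : ∀ x ∈ cn i0 c₁, u x 0 = 0) : ∀ x ∈ cn i0 c₁, ∀ t, 0 ≤ t → t ≤ 1 / 2 → u x t = 0 := by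
  obtain ⟨τ, hτ, H⟩ := step (n := n) (i0 := i0) hc hc1 hM
  have H := H u h1 h2 h3 h4 h5
  have ind : ∀ k : ℕ, ∀ x ∈ cn i0 c₁, ∀ t, 0 ≤ t → t ≤ 1 / 2 → t ≤ k * (τ / 2) → u x t = 0 := by
    intro k
    induction k with
    | zero =>
      intro x hx t t0 _ t1
      have : t = 0 := le_antisymm (by simpa using t1) t0
      rw [this]; exact h6 x hx
    | succ k ih =>
      intro x hx t t0 t2 t1
      rcases le_or_gt t (k * (τ / 2)) with h | h
      · exact ih x hx t t0 t2 h
      · push_cast at t1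
        have s0 : 0 ≤ (k : ℝ) * (τ / 2) := by positivity
        have := H (k * (τ / 2)) s0 (h.le.trans t2) (fun y hy => ih y hy _ s0 (h.le.trans t2) le_rfl) x hx
          (t - k * (τ / 2)) ⟨by linarith, by linarith⟩
        rwa [add_sub_cancel] at this
  intro x hx t t0 t1
  obtain ⟨k, hk⟩ := exists_nat_gt (t / (τ / 2))
  refine ind k x hx t t0 t1 ?_
  rw [div_lt_iff₀ (by positivity)] at hk
  exact hk.le

theorem cone_eq (hn : 0 < n) (θ : ℝ) : cone hn θ = cn ⟨0, hn⟩ (Real.cos (θ / 2)) := by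
  ext x; simp only [cone, cn, mem_setOf_eq, mul_comm]

theorem cos_bd {θ : ℝ} (hθ : θ ∈ Ioo (2 * Real.arccos (Real.sqrt (73 / 173))) Real.pi) :
    0 ≤ Real.cos (θ / 2) ∧ Real.cos (θ / 2) < 13 / 20 := by
  have a0 := Real.arccos_nonneg (Real.sqrt (73 / 173))
  have h1 : Real.arccos (Real.sqrt (73 / 173)) < θ / 2 := by linarith [hθ.1]
  have h2 : θ / 2 < Real.pi / 2 := by linarith [hθ.2]
  have pp := Real.pi_pos
  refine ⟨Real.cos_nonneg_of_neg_pi_div_two_le_of_le (by linarith) h2.le, ?_⟩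
  have h3 := Real.cos_lt_cos_of_nonneg_of_le_pi a0 (by linarith) h1
  have h4 : Real.sqrt (73 / 173) < 13 / 20 := by
    rw [Real.sqrt_lt' (by norm_num)]; norm_num
  rw [Real.cos_arccos (by linarith [Real.sqrt_nonneg (73 / 173)]) (by linarith)] at h3
  linarith
end asm

end Mine

/-- with `θ ∈ (2 arccos √(73/173), π)`, `M > 0` and
`T₁ = min{1/(256M), 1/(12M²), 1/2}`: if `u` is continuous on `C_θ × [0,1)`,
`C²` in `x` and `C¹` in `t` on `C_θ × (0,1)`, satisfies `|∂ₜu + Δu| ≤ M(|u|+|∇u|)`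
and `|u| ≤ M e^{M|x|²}` on `C_θ × (0,1)`, and `u(·,0) = 0` on `C_θ`, then
`u = 0` on `C_θ × (0,T₁)`. -/
theorem stmt_2 (n : ℕ) (hn : 2 ≤ n) (θ M : ℝ)
    (hθ : θ ∈ Ioo (2 * Real.arccos (Real.sqrt (73 / 173))) Real.pi)
    (hM : 0 < M)
    (u : EuclideanSpace ℝ (Fin n) → ℝ → ℝ)
    (hcont : ContinuousOn (fun p : EuclideanSpace ℝ (Fin n) × ℝ => u p.1 p.2)
      ((cone (by omega) θ) ×ˢ Ico 0 1))
    (hreg_x : ∀ t ∈ Ioo (0 : ℝ) 1, ContDiffOn ℝ 2 (fun x => u x t) (cone (by omega) θ))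
    (hreg_t : ∀ x ∈ cone (n := n) (by omega) θ, ContDiffOn ℝ 1 (u x) (Ioo 0 1))
    (heq : ∀ x ∈ cone (n := n) (by omega) θ, ∀ t ∈ Ioo (0 : ℝ) 1,
      |deriv (u x) t + lap (fun y => u y t) x|
        ≤ M * (|u x t| + ‖gradient (fun y => u y t) x‖))
    (hgrowth : ∀ x ∈ cone (n := n) (by omega) θ, ∀ t ∈ Ioo (0 : ℝ) 1,
      |u x t| ≤ M * Real.exp (M * ‖x‖ ^ 2))
    (hinit : ∀ x ∈ cone (n := n) (by omega) θ, u x 0 = 0) :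
    ∀ x ∈ cone (n := n) (by omega) θ,
      ∀ t ∈ Ioo (0 : ℝ) (min (1 / (256 * M)) (min (1 / (12 * M ^ 2)) (1 / 2))),
        u x t = 0 := by
  simp only [cone_eq] at hcont hreg_x hreg_t heq hgrowth hinit ⊢
  obtain ⟨c0, c1⟩ := cos_bd hθ
  intro x hx t ht
  exact fin_step c0 c1 hM u hcont hreg_x hreg_t heq hgrowth hinit x hx t ht.1.le
    (ht.2.le.trans ((min_le_right _ _).trans (min_le_right _ _)))
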